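/- Let v ∈ W^{1,2}_loc(B) be a weak solution of div(A∇v) = 0 in B = B(0,1) ⊆ ℝ^k, with v not identically zero. Then there exist constants ρ₀ > 0, C₁ > 0 and C₂ > 0, depending only on k, the Lipschitz constant of the entries of A and the ellipticity constant of A, such that for every x ∈ B(0,1/2) and all radii with 0 < 2r₁ < r₂ < ρ₀, one has (r₂/r₁)^{C₁⁻¹·𝒩_v(x,r₁) − C₂} ≤ H_v(x,r₂)/H_v(x,r₁) ≤ (r₂/r₁)^{C₁·𝒩_v(x,r₂) + C₂}. -/

import Mathlib

open MeasureTheory Metric Set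
open scoped ENNReal NNReal Topology ContDiff

noncomputable section
attribute [local instance] Classical.propDecidable

abbrev Euc (n : ℕ) := EuclideanSpace ℝ (Fin n)

/-- The gradient vector of `v` at `x`, as a tuple of partial derivatives. -/
def gradVec {k : ℕ} (v : Euc k → ℝ) (x : Euc k) : Fin k → ℝ :=
  fun i => fderiv ℝ v x (EuclideanSpace.single i 1)

/-- The bilinear form `⟨A ξ, ζ⟩ = ∑ i j, A i j * ξ j * ζ i` associated with a matrix. -/
def aForm {k : ℕ} (A : Matrix (Fin k) (Fin k) ℝ) (ξ ζ : Fin k → ℝ) : ℝ :=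
  ∑ i, ∑ j, A i j * ξ j * ζ i

/-- `A` is uniformly elliptic with constant `Λ` on `U`:
`Λ⁻¹|ξ|² ≤ ⟨A(x)ξ, ξ⟩ ≤ Λ|ξ|²` for all `x ∈ U`, `ξ ∈ ℝᵏ`. -/
def UnifElliptic {k : ℕ} (A : Euc k → Matrix (Fin k) (Fin k) ℝ) (Λ : ℝ) (U : Set (Euc k)) :
    Prop :=
  ∀ x ∈ U, ∀ ξ : Fin k → ℝ,
    Λ⁻¹ * (∑ i, ξ i ^ 2) ≤ aForm (A x) ξ ξ ∧ aForm (A x) ξ ξ ≤ Λ * (∑ i, ξ i ^ 2)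

/-- The entries of `A` are Lipschitz with constant `L` on `U`. -/
def LipEntries {k : ℕ} (A : Euc k → Matrix (Fin k) (Fin k) ℝ) (L : ℝ≥0) (U : Set (Euc k)) :
    Prop :=
  ∀ i j, LipschitzOnWith L (fun x => A x i j) U

/-- `v` is a weak solution of `div(A ∇v) = 0` in `U`:
`∫_U ⟨A(x)∇v(x), ∇ψ(x)⟩ dx = 0` for every test function `ψ ∈ C_c^∞(U)`. -/
def IsWeakSol {k : ℕ} (A : Euc k → Matrix (Fin k) (Fin k) ℝ) (v : Euc k → ℝ)
    (U : Set (Euc k)) : Prop :=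
  ∀ ψ : Euc k → ℝ, ContDiff ℝ ∞ ψ → HasCompactSupport ψ → tsupport ψ ⊆ U →
    ∫ x in U, aForm (A x) (gradVec v x) (gradVec ψ x) = 0

/-- `α(x) = ⟨A(x)x, x⟩/|x|²`, with `α(0) = 1`. -/
def alphaFn {k : ℕ} (A : Euc k → Matrix (Fin k) (Fin k) ℝ) (x : Euc k) : ℝ :=
  if x = 0 then 1 else aForm (A x) (fun i => x i) (fun i => x i) / ‖x‖ ^ 2

/-- `H_v(x,r) = ∫_{B(x,r)} α v²`. -/
def Hfun {k : ℕ} (A : Euc k → Matrix (Fin k) (Fin k) ℝ) (v : Euc k → ℝ) (x : Euc k)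
    (r : ℝ) : ℝ :=
  ∫ z in ball x r, alphaFn A z * v z ^ 2

/-- The frequency function `N_v(x,r) = r ∂_r H_v(x,r) / H_v(x,r)`. -/
def freqN {k : ℕ} (A : Euc k → Matrix (Fin k) (Fin k) ℝ) (v : Euc k → ℝ) (x : Euc k)
    (r : ℝ) : ℝ :=
  r * deriv (Hfun A v x) r / Hfun A v x r

/-- The doubling index `𝒩_v(x,r) = log (H_v(x,2r) / H_v(x,r))`. -/
def doubN {k : ℕ} (A : Euc k → Matrix (Fin k) (Fin k) ℝ) (v : Euc k → ℝ) (x : Euc k)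
    (r : ℝ) : ℝ :=
  Real.log (Hfun A v x (2 * r) / Hfun A v x r)

set_option linter.unusedSectionVars false

section PartOne
open Filter Function
open scoped RealInnerProductSpace Convolution

variable {E : Type*} [NormedAddCommGroup E] [InnerProductSpace ℝ E] [FiniteDimensional ℝ E]
  [MeasurableSpace E] [BorelSpace E]
variable {F : Type*} [NormedAddCommGroup F] [NormedSpace ℝ F]

lemma lip_of_loc {f : E → F} (hf : LocallyLipschitz f) (hc : HasCompactSupport f) :
    ∃ C : ℝ≥0, LipschitzWith C f := by
  obtain ⟨R0, hR0⟩ := (IsCompact.isBounded hc).subset_closedBall (0 : E)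
  set R := max R0 1 with hR
  have hR1 : 1 ≤ R := le_max_right _ _
  have hsup : ∀ x, x ∉ closedBall (0 : E) R → f x = 0 := by
    intro x hx
    by_contra h
    exact hx (closedBall_subset_closedBall (le_max_left _ _) (hR0 (subset_tsupport _ h)))
  obtain ⟨K, hK⟩ := (hf.locallyLipschitzOn (s := closedBall (0 : E) (2 * R))).exists_lipschitzOnWith_of_compact
    (isCompact_closedBall _ _)
  obtain ⟨M, hM⟩ := hc.exists_bound_of_continuous hf.continuous
  have hM0 : 0 ≤ M := (norm_nonneg _).trans (hM 0)
  have key : ∀ x y, x ∉ closedBall (0 : E) (2 * R) → dist (f x) (f y) ≤ M * dist x y := by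
    intro x y hx
    have h1 : f x = 0 := hsup x (fun h => hx (closedBall_subset_closedBall (by linarith) h))
    by_cases hy : y ∈ closedBall (0 : E) R
    · rw [h1, dist_zero_left]
      have : 1 ≤ dist x y := by
        have := dist_triangle x y 0
        simp only [mem_closedBall, not_le] at hx hy
        linarith
      nlinarith [hM y]
    · rw [h1, hsup y hy, dist_self]; positivity
  refine ⟨K + ⟨M, hM0⟩, LipschitzWith.of_dist_le_mul fun x y => ?_⟩
  have e : ((K + ⟨M, hM0⟩ : ℝ≥0) : ℝ) = K + M := rfl
  rw [e, add_mul]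
  have p1 : 0 ≤ (K : ℝ) * dist x y := by positivity
  have p2 : 0 ≤ M * dist x y := by positivity
  by_cases hx : x ∈ closedBall (0 : E) (2 * R)
  · by_cases hy : y ∈ closedBall (0 : E) (2 * R)
    · have := hK.dist_le_mul x hx y hy
      linarith
    · have := key y x hy
      rw [dist_comm, dist_comm y x] at this
      linarith
  · have := key x y hx
    linarith

theorem weak_lip {V : E → E} (hV : Continuous V) {U : Set E} (hU : IsOpen U)
    (hw : ∀ ψ : E → ℝ, ContDiff ℝ ∞ ψ → HasCompactSupport ψ → tsupport ψ ⊆ U →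
      ∫ x, fderiv ℝ ψ x (V x) = 0)
    {ψ : E → ℝ} {C : ℝ≥0} (hψ : LipschitzWith C ψ) (hc : HasCompactSupport ψ)
    (hs : tsupport ψ ⊆ U) : ∫ x, fderiv ℝ ψ x (V x) = 0 := by
  obtain ⟨δ, hδ, hδU⟩ := IsCompact.exists_cthickening_subset_open hc hU hs
  set K := cthickening δ (tsupport ψ) with hKdef
  have hK : IsCompact K := IsCompact.cthickening hc
  let φ : ℕ → ContDiffBump (0 : E) := fun n =>
    ⟨δ / (2 * (n + 1)), δ / (n + 1), by positivity, by
      apply div_lt_div_of_pos_left hδ (by positivity)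
      have : (0 : ℝ) < n + 1 := by positivity
      linarith⟩
  have hφ : Tendsto (fun n => (φ n).rOut) atTop (𝓝 0) :=
    (tendsto_const_div_atTop_nhds_zero_nat δ).comp (tendsto_add_atTop_nat 1) |>.congr
      (fun n => by simp [φ])
  have hφ' : ∀ᶠ n in atTop, (φ n).rOut ≤ 2 * (φ n).rIn := by
    filter_upwards with n
    change δ / (n + 1) ≤ 2 * (δ / (2 * (n + 1)))
    apply le_of_eq
    field_simp
  have hfd : ∀ x, ‖fderiv ℝ ψ x‖ ≤ C := fun x => norm_fderiv_le_of_lipschitz ℝ hψ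
  have hmeas : Measurable (fderiv ℝ ψ) := measurable_fderiv ℝ ψ
  have hli : LocallyIntegrable (fderiv ℝ ψ) (volume : Measure E) :=
    (memLp_top_of_bound hmeas.aestronglyMeasurable (C : ℝ) (.of_forall hfd)).locallyIntegrable le_top
  let ψn : ℕ → E → ℝ := fun n => ((φ n).normed volume ⋆[ContinuousLinearMap.lsmul ℝ ℝ, volume] ψ)
  let gn : ℕ → E → (E →L[ℝ] ℝ) := fun n =>
    ((φ n).normed volume ⋆[ContinuousLinearMap.lsmul ℝ ℝ, volume] (fderiv ℝ ψ))
  have hdiff : ∀ᵐ x : E, DifferentiableAt ℝ ψ x := hψ.ae_differentiableAt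
  have hder : ∀ n x, HasFDerivAt (ψn n) (gn n x) x := by
    intro n x
    have hcn : Continuous ((φ n).normed (volume : Measure E)) := (φ n).continuous_normed
    have hin : Integrable ((φ n).normed (volume : Measure E)) := (φ n).integrable_normed
    refine (hasFDerivAt_integral_of_dominated_loc_of_lip' (μ := (volume : Measure E))
      (F := fun x t => (φ n).normed volume t * ψ (x - t))
      (F' := fun t => (φ n).normed volume t • fderiv ℝ ψ (x - t))
      (bound := fun t => (φ n).normed volume t * C) (s := univ) univ_mem ?_ ?_ ?_ ?_ ?_ ?_).2
    · intro y _
      exact (hcn.mul (hψ.continuous.comp (by fun_prop))).aestronglyMeasurable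
    · apply Continuous.integrable_of_hasCompactSupport
      · exact (hcn.mul (hψ.continuous.comp (by fun_prop)))
      · exact HasCompactSupport.mul_right (φ n).hasCompactSupport_normed
    · exact hcn.aestronglyMeasurable.smul (hmeas.comp (by fun_prop)).aestronglyMeasurable
    · refine .of_forall fun t y _ => ?_
      rw [← mul_sub, norm_mul, Real.norm_of_nonneg ((φ n).nonneg_normed t), mul_assoc]
      gcongr
      · exact (φ n).nonneg_normed t
      · have := hψ.norm_sub_le (y - t) (x - t)
        simpa using this
    · exact hin.mul_const _
    · have h2 : ∀ᵐ t : E, DifferentiableAt ℝ ψ (x - t) :=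
        (Measure.measurePreserving_sub_left (volume : Measure E) x).quasiMeasurePreserving.ae hdiff
      filter_upwards [h2] with t ht
      have h3 : HasFDerivAt (fun y => ψ (y - t)) (fderiv ℝ ψ (x - t)) x := by
        have := ht.hasFDerivAt.comp x ((hasFDerivAt_id x).sub_const t)
        simpa using! this
      exact h3.const_mul _
  have hsupp : ∀ n, support (ψn n) ⊆ K := by
    intro n x hx
    have := support_convolution_subset (ContinuousLinearMap.lsmul ℝ ℝ) hx
    obtain ⟨a, ha, b, hb, rfl⟩ := this
    rw [(φ n).support_normed_eq, mem_ball, dist_zero_right] at ha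
    refine mem_cthickening_of_dist_le _ b δ _ (subset_tsupport _ hb) ?_
    have h5 : (φ n).rOut ≤ δ := by
      change δ / (n + 1) ≤ δ
      apply div_le_self hδ.le
      have : (0 : ℝ) ≤ n := by positivity
      linarith
    simp only [dist_add_self_left]
    linarith
  have hts : ∀ n, tsupport (ψn n) ⊆ K := fun n =>
    closure_minimal (hsupp n) isClosed_cthickening
  have hzero : ∀ n, ∫ x, gn n x (V x) = 0 := by
    intro n
    have h1 := hw (ψn n) ?_ (hK.of_isClosed_subset (isClosed_tsupport _) (hts n)) ((hts n).trans hδU)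
    · rw [← h1]
      congr 1; ext x; rw [(hder n x).fderiv]
    · exact HasCompactSupport.contDiff_convolution_left _ (φ n).hasCompactSupport_normed
        (φ n).contDiff_normed hψ.continuous.locallyIntegrable
  have hgb : ∀ n x, ‖gn n x‖ ≤ C := by
    intro n x
    have h1 : ‖gn n x‖ ≤ ∫ t, (φ n).normed (volume : Measure E) t * (C : ℝ) := by
      apply norm_integral_le_of_norm_le
      · exact (φ n).integrable_normed.mul_const _
      · refine .of_forall fun t => ?_
        simp only [ContinuousLinearMap.lsmul_apply, norm_smul]
        rw [Real.norm_of_nonneg ((φ n).nonneg_normed t)]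
        gcongr
        · exact (φ n).nonneg_normed t
        · exact hfd _
    rwa [integral_mul_const, (φ n).integral_normed, one_mul] at h1
  have hg0 : ∀ n x, x ∉ K → gn n x = 0 := by
    intro n x hx
    have h1 : ψn n =ᶠ[𝓝 x] fun _ => 0 := by
      filter_upwards [isClosed_cthickening.isOpen_compl.mem_nhds hx] with y hy
      by_contra h
      exact hy (hsupp n h)
    exact ((hder n x).congr_of_eventuallyEq h1.symm).unique (hasFDerivAt_const (0:ℝ) x)
  have hlim : Tendsto (fun n => ∫ x, gn n x (V x)) atTop (𝓝 (∫ x, fderiv ℝ ψ x (V x))) := by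
    apply tendsto_integral_of_dominated_convergence (K.indicator fun x => C * ‖V x‖)
    · intro n
      have h1 : gn n = fderiv ℝ (ψn n) := by ext1 x; rw [(hder n x).fderiv]
      have h2 : Measurable (gn n) := by rw [h1]; exact measurable_fderiv ℝ _
      exact (isBoundedBilinearMap_apply.continuous.measurable.comp
        (h2.prodMk hV.measurable)).aestronglyMeasurable
    · rw [integrable_indicator_iff hK.measurableSet]
      exact ContinuousOn.integrableOn_compact hK (by fun_prop)
    · intro n
      refine .of_forall fun x => ?_
      by_cases hx : x ∈ K
      · rw [indicator_of_mem hx]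
        exact ((gn n x).le_opNorm _).trans (by gcongr; exact hgb n x)
      · rw [indicator_of_notMem hx, hg0 n x hx]; simp
    · filter_upwards [ContDiffBump.ae_convolution_tendsto_right_of_locallyIntegrable hφ hφ' hli]
        with x hx
      exact ((ContinuousLinearMap.apply ℝ ℝ (V x)).continuous.tendsto _).comp hx
  simp only [hzero] at hlim
  exact (tendsto_nhds_unique hlim tendsto_const_nhds)

end PartOne


section PartTwo
open Filter Function
open scoped RealInnerProductSpace

variable {E : Type*} [NormedAddCommGroup E] [InnerProductSpace ℝ E] [FiniteDimensional ℝ E]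
  [MeasurableSpace E] [BorelSpace E]
variable {F : Type*} [NormedAddCommGroup F] [NormedSpace ℝ F]

lemma loclip_smul {f : E → ℝ} {g : E → F} (hf : LocallyLipschitz f) (hg : LocallyLipschitz g) :
    LocallyLipschitz (fun x => f x • g x) :=
  (show LocallyLipschitz (fun p : ℝ × F => p.1 • p.2) from
    (contDiff_fst.smul contDiff_snd : ContDiff ℝ 1 _).locallyLipschitz).comp (hf.prodMk hg)

lemma loclip_mul {f g : E → ℝ} (hf : LocallyLipschitz f) (hg : LocallyLipschitz g) :
    LocallyLipschitz (fun x => f x * g x) := loclip_smul hf hg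

lemma tendsto_line {f : E → F} {f' : E →L[ℝ] F} {x : E} (h : HasFDerivAt f f' x) (e : E) :
    Tendsto (fun t : ℝ => t⁻¹ • (f (x + t • e) - f x)) (𝓝[>] 0) (𝓝 (f' e)) :=
  (h.hasLineDerivAt e).tendsto_slope_zero_right

theorem rellich_scalar {a : E → E →L[ℝ] E} {La : ℝ≥0} (ha : LipschitzWith La a)
    (hsym : ∀ x v w, ⟪a x v, w⟫ = ⟪v, a x w⟫)
    {u : E → ℝ} {g : E → E} (hu : ∀ x, HasFDerivAt u (innerSL ℝ (g x)) x) (hg : Continuous g)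
    {M : ℝ} (hM : ∀ x, ‖g x‖ ≤ M)
    {U : Set E} (hU : IsOpen U)
    (hw : ∀ ψ : E → ℝ, ContDiff ℝ ∞ ψ → HasCompactSupport ψ → tsupport ψ ⊆ U →
      ∫ x, fderiv ℝ ψ x (a x (g x)) = 0)
    {ζ : E → ℝ} {C : ℝ≥0} (hζ : LipschitzWith C ζ) (hc : HasCompactSupport ζ)
    (hs : tsupport ζ ⊆ U) (e : E) :
    ∫ x, fderiv ℝ ζ x (a x (g x)) * (2 * ⟪g x, e⟫) =
      ∫ x, ⟪fderiv ℝ (fun x => ζ x • a x) x e (g x), g x⟫ := by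
  have hM0 : 0 ≤ M := (norm_nonneg _).trans (hM 0)
  have hV : Continuous fun x => a x (g x) := ha.continuous.clm_apply hg
  have huC : ContDiff ℝ 1 u := by
    rw [contDiff_one_iff_fderiv]
    refine ⟨fun x => (hu x).differentiableAt, ?_⟩
    have : fderiv ℝ u = fun x => innerSL ℝ (g x) := by ext1 x; exact (hu x).fderiv
    rw [this]; fun_prop
  have huL : LipschitzWith M.toNNReal u := by
    apply lipschitzWith_of_nnnorm_fderiv_le (𝕜 := ℝ) (fun x => (hu x).differentiableAt)
    intro x
    rw [(hu x).fderiv, ← NNReal.coe_le_coe, Real.coe_toNNReal _ hM0]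
    simpa using hM x
  set K := cthickening ‖e‖ (tsupport ζ) with hKdef
  have hK : IsCompact K := IsCompact.cthickening hc
  have hζ0 : ∀ x, x ∉ K → ζ x = 0 := by
    intro x hx
    by_contra h
    exact hx (self_subset_cthickening _ (subset_tsupport _ h))
  have hdζ0 : ∀ x, x ∉ K → fderiv ℝ ζ x = 0 := by
    intro x hx
    have h1 : ζ =ᶠ[𝓝 x] fun _ => 0 := by
      filter_upwards [isClosed_cthickening.isOpen_compl.mem_nhds hx] with y hy
      exact hζ0 y hy
    rw [h1.fderiv_eq]; simp
  have hmζ : Measurable (fderiv ℝ ζ) := measurable_fderiv ℝ ζ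
  have hfd : ∀ x, ‖fderiv ℝ ζ x‖ ≤ C := fun x => norm_fderiv_le_of_lipschitz ℝ hζ
  have hmV : Measurable fun x => fderiv ℝ ζ x (a x (g x)) :=
    isBoundedBilinearMap_apply.continuous.measurable.comp (hmζ.prodMk hV.measurable)
  have hFloc : LocallyLipschitz (fun x => ζ x • a x) :=
    loclip_smul hζ.locallyLipschitz ha.locallyLipschitz
  obtain ⟨CF, hCF⟩ := lip_of_loc hFloc hc.smul_right
  have hdiff : ∀ᵐ x : E, DifferentiableAt ℝ ζ x := hζ.ae_differentiableAt
  have hdiffF : ∀ᵐ x : E, DifferentiableAt ℝ (fun x => ζ x • a x) x := hCF.ae_differentiableAt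
  -- identity at positive t
  have hid : ∀ t : ℝ, ∫ x, fderiv ℝ ζ x (a x (g x)) * (u (x + t • e) - u (x - t • e)) =
      ∫ x, ⟪(ζ (x + t • e) • a (x + t • e) - ζ x • a x) (g x), g (x + t • e)⟫ := by
    intro t
    have hDc : ContDiff ℝ 1 (fun x => u (x + t • e) - u (x - t • e)) :=
      (huC.comp (contDiff_id.add contDiff_const)).sub (huC.comp (contDiff_id.sub contDiff_const))
    have hψl : LocallyLipschitz (fun x => ζ x * (u (x + t • e) - u (x - t • e))) :=
      loclip_mul hζ.locallyLipschitz hDc.locallyLipschitz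
    have hψc : HasCompactSupport (fun x => ζ x * (u (x + t • e) - u (x - t • e))) := hc.mul_right
    obtain ⟨Cψ, hCψ⟩ := lip_of_loc hψl hψc
    have h0 := weak_lip hV hU hw hCψ hψc ((tsupport_mul_subset_left).trans hs)
    have hd : ∀ x, HasFDerivAt (fun x => u (x + t • e) - u (x - t • e))
        (innerSL ℝ (g (x + t • e)) - innerSL ℝ (g (x - t • e))) x := by
      intro x
      have h1 := (hu (x + t • e)).comp x ((hasFDerivAt_id x).add_const (t • e))
      have h2 := (hu (x - t • e)).comp x ((hasFDerivAt_id x).sub_const (t • e))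
      simpa using! h1.sub h2
    have h1 : ∫ x, fderiv ℝ (fun x => ζ x * (u (x + t • e) - u (x - t • e))) x (a x (g x)) =
        ∫ x, (fderiv ℝ ζ x (a x (g x)) * (u (x + t • e) - u (x - t • e)) +
          (ζ x * ⟪g (x + t • e), a x (g x)⟫ - ζ x * ⟪g (x - t • e), a x (g x)⟫)) := by
      apply integral_congr_ae
      filter_upwards [hdiff] with x hx
      rw [(hx.hasFDerivAt.fun_mul (hd x)).fderiv]
      simp
      ring
    have c1 : Continuous fun x => ζ x * ⟪g (x + t • e), a x (g x)⟫ :=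
      hζ.continuous.mul ((hg.comp (by fun_prop)).inner hV)
    have c2 : Continuous fun x => ζ x * ⟪g (x - t • e), a x (g x)⟫ :=
      hζ.continuous.mul ((hg.comp (by fun_prop)).inner hV)
    have i1 : Integrable fun x => ζ x * ⟪g (x + t • e), a x (g x)⟫ :=
      c1.integrable_of_hasCompactSupport hc.mul_right
    have i2 : Integrable fun x => ζ x * ⟪g (x - t • e), a x (g x)⟫ :=
      c2.integrable_of_hasCompactSupport hc.mul_right
    have i0 : Integrable fun x => fderiv ℝ ζ x (a x (g x)) * (u (x + t • e) - u (x - t • e)) := by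
      have ib : Integrable (K.indicator fun x => C * ‖a x (g x)‖ * ‖u (x + t • e) - u (x - t • e)‖) := by
        rw [integrable_indicator_iff hK.measurableSet]
        exact ContinuousOn.integrableOn_compact hK
          ((continuous_const.mul hV.norm).mul hDc.continuous.norm).continuousOn
      refine ib.mono' (hmV.mul hDc.continuous.measurable).aestronglyMeasurable
        (.of_forall fun x => ?_)
      by_cases hx : x ∈ K
      · rw [indicator_of_mem hx, norm_mul]
        gcongr
        exact ((fderiv ℝ ζ x).le_opNorm _).trans (by gcongr; exact hfd x)
      · rw [indicator_of_notMem hx, hdζ0 x hx]; simp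
    have i12 : Integrable fun x => ζ x * ⟪g (x + t • e), a x (g x)⟫ - ζ x * ⟪g (x - t • e), a x (g x)⟫ :=
      i1.sub i2
    rw [h1, integral_add i0 i12, integral_sub i1 i2] at h0
    have h2 : ∫ x, ζ x * ⟪g (x - t • e), a x (g x)⟫ =
        ∫ x, ζ (x + t • e) * ⟪g x, a (x + t • e) (g (x + t • e))⟫ := by
      rw [← integral_add_right_eq_self _ (t • e)]
      simp
    have i3 : Integrable fun x => ζ (x + t • e) * ⟪g x, a (x + t • e) (g (x + t • e))⟫ := by
      have := i2.comp_add_right (t • e)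
      simpa using this
    have h3 : ∫ x, ⟪(ζ (x + t • e) • a (x + t • e) - ζ x • a x) (g x), g (x + t • e)⟫ =
       ∫ x, (ζ (x + t • e) * ⟪g x, a (x + t • e) (g (x + t • e))⟫ - ζ x * ⟪g (x + t • e), a x (g x)⟫) := by
      congr 1; ext x
      simp only [ContinuousLinearMap.sub_apply, ContinuousLinearMap.smul_apply, inner_sub_left,
        real_inner_smul_left]
      rw [hsym (x + t • e), real_inner_comm (a x (g x)) (g (x + t • e))]
    rw [h3, integral_sub i3 i1, ← h2]
    linarith
  have L1 : Tendsto (fun t : ℝ => ∫ x, t⁻¹ * (fderiv ℝ ζ x (a x (g x)) * (u (x + t • e) - u (x - t • e))))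
      (𝓝[>] 0) (𝓝 (∫ x, fderiv ℝ ζ x (a x (g x)) * (2 * ⟪g x, e⟫))) := by
    apply tendsto_integral_filter_of_dominated_convergence
      (K.indicator fun x => C * ‖a x (g x)‖ * (2 * M * ‖e‖))
    · filter_upwards with t
      exact ((hmV.mul ((huC.continuous.comp (by fun_prop)).sub
        (huC.continuous.comp (by fun_prop))).measurable).const_mul _).aestronglyMeasurable
    · filter_upwards [self_mem_nhdsWithin] with t (ht : 0 < t)
      refine .of_forall fun x => ?_
      by_cases hx : x ∈ K
      · rw [indicator_of_mem hx]
        have h1 : ‖fderiv ℝ ζ x (a x (g x))‖ ≤ C * ‖a x (g x)‖ :=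
          ((fderiv ℝ ζ x).le_opNorm _).trans (by gcongr; exact hfd x)
        have h2 : ‖u (x + t • e) - u (x - t • e)‖ ≤ M * (2 * t * ‖e‖) := by
          refine (huL.norm_sub_le _ _).trans ?_
          have : x + t • e - (x - t • e) = (2 * t) • e := by module
          rw [this, norm_smul, Real.norm_of_nonneg (by positivity), Real.coe_toNNReal _ hM0]
        rw [norm_mul, norm_mul, Real.norm_of_nonneg (by positivity)]
        calc t⁻¹ * (‖fderiv ℝ ζ x (a x (g x))‖ * ‖u (x + t • e) - u (x - t • e)‖)
            ≤ t⁻¹ * ((C * ‖a x (g x)‖) * (M * (2 * t * ‖e‖))) := by gcongr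
          _ = _ := by field_simp
      · rw [indicator_of_notMem hx, hdζ0 x hx]; simp
    · rw [integrable_indicator_iff hK.measurableSet]
      exact ContinuousOn.integrableOn_compact hK
          ((continuous_const.mul hV.norm).mul continuous_const).continuousOn
    · refine .of_forall fun x => ?_
      have h1 := tendsto_line (hu x) e
      have h2 := tendsto_line (hu x) (-e)
      have h3 := (h1.sub h2).const_mul (fderiv ℝ ζ x (a x (g x)))
      refine (h3.congr fun t => ?_).trans (le_of_eq ?_)
      · simp only [smul_eq_mul, smul_neg, ← sub_eq_add_neg]; ring
      · congr 1; simp; left; ring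
  have L2 : Tendsto (fun t : ℝ => ∫ x, ⟪(t⁻¹ • (ζ (x + t • e) • a (x + t • e) - ζ x • a x)) (g x), g (x + t • e)⟫)
      (𝓝[>] 0) (𝓝 (∫ x, ⟪fderiv ℝ (fun x => ζ x • a x) x e (g x), g x⟫)) := by
    have hFc := hCF.continuous
    apply tendsto_integral_filter_of_dominated_convergence
      (K.indicator fun x => CF * ‖e‖ * M * M)
    · filter_upwards with t
      apply Continuous.aestronglyMeasurable
      apply Continuous.inner
      · apply Continuous.clm_apply _ hg
        have hF1 : Continuous fun x => ζ (x + t • e) • a (x + t • e) :=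
          hFc.comp (by fun_prop : Continuous fun x => x + t • e)
        fun_prop
      · exact hg.comp (by fun_prop)
    · filter_upwards [Ioc_mem_nhdsGT zero_lt_one] with t ht
      have t_pos : 0 < t := ht.1
      refine .of_forall fun x => ?_
      by_cases hx : x ∈ K
      · rw [indicator_of_mem hx]
        refine (norm_inner_le_norm _ _).trans ?_
        gcongr
        · refine (ContinuousLinearMap.le_opNorm _ _).trans ?_
          gcongr
          · rw [norm_smul, Real.norm_of_nonneg (by positivity)]
            have := hCF.norm_sub_le (x + t • e) x
            simp only [add_sub_cancel_left, norm_smul, Real.norm_of_nonneg t_pos.le] at this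
            calc _ ≤ t⁻¹ * (CF * (t * ‖e‖)) := by gcongr
              _ = _ := by field_simp
          · exact hM x
        · exact hM _
      · rw [indicator_of_notMem hx, hζ0 x hx]
        have : ζ (x + t • e) = 0 := by
          by_contra hh
          apply hx
          refine mem_cthickening_of_dist_le _ _ _ _ (subset_tsupport _ hh) ?_
          rw [dist_eq_norm]
          simp only [sub_add_cancel_left, norm_neg, norm_smul, Real.norm_of_nonneg t_pos.le]
          exact mul_le_of_le_one_left (norm_nonneg e) ht.2
        simp [this]
    · rw [integrable_indicator_iff hK.measurableSet]
      exact ContinuousOn.integrableOn_compact hK continuousOn_const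
    · filter_upwards [hdiffF] with x hx
      have h1 := tendsto_line hx.hasFDerivAt e
      have h2 : Tendsto (fun t : ℝ => g (x + t • e)) (𝓝[>] 0) (𝓝 (g x)) := by
        have : Continuous fun t : ℝ => g (x + t • e) := hg.comp (by fun_prop)
        simpa using (this.tendsto 0).mono_left nhdsWithin_le_nhds
      exact (((ContinuousLinearMap.apply ℝ E (g x)).continuous.tendsto _).comp h1).inner h2
  refine tendsto_nhds_unique L1 (L2.congr fun t => ?_)
  rw [integral_const_mul, hid t, ← integral_const_mul]
  congr 1; ext x
  simp [inner_smul_left]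

end PartTwo


section PartThree
open Filter Function
open scoped RealInnerProductSpace

variable {E : Type*} [NormedAddCommGroup E] [InnerProductSpace ℝ E] [FiniteDimensional ℝ E]
  [MeasurableSpace E] [BorelSpace E]

def trE (T : E →L[ℝ] E) : ℝ := ∑ i, ⟪stdOrthonormalBasis ℝ E i, T (stdOrthonormalBasis ℝ E i)⟫

lemma trE_add (S T : E →L[ℝ] E) : trE (S + T) = trE S + trE T := by
  simp [trE, inner_add_right, Finset.sum_add_distrib]

lemma trE_sub (S T : E →L[ℝ] E) : trE (S - T) = trE S - trE T := by
  simp [trE, inner_sub_right, Finset.sum_sub_distrib]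

lemma trE_smul (c : ℝ) (T : E →L[ℝ] E) : trE (c • T) = c * trE T := by
  simp [trE, inner_smul_right, Finset.mul_sum]

lemma trE_id : trE (ContinuousLinearMap.id ℝ E) = Module.finrank ℝ E := by
  simp [trE]

lemma trE_smulRight (l : E →L[ℝ] ℝ) (v : E) : trE (l.smulRight v) = l v := by
  simp only [trE, ContinuousLinearMap.smulRight_apply, inner_smul_right]
  conv_rhs => rw [← (stdOrthonormalBasis ℝ E).sum_repr' v]
  simp [mul_comm]

lemma trE_bound (T : E →L[ℝ] E) : |trE T| ≤ Module.finrank ℝ E * ‖T‖ := by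
  unfold trE
  refine (Finset.abs_sum_le_sum_abs _ _).trans ?_
  refine (Finset.sum_le_sum (g := fun _ => ‖T‖) fun i _ => ?_).trans (by simp)
  refine (abs_real_inner_le_norm _ _).trans ?_
  simpa using T.le_opNorm (stdOrthonormalBasis ℝ E i)

lemma trE_measurable {T : E → (E →L[ℝ] E)} (hT : Measurable T) :
    Measurable fun x => trE (T x) := by
  have : Continuous (fun S : E →L[ℝ] E => trE S) := by
    unfold trE; fun_prop
  exact this.measurable.comp hT

lemma int_of_bdd {f : E → ℝ} (hm : Measurable f) {K : Set E} (hK : IsCompact K) {M : ℝ}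
    (hM : ∀ x, ‖f x‖ ≤ M) (h0 : ∀ x, x ∉ K → f x = 0) : Integrable f := by
  have : Integrable (K.indicator fun _ => M) := by
    rw [integrable_indicator_iff hK.measurableSet]
    exact ContinuousOn.integrableOn_compact hK continuousOn_const
  refine this.mono' hm.aestronglyMeasurable (.of_forall fun x => ?_)
  by_cases hx : x ∈ K
  · rw [indicator_of_mem hx]; exact hM x
  · rw [indicator_of_notMem hx, h0 x hx]; simp

lemma fderiv_zero_off {F : Type*} [NormedAddCommGroup F] [NormedSpace ℝ F] {f : E → F} {x : E}
    (hx : x ∉ tsupport f) : fderiv ℝ f x = 0 := by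
  have h1 : f =ᶠ[𝓝 x] fun _ => 0 := by
    filter_upwards [(isClosed_tsupport f).isOpen_compl.mem_nhds hx] with y hy
    exact image_eq_zero_of_notMem_tsupport hy
  rw [h1.fderiv_eq]; simp

theorem integral_trE_zero {Y : E → E} {C : ℝ≥0} (hY : LipschitzWith C Y) (hc : HasCompactSupport Y) :
    ∫ x, trE (fderiv ℝ Y x) = 0 := by
  have hdiff : ∀ᵐ x : E, DifferentiableAt ℝ Y x := hY.ae_differentiableAt
  set b := stdOrthonormalBasis ℝ E
  have hmd : Measurable (fderiv ℝ Y) := measurable_fderiv ℝ Y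
  have hfd : ∀ x, ‖fderiv ℝ Y x‖ ≤ C := fun x => norm_fderiv_le_of_lipschitz ℝ hY
  unfold trE
  rw [integral_finset_sum]
  · apply Finset.sum_eq_zero
    intro i _
    have hl : LipschitzWith (‖innerSL ℝ (b i)‖₊ * C) (fun x => ⟪b i, Y x⟫) :=
      (innerSL ℝ (b i)).lipschitz.comp hY
    have hcs : HasCompactSupport (fun x => ⟪b i, Y x⟫) :=
      hc.comp_left (g := fun y => ⟪b i, y⟫) (by simp)
    have h1 := (LipschitzWith.const (1 : ℝ)).integral_lineDeriv_mul_eq (μ := (volume : Measure E))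
      hl hcs (-(b i))
    simp only [neg_neg, mul_one] at h1
    have h2 : ∀ x v, lineDeriv ℝ (fun _ : E => (1 : ℝ)) x v = 0 := by
      intro x v; simp [lineDeriv]
    simp only [h2, zero_mul, integral_zero] at h1
    rw [h1]
    apply integral_congr_ae
    filter_upwards [hdiff] with x hx
    have h3 : HasFDerivAt (fun x => ⟪b i, Y x⟫) ((innerSL ℝ (b i)).comp (fderiv ℝ Y x)) x :=
      (innerSL ℝ (b i)).hasFDerivAt.comp x hx.hasFDerivAt
    rw [(h3.hasLineDerivAt (b i)).lineDeriv]
    simp [b]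
  · intro i _
    refine int_of_bdd (K := tsupport Y) (M := C) ?_ hc ?_ ?_
    · have : Continuous fun T : E →L[ℝ] E => ⟪b i, T (b i)⟫ := by fun_prop
      exact this.measurable.comp hmd
    · intro x
      refine (norm_inner_le_norm _ _).trans ?_
      have := (fderiv ℝ Y x).le_opNorm (b i)
      simp only [OrthonormalBasis.norm_eq_one, mul_one, one_mul] at this ⊢
      exact this.trans (hfd x)
    · intro x hx
      rw [fderiv_zero_off hx]; simp

theorem rellich_vec {a : E → E →L[ℝ] E} {La : ℝ≥0} (ha : LipschitzWith La a)
    {Ma : ℝ} (hMa : ∀ x, ‖a x‖ ≤ Ma)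
    (hsym : ∀ x v w, ⟪a x v, w⟫ = ⟪v, a x w⟫)
    {u : E → ℝ} {g : E → E} (hu : ∀ x, HasFDerivAt u (innerSL ℝ (g x)) x) (hg : Continuous g)
    {M : ℝ} (hM : ∀ x, ‖g x‖ ≤ M)
    {U : Set E} (hU : IsOpen U)
    (hw : ∀ ψ : E → ℝ, ContDiff ℝ ∞ ψ → HasCompactSupport ψ → tsupport ψ ⊆ U →
      ∫ x, fderiv ℝ ψ x (a x (g x)) = 0)
    {Z : E → E} {C : ℝ≥0} (hZ : LipschitzWith C Z) (hc : HasCompactSupport Z)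
    (hs : tsupport Z ⊆ U) :
    ∫ x, (2 * ⟪fderiv ℝ Z x (a x (g x)), g x⟫ - trE (fderiv ℝ Z x) * ⟪a x (g x), g x⟫
      - ⟪fderiv ℝ a x (Z x) (g x), g x⟫) = 0 := by
  have hM0 : 0 ≤ M := (norm_nonneg _).trans (hM 0)
  have hMa0 : 0 ≤ Ma := (norm_nonneg _).trans (hMa 0)
  have hdiff : ∀ᵐ x : E, DifferentiableAt ℝ Z x := hZ.ae_differentiableAt
  have hdiffa : ∀ᵐ x : E, DifferentiableAt ℝ a x := ha.ae_differentiableAt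
  set b := stdOrthonormalBasis ℝ E with hb
  have hV : Continuous fun x => a x (g x) := ha.continuous.clm_apply hg
  have hVb : ∀ x, ‖a x (g x)‖ ≤ Ma * M := fun x => ((a x).le_opNorm _).trans (by
    gcongr; exacts [hMa x, hM x])
  let ζ : _ → E → ℝ := fun i x => ⟪b i, Z x⟫
  have hl : ∀ i, LipschitzWith (‖innerSL ℝ (b i)‖₊ * C) (ζ i) := fun i =>
      (innerSL ℝ (b i)).lipschitz.comp hZ
  have hcs : ∀ i, HasCompactSupport (ζ i) := fun i =>
      hc.comp_left (g := fun y => ⟪b i, y⟫) (by simp)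
  have hts : ∀ i, tsupport (ζ i) ⊆ U := fun i => by
    refine Subset.trans (closure_mono ?_) hs
    intro x hx h
    exact hx (by simp [ζ, h])
  have hsc := fun i => rellich_scalar ha hsym hu hg hM hU hw (hl i) (hcs i) (hts i) (b i)
  have int1 : ∀ i, Integrable fun x => fderiv ℝ (ζ i) x (a x (g x)) * (2 * ⟪g x, b i⟫) := by
    intro i
    refine int_of_bdd (K := tsupport (ζ i)) (M := ((‖innerSL ℝ (b i)‖₊ * C : ℝ≥0) : ℝ) * (Ma * M) * (2 * M)) ?_ (hcs i) ?_ ?_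
    · exact (isBoundedBilinearMap_apply.continuous.measurable.comp
        ((measurable_fderiv ℝ (ζ i)).prodMk hV.measurable)).mul (by fun_prop)
    · intro x
      rw [norm_mul]
      gcongr
      · exact ((fderiv ℝ (ζ i) x).le_opNorm _).trans (by
          gcongr
          · exact norm_fderiv_le_of_lipschitz ℝ (hl i)
          · exact hVb x)
      · rw [norm_mul, Real.norm_of_nonneg zero_le_two]
        gcongr
        refine (norm_inner_le_norm _ _).trans ?_
        simpa using hM x
    · intro x hx
      rw [fderiv_zero_off hx]; simp
  have int2 : ∀ i, Integrable fun x => ⟪fderiv ℝ (fun x => ζ i x • a x) x (b i) (g x), g x⟫ := by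
    intro i
    have hFloc : LocallyLipschitz (fun x => ζ i x • a x) :=
      loclip_smul (hl i).locallyLipschitz ha.locallyLipschitz
    obtain ⟨CF, hCF⟩ := lip_of_loc hFloc (hcs i).smul_right
    refine int_of_bdd (K := tsupport (fun x => ζ i x • a x)) (M := CF * 1 * M * M) ?_ (hcs i).smul_right ?_ ?_
    · have h1 : Measurable (fderiv ℝ (fun x => ζ i x • a x)) := measurable_fderiv ℝ _
      have h2 : Continuous fun p : (E →L[ℝ] E →L[ℝ] E) × E => ⟪p.1 (b i) p.2, p.2⟫ := by fun_prop
      exact h2.measurable.comp (h1.prodMk hg.measurable)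
    · intro x
      refine (norm_inner_le_norm _ _).trans ?_
      gcongr
      · refine (ContinuousLinearMap.le_opNorm _ _).trans ?_
        gcongr
        · refine (ContinuousLinearMap.le_opNorm _ _).trans ?_
          gcongr
          · exact norm_fderiv_le_of_lipschitz ℝ hCF
          · simp
        · exact hM x
      · exact hM x
    · intro x hx
      rw [fderiv_zero_off hx]; simp
  have hsum : ∫ x, ∑ i, (fderiv ℝ (ζ i) x (a x (g x)) * (2 * ⟪g x, b i⟫) -
      ⟪fderiv ℝ (fun x => ζ i x • a x) x (b i) (g x), g x⟫) = 0 := by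
    have i12 : ∀ i, Integrable fun x => fderiv ℝ (ζ i) x (a x (g x)) * (2 * ⟪g x, b i⟫) -
      ⟪fderiv ℝ (fun x => ζ i x • a x) x (b i) (g x), g x⟫ := fun i => (int1 i).sub (int2 i)
    rw [integral_finset_sum _ fun i _ => i12 i]
    apply Finset.sum_eq_zero
    intro i _
    rw [integral_sub (int1 i) (int2 i), hsc i, sub_self]
  rw [← hsum]
  apply integral_congr_ae
  filter_upwards [hdiff, hdiffa] with x hx hax
  have h3 : ∀ i, HasFDerivAt (ζ i) ((innerSL ℝ (b i)).comp (fderiv ℝ Z x)) x := fun i =>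
      (innerSL ℝ (b i)).hasFDerivAt.comp x hx.hasFDerivAt
  have h4 : ∀ i, fderiv ℝ (fun x => ζ i x • a x) x (b i) =
      ζ i x • fderiv ℝ a x (b i) + ⟪b i, fderiv ℝ Z x (b i)⟫ • a x := by
    intro i
    rw [((h3 i).fun_smul hax.hasFDerivAt).fderiv]
    simp
  simp only [h4, (h3 _).fderiv, Finset.sum_sub_distrib]
  have e1 : ∑ i, ((innerSL ℝ (b i)).comp (fderiv ℝ Z x)) (a x (g x)) * (2 * ⟪g x, b i⟫) =
      2 * ⟪fderiv ℝ Z x (a x (g x)), g x⟫ := by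
    rw [real_inner_comm, ← b.sum_inner_mul_inner (g x), Finset.mul_sum]
    refine Finset.sum_congr rfl fun i _ => ?_
    simp; ring
  have e2 : ∑ i, ⟪(ζ i x • fderiv ℝ a x (b i) + ⟪b i, fderiv ℝ Z x (b i)⟫ • a x) (g x), g x⟫ =
      trE (fderiv ℝ Z x) * ⟪a x (g x), g x⟫ + ⟪fderiv ℝ a x (Z x) (g x), g x⟫ := by
    have : fderiv ℝ a x (Z x) (g x) = ∑ i, ζ i x • fderiv ℝ a x (b i) (g x) := by
      conv_lhs => rw [← b.sum_repr' (Z x)]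
      simp [ζ]
    rw [this, sum_inner, trE, Finset.sum_mul, ← Finset.sum_add_distrib]
    refine Finset.sum_congr rfl fun i _ => ?_
    simp only [ContinuousLinearMap.add_apply, ContinuousLinearMap.smul_apply, inner_add_left,
      real_inner_smul_left]
    rw [← hb]; ring
  rw [e1, e2]; ring

lemma maxpow_deriv (n : ℕ) (hn : 1 ≤ n) (t : ℝ) :
    HasDerivAt (fun t : ℝ => (max t 0) ^ (n + 1)) ((n + 1) * (max t 0) ^ n) t := by
  rcases lt_trichotomy t 0 with h | h | h
  · have h1 : (fun t : ℝ => (max t 0) ^ (n + 1)) =ᶠ[𝓝 t] fun _ => 0 := by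
      filter_upwards [Iio_mem_nhds h] with y hy
      rw [max_eq_right (le_of_lt hy)]; simp
    have := (hasDerivAt_const t (0 : ℝ)).congr_of_eventuallyEq h1
    rw [max_eq_right h.le, zero_pow (by omega)]
    simpa using this
  · subst h
    have : HasDerivAt (fun t : ℝ => (max t 0) ^ (n + 1)) 0 0 := by
      rw [hasDerivAt_iff_isLittleO]
      simp only [max_self, ne_eq, Nat.add_eq_zero_iff, one_ne_zero, and_false, not_false_eq_true, zero_pow,
        sub_zero, smul_zero]
      have h2 : (fun t : ℝ => t ^ (n + 1)) =o[𝓝 0] fun t : ℝ => t := by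
        simpa using Asymptotics.isLittleO_pow_pow (𝕜 := ℝ) (show 1 < n + 1 by omega)
      refine Asymptotics.IsBigO.trans_isLittleO ?_ h2
      refine Asymptotics.IsBigO.of_bound 1 (.of_forall fun t => ?_)
      rw [norm_pow, norm_pow, one_mul]
      gcongr
      rw [Real.norm_eq_abs, Real.norm_eq_abs, abs_of_nonneg (le_max_right _ _)]
      exact max_le (le_abs_self _) (abs_nonneg _)
    simpa [zero_pow (show n ≠ 0 by omega)] using this
  · have h1 : (fun t : ℝ => (max t 0) ^ (n + 1)) =ᶠ[𝓝 t] fun t => t ^ (n + 1) := by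
      filter_upwards [Ioi_mem_nhds h] with y hy
      rw [max_eq_left (le_of_lt hy)]
    have := (hasDerivAt_pow (n + 1) t).congr_of_eventuallyEq h1
    rw [max_eq_left h.le]
    simpa using this

/-- derivative of weighted integrals in the parameter -/
theorem deriv_weight {f p : E → ℝ} (hf : Integrable f) (hp : Continuous p) (hp0 : ∀ x, 0 ≤ p x)
    (n : ℕ) (hn : 1 ≤ n) {s : ℝ} (hs : 0 < s) :
    HasDerivAt (fun s => ∫ x, f x * (max (s - p x) 0) ^ (n + 1))
      (∫ x, f x * ((n + 1) * (max (s - p x) 0) ^ n)) s := by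
  have hd := maxpow_deriv n hn
  have hb : ∀ t ∈ Ioo 0 (2 * s), ∀ x, max (t - p x) 0 ≤ 2 * s := by
    intro t ht x
    exact max_le (by linarith [ht.2, hp0 x]) (by linarith)
  refine (hasDerivAt_integral_of_dominated_loc_of_deriv_le (s := Ioo 0 (2 * s))
    (F := fun s x => f x * max (s - p x) 0 ^ (n + 1))
    (F' := fun t x => f x * ((n + 1) * max (t - p x) 0 ^ n))
    (bound := fun x => ‖f x‖ * ((n + 1) * (2 * s) ^ n)) (Ioo_mem_nhds hs (by linarith)) ?_ ?_ ?_ ?_ ?_ ?_).2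
  · filter_upwards with t
    exact hf.aestronglyMeasurable.mul (by fun_prop)
  · refine (hf.norm.mul_const ((2 * s) ^ (n + 1))).mono' (hf.aestronglyMeasurable.mul (by fun_prop)) (.of_forall fun x => ?_)
    rw [norm_mul, norm_pow, Real.norm_of_nonneg (le_max_right (s - p x) 0)]
    gcongr
    exact hb s ⟨hs, by linarith⟩ x
  · exact hf.aestronglyMeasurable.mul (by fun_prop)
  · refine .of_forall fun x t ht => ?_
    rw [norm_mul, norm_mul, norm_pow, Real.norm_of_nonneg (le_max_right (t - p x) 0),
      Real.norm_of_nonneg (show (0 : ℝ) ≤ (n : ℝ) + 1 by positivity)]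
    gcongr
    exact hb t ht x
  · exact hf.norm.mul_const _
  · refine .of_forall fun x t ht => ?_
    have := (hd (t - p x)).comp t ((hasDerivAt_id t).sub_const (p x))
    simpa using! this.const_mul (f x)

end PartThree


section PartFour
open Filter Function
open scoped RealInnerProductSpace

variable {E : Type*} [NormedAddCommGroup E] [InnerProductSpace ℝ E]

structure Geo (a : E → E →L[ℝ] E) (G : E →L[ℝ] E) (Λ : ℝ) (L : ℝ≥0) : Prop where
  hΛ : 1 ≤ Λ
  lip : LipschitzWith L a
  sym : ∀ x v w, ⟪a x v, w⟫ = ⟪v, a x w⟫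
  bd : ∀ x, ‖a x‖ ≤ Λ
  ell : ∀ x v, ‖v‖ ^ 2 ≤ Λ * ⟪a x v, v⟫
  Gsym : ∀ v w, ⟪G v, w⟫ = ⟪v, G w⟫
  aG : ∀ v, a 0 (G v) = v
  Gbd : ‖G‖ ≤ Λ
  Gell : ∀ v, ‖v‖ ^ 2 ≤ Λ * ⟪G v, v⟫

def pF (G : E →L[ℝ] E) (x : E) : ℝ := ⟪G x, x⟫
def bF (a : E → E →L[ℝ] E) (G : E →L[ℝ] E) (x : E) : E := a x (G x)
def qF (a : E → E →L[ℝ] E) (G : E →L[ℝ] E) (x : E) : ℝ := ⟪a x (G x), G x⟫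

namespace Geo
variable {a : E → E →L[ℝ] E} {G : E →L[ℝ] E} {Λ : ℝ} {L : ℝ≥0} (h : Geo a G Λ L)
include h

lemma pos : 0 < Λ := lt_of_lt_of_le one_pos h.hΛ

lemma Gle (x : E) : ‖G x‖ ≤ Λ * ‖x‖ := (G.le_opNorm x).trans (by gcongr; exact h.Gbd)

lemma ale (x v : E) : ‖a x v‖ ≤ Λ * ‖v‖ := ((a x).le_opNorm v).trans (by gcongr; exact h.bd x)

lemma ble (x : E) : ‖bF a G x‖ ≤ Λ ^ 2 * ‖x‖ := by
  have := h.pos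
  calc _ ≤ Λ * ‖G x‖ := h.ale x _
    _ ≤ Λ * (Λ * ‖x‖) := by gcongr; exact h.Gle x
    _ = _ := by ring

lemma adiff (x y v : E) : ‖(a x - a y) v‖ ≤ L * ‖x - y‖ * ‖v‖ :=
  ((a x - a y).le_opNorm v).trans (by gcongr; simpa [dist_eq_norm] using h.lip.dist_le_mul x y)

lemma ple (x : E) : pF G x ≤ Λ * ‖x‖ ^ 2 := by
  have := (real_inner_le_norm (G x) x).trans
    (mul_le_mul_of_nonneg_right (h.Gle x) (norm_nonneg x))
  unfold pF; nlinarith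

lemma p_ge (x : E) : ‖x‖ ^ 2 ≤ Λ * pF G x := h.Gell x

lemma p_nonneg (x : E) : 0 ≤ pF G x := by
  have := h.p_ge x
  have := h.pos
  by_contra hc
  nlinarith [sq_nonneg ‖x‖]

lemma q_ge (x : E) : ‖x‖ ^ 2 ≤ Λ ^ 3 * qF a G x := by
  have h1 := h.ell x (G x)
  have h2 := h.ale 0 (G x)
  rw [h.aG] at h2
  have h3 : ‖x‖ ^ 2 ≤ Λ ^ 2 * ‖G x‖ ^ 2 := by
    rw [← mul_pow]; gcongr
  have := h.pos
  calc _ ≤ Λ ^ 2 * ‖G x‖ ^ 2 := h3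
    _ ≤ Λ ^ 2 * (Λ * ⟪a x (G x), G x⟫) := by gcongr
    _ = _ := by unfold qF; ring

lemma q_nonneg (x : E) : 0 ≤ qF a G x := by
  have h1 := h.q_ge x
  have : 0 < Λ ^ 3 := pow_pos h.pos 3
  by_contra hc
  nlinarith [sq_nonneg ‖x‖]

lemma q_le (x : E) : qF a G x ≤ Λ ^ 3 * ‖x‖ ^ 2 := by
  have hp := h.pos
  calc _ ≤ ‖bF a G x‖ * ‖G x‖ := real_inner_le_norm _ _
    _ ≤ (Λ ^ 2 * ‖x‖) * (Λ * ‖x‖) := by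
      gcongr
      exacts [h.ble x, h.Gle x]
    _ = _ := by ring

lemma p_pos {x : E} (hx : x ≠ 0) : 0 < pF G x := by
  have h1 := h.p_ge x
  have : 0 < ‖x‖ ^ 2 := by positivity
  have := h.pos
  by_contra hc
  nlinarith

lemma q_pos {x : E} (hx : x ≠ 0) : 0 < qF a G x := by
  have h1 := h.q_ge x
  have : 0 < ‖x‖ ^ 2 := by positivity
  have : 0 < Λ ^ 3 := pow_pos h.pos 3
  by_contra hc
  nlinarith

lemma p_le_q (x : E) : pF G x ≤ Λ ^ 4 * qF a G x := by
  have hp := h.pos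
  calc _ ≤ Λ * ‖x‖ ^ 2 := h.ple x
    _ ≤ Λ * (Λ ^ 3 * qF a G x) := by gcongr; exact h.q_ge x
    _ = _ := by ring

lemma q_le_p (x : E) : qF a G x ≤ Λ ^ 4 * pF G x := by
  have hp := h.pos
  calc _ ≤ Λ ^ 3 * ‖x‖ ^ 2 := h.q_le x
    _ ≤ Λ ^ 3 * (Λ * pF G x) := by gcongr; exact h.p_ge x
    _ = _ := by ring

lemma pq_nonneg (x : E) : 0 ≤ pF G x / qF a G x := div_nonneg (h.p_nonneg x) (h.q_nonneg x)
lemma qp_nonneg (x : E) : 0 ≤ qF a G x / pF G x := div_nonneg (h.q_nonneg x) (h.p_nonneg x)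

lemma pq_le (x : E) : pF G x / qF a G x ≤ Λ ^ 4 :=
  div_le_of_le_mul₀ (h.q_nonneg x) (by have := h.pos; positivity) (h.p_le_q x)

lemma qp_le (x : E) : qF a G x / pF G x ≤ Λ ^ 4 :=
  div_le_of_le_mul₀ (h.p_nonneg x) (by have := h.pos; positivity) (h.q_le_p x)

lemma qp_ge {x : E} (hx : x ≠ 0) : 1 ≤ Λ ^ 4 * (qF a G x / pF G x) := by
  rw [← mul_div_assoc, le_div_iff₀ (h.p_pos hx), one_mul]
  exact h.p_le_q x

lemma p_eq (x : E) : pF G x = ⟪a 0 (G x), G x⟫ := by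
  rw [h.aG, pF, real_inner_comm]

lemma q_sub_p (x : E) : |qF a G x - pF G x| ≤ L * Λ ^ 2 * ‖x‖ ^ 3 := by
  have hp := h.pos
  rw [h.p_eq, qF, ← inner_sub_left]
  have e : a x (G x) - a 0 (G x) = (a x - a 0) (G x) := rfl
  rw [e]
  calc _ ≤ ‖(a x - a 0) (G x)‖ * ‖G x‖ := abs_real_inner_le_norm _ _
    _ ≤ (L * ‖x - 0‖ * ‖G x‖) * ‖G x‖ := by gcongr; exact h.adiff x 0 _
    _ ≤ (L * ‖x - 0‖ * (Λ * ‖x‖)) * (Λ * ‖x‖) := by gcongr <;> exact h.Gle x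
    _ = _ := by rw [sub_zero]; ring

lemma pq_sub_one {x : E} (hx : x ≠ 0) : |pF G x / qF a G x - 1| ≤ L * Λ ^ 5 * ‖x‖ := by
  have hp := h.pos
  have hq := h.q_pos hx
  rw [div_sub_one hq.ne', abs_div, abs_of_pos hq, div_le_iff₀ hq, abs_sub_comm]
  calc _ ≤ _ := h.q_sub_p x
    _ = L * Λ ^ 2 * ‖x‖ * ‖x‖ ^ 2 := by ring
    _ ≤ L * Λ ^ 2 * ‖x‖ * (Λ ^ 3 * qF a G x) := by gcongr; exact h.q_ge x
    _ = _ := by ring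

lemma qp_sub_one {x : E} (hx : x ≠ 0) : |qF a G x / pF G x - 1| ≤ L * Λ ^ 3 * ‖x‖ := by
  have hp := h.pos
  have hq := h.p_pos hx
  rw [div_sub_one hq.ne', abs_div, abs_of_pos hq, div_le_iff₀ hq]
  calc _ ≤ _ := h.q_sub_p x
    _ = L * Λ ^ 2 * ‖x‖ * ‖x‖ ^ 2 := by ring
    _ ≤ L * Λ ^ 2 * ‖x‖ * (Λ * pF G x) := by gcongr; exact h.p_ge x
    _ = _ := by ring

/-- derivative of `p` -/
lemma p_hasFDerivAt (x : E) : HasFDerivAt (pF G) (2 • innerSL ℝ (G x)) x := by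
  have h1 := (G.hasFDerivAt (x := x)).inner ℝ (hasFDerivAt_id x)
  refine h1.congr_fderiv ?_
  ext v
  simp only [ContinuousLinearMap.comp_apply, ContinuousLinearMap.prod_apply, fderivInnerCLM_apply,
    ContinuousLinearMap.smul_apply, innerSL_apply_apply, id_eq, ContinuousLinearMap.id_apply]
  rw [h.Gsym v x, real_inner_comm]
  simp [two_mul, two_smul]

lemma b_hasFDerivAt {x : E} (hx : DifferentiableAt ℝ a x) :
    HasFDerivAt (bF a G) ((a x).comp G + (fderiv ℝ a x).flip (G x)) x :=
  hx.hasFDerivAt.clm_apply (G.hasFDerivAt (x := x))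

lemma db_sub_id {x : E} :
    ‖((a x).comp G + (fderiv ℝ a x).flip (G x)) - ContinuousLinearMap.id ℝ E‖ ≤ 2 * L * Λ * ‖x‖ := by
  have hp := h.pos
  refine ContinuousLinearMap.opNorm_le_bound _ (by positivity) fun v => ?_
  have e : ((a x).comp G + (fderiv ℝ a x).flip (G x) - ContinuousLinearMap.id ℝ E) v =
      (a x - a 0) (G v) + fderiv ℝ a x v (G x) := by
    simp [h.aG]; abel
  rw [e]
  have h1 : ‖(a x - a 0) (G v)‖ ≤ L * ‖x‖ * (Λ * ‖v‖) :=
    (h.adiff x 0 _).trans (by rw [sub_zero]; gcongr; exact h.Gle v)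
  have h2 : ‖fderiv ℝ a x v (G x)‖ ≤ (L * ‖v‖) * (Λ * ‖x‖) := by
    refine (ContinuousLinearMap.le_opNorm _ _).trans ?_
    gcongr
    · refine (ContinuousLinearMap.le_opNorm _ _).trans ?_
      gcongr
      exact norm_fderiv_le_of_lipschitz ℝ h.lip
    · exact h.Gle x
  calc _ ≤ _ := norm_add_le _ _
    _ ≤ _ := add_le_add h1 h2
    _ = _ := by ring

lemma q_hasFDerivAt {x : E} (hx : DifferentiableAt ℝ a x) :
    ∃ q', HasFDerivAt (qF a G) q' x ∧ ‖q' - 2 • innerSL ℝ (G x)‖ ≤ 3 * L * Λ ^ 2 * ‖x‖ ^ 2 := by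
  have hp := h.pos
  refine ⟨_, (h.b_hasFDerivAt hx).inner ℝ (G.hasFDerivAt (x := x)), ?_⟩
  refine ContinuousLinearMap.opNorm_le_bound _ (by positivity) fun v => ?_
  set D := (a x).comp G + (fderiv ℝ a x).flip (G x) with hD
  have e : (((fderivInnerCLM ℝ (bF a G x, G x)).comp (D.prod G)) - 2 • innerSL ℝ (G x)) v =
      ⟪(D - ContinuousLinearMap.id ℝ E) v, G x⟫ + ⟪(a x - a 0) (G x), G v⟫ := by
    simp only [ContinuousLinearMap.sub_apply, ContinuousLinearMap.comp_apply, ContinuousLinearMap.prod_apply, fderivInnerCLM_apply,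
      ContinuousLinearMap.smul_apply, innerSL_apply_apply, ContinuousLinearMap.id_apply, inner_sub_left, h.aG, bF]
    rw [← h.Gsym x v, real_inner_comm v (G x), two_nsmul]
    ring
  rw [e]
  have h1 : ‖⟪(D - ContinuousLinearMap.id ℝ E) v, G x⟫‖ ≤ (2 * L * Λ * ‖x‖ * ‖v‖) * (Λ * ‖x‖) := by
    refine (norm_inner_le_norm _ _).trans ?_
    gcongr
    · exact (ContinuousLinearMap.le_opNorm _ _).trans (by gcongr; exact h.db_sub_id)
    · exact h.Gle x
  have h2 : ‖⟪(a x - a 0) (G x), G v⟫‖ ≤ (L * ‖x‖ * (Λ * ‖x‖)) * (Λ * ‖v‖) := by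
    refine (norm_inner_le_norm _ _).trans ?_
    gcongr
    · exact (h.adiff x 0 _).trans (by rw [sub_zero]; gcongr; exact h.Gle x)
    · exact h.Gle v
  calc _ ≤ _ := norm_add_le _ _
    _ ≤ _ := add_le_add h1 h2
    _ = _ := by ring

lemma pq_hasFDerivAt {x : E} (hx : DifferentiableAt ℝ a x) (h0 : x ≠ 0) :
    ∃ r' : E →L[ℝ] ℝ, HasFDerivAt (fun x => pF G x / qF a G x) r' x ∧ ‖r'‖ ≤ 5 * L * Λ ^ 9 := by
  have hp := h.pos
  have hq := h.q_pos h0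
  obtain ⟨q', hq', hb⟩ := h.q_hasFDerivAt hx
  have hinv := (hasDerivAt_inv hq.ne').comp_hasFDerivAt x hq'
  have hmul := (h.p_hasFDerivAt x).fun_mul hinv
  set p' : E →L[ℝ] ℝ := 2 • innerSL ℝ (G x) with hp'
  refine ⟨((qF a G x) ^ 2)⁻¹ • (qF a G x • p' - pF G x • q'), ?_, ?_⟩
  · refine hmul.congr_fderiv ?_
    ext v
    simp only [ContinuousLinearMap.add_apply, ContinuousLinearMap.sub_apply,
      ContinuousLinearMap.smul_apply, smul_eq_mul, Function.comp]
    have := hq.ne'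
    field_simp
    ring
  have hpn : ‖p'‖ ≤ 2 * (Λ * ‖x‖) := by
    rw [hp']
    refine (norm_nsmul_le).trans ?_
    rw [innerSL_apply_norm]
    push_cast
    gcongr; exact h.Gle x
  have e : qF a G x • p' - pF G x • q' = (qF a G x - pF G x) • p' - pF G x • (q' - p') := by
    module
  rw [e, norm_smul, norm_inv, norm_pow, Real.norm_of_nonneg hq.le]
  have h1 : ‖(qF a G x - pF G x) • p'‖ ≤ (L * Λ ^ 2 * ‖x‖ ^ 3) * (2 * (Λ * ‖x‖)) := by
    rw [norm_smul]; gcongr; exact h.q_sub_p x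
  have h2 : ‖pF G x • (q' - p')‖ ≤ (Λ * ‖x‖ ^ 2) * (3 * L * Λ ^ 2 * ‖x‖ ^ 2) := by
    rw [norm_smul, Real.norm_of_nonneg (h.p_nonneg x)]; gcongr; exact h.ple x
  have h3 : (‖x‖ ^ 2) ^ 2 ≤ (Λ ^ 3 * qF a G x) ^ 2 := by gcongr; exact h.q_ge x
  rw [inv_mul_le_iff₀ (by positivity)]
  calc _ ≤ _ := norm_sub_le _ _
    _ ≤ _ := add_le_add h1 h2
    _ = 5 * L * Λ ^ 3 * (‖x‖ ^ 2) ^ 2 := by ring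
    _ ≤ 5 * L * Λ ^ 3 * (Λ ^ 3 * qF a G x) ^ 2 := by gcongr
    _ = _ := by ring

/-- the vector field `(p/q) β` -/
lemma Y_hasFDerivAt {x : E} (hx : DifferentiableAt ℝ a x) (h0 : x ≠ 0) :
    ∃ T : E →L[ℝ] E, HasFDerivAt (fun x => (pF G x / qF a G x) • bF a G x) T x ∧
      ‖T - ContinuousLinearMap.id ℝ E‖ ≤ 8 * L * Λ ^ 11 * ‖x‖ := by
  have hp := h.pos
  have h1L := h.hΛ
  obtain ⟨r', hr', hb⟩ := h.pq_hasFDerivAt hx h0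
  refine ⟨_, hr'.fun_smul (h.b_hasFDerivAt hx), ?_⟩
  set D := (a x).comp G + (fderiv ℝ a x).flip (G x) with hD
  set ρ := pF G x / qF a G x with hρ
  have e : ρ • D + r'.smulRight (bF a G x) - ContinuousLinearMap.id ℝ E =
      ρ • (D - ContinuousLinearMap.id ℝ E) + (ρ - 1) • ContinuousLinearMap.id ℝ E +
        r'.smulRight (bF a G x) := by module
  rw [e]
  have h1 : ‖ρ • (D - ContinuousLinearMap.id ℝ E)‖ ≤ Λ ^ 4 * (2 * L * Λ * ‖x‖) := by
    rw [norm_smul, Real.norm_of_nonneg (h.pq_nonneg x)]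
    gcongr
    exacts [h.pq_le x, h.db_sub_id]
  have h2 : ‖(ρ - 1) • ContinuousLinearMap.id ℝ E‖ ≤ L * Λ ^ 5 * ‖x‖ * 1 := by
    rw [norm_smul]
    gcongr
    exacts [h.pq_sub_one h0, ContinuousLinearMap.norm_id_le]
  have h3 : ‖r'.smulRight (bF a G x)‖ ≤ (5 * L * Λ ^ 9) * (Λ ^ 2 * ‖x‖) := by
    rw [ContinuousLinearMap.norm_smulRight_apply]
    gcongr
    exact h.ble x
  have h4 : Λ ^ 5 ≤ Λ ^ 11 := pow_le_pow_right₀ h1L (by norm_num)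
  calc _ ≤ _ := norm_add₃_le
    _ ≤ _ := add_le_add (add_le_add h1 h2) h3
    _ = 3 * L * ‖x‖ * Λ ^ 5 + 5 * L * Λ ^ 11 * ‖x‖ := by ring
    _ ≤ 3 * L * ‖x‖ * Λ ^ 11 + 5 * L * Λ ^ 11 * ‖x‖ := by gcongr
    _ = _ := by ring

lemma b_lip {R : ℝ} {x y : E} (hx : ‖x‖ ≤ R) :
    ‖bF a G x - bF a G y‖ ≤ (L * Λ * R + Λ ^ 2) * ‖x - y‖ := by
  have hp := h.pos
  have e : bF a G x - bF a G y = (a x - a y) (G x) + a y (G (x - y)) := by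
    simp [bF]
  rw [e]
  have hR : 0 ≤ R := (norm_nonneg x).trans hx
  have h1 : ‖(a x - a y) (G x)‖ ≤ L * ‖x - y‖ * (Λ * R) :=
    (h.adiff x y _).trans (by gcongr; exact (h.Gle x).trans (by gcongr))
  have h2 : ‖a y (G (x - y))‖ ≤ Λ * (Λ * ‖x - y‖) :=
    (h.ale y _).trans (by gcongr; exact h.Gle _)
  calc _ ≤ _ := norm_add_le _ _
    _ ≤ _ := add_le_add h1 h2
    _ = _ := by ring

lemma Y_lip_aux {R : ℝ} {x y : E} (hx : ‖x‖ ≤ ‖y‖) (hy : ‖y‖ ≤ R) (hy0 : y ≠ 0) :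
    ‖(pF G x / qF a G x) • bF a G x - (pF G y / qF a G y) • bF a G y‖ ≤
      (Λ ^ 4 * (L * Λ * R + Λ ^ 2) +
        Λ ^ 5 * (Λ ^ 4 * ((L * Λ * R + Λ ^ 2) * Λ + Λ ^ 3) + 2 * Λ)) * ‖x - y‖ := by
  have hp := h.pos
  have hR : 0 ≤ R := (norm_nonneg y).trans hy
  set K := L * Λ * R + Λ ^ 2
  have hK : 0 ≤ K := by positivity
  have hb := h.b_lip (y := y) (hx.trans hy)
  have hny : 0 < ‖y‖ := norm_pos_iff.2 hy0
  have hqy := h.q_pos hy0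
  have hqd : |qF a G y - qF a G x| ≤ (K * Λ + Λ ^ 3) * ‖y‖ * ‖x - y‖ := by
    have e : qF a G y - qF a G x = -⟪bF a G x - bF a G y, G x⟫ - ⟪bF a G y, G (x - y)⟫ := by
      simp [qF, bF, inner_sub_left, inner_sub_right]
    rw [e]
    have h1 : |⟪bF a G x - bF a G y, G x⟫| ≤ (K * ‖x - y‖) * (Λ * ‖y‖) := by
      refine (abs_real_inner_le_norm _ _).trans ?_
      gcongr
      exact (h.Gle x).trans (by gcongr)
    have h2 : |⟪bF a G y, G (x - y)⟫| ≤ (Λ ^ 2 * ‖y‖) * (Λ * ‖x - y‖) := by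
      refine (abs_real_inner_le_norm _ _).trans ?_
      gcongr
      exacts [h.ble y, h.Gle _]
    calc _ ≤ _ := abs_sub _ _
      _ = |⟪bF a G x - bF a G y, G x⟫| + |⟪bF a G y, G (x - y)⟫| := by rw [abs_neg]
      _ ≤ _ := add_le_add h1 h2
      _ = _ := by ring
  have hpd : |pF G x - pF G y| ≤ 2 * Λ * ‖y‖ * ‖x - y‖ := by
    have e : pF G x - pF G y = ⟪G (x - y), x⟫ + ⟪G y, x - y⟫ := by
      simp [pF, inner_sub_left, inner_sub_right]
    rw [e]
    have h1 : |⟪G (x - y), x⟫| ≤ (Λ * ‖x - y‖) * ‖y‖ :=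
      (abs_real_inner_le_norm _ _).trans (by gcongr; exact h.Gle _)
    have h2 : |⟪G y, x - y⟫| ≤ (Λ * ‖y‖) * ‖x - y‖ :=
      (abs_real_inner_le_norm _ _).trans (by gcongr; exact h.Gle _)
    calc _ ≤ _ := abs_add_le _ _
      _ ≤ _ := add_le_add h1 h2
      _ = _ := by ring
  set ρ := pF G x / qF a G x with hρ
  have hρq : ρ * qF a G x = pF G x := by
    by_cases hx0 : x = 0
    · simp [hρ, hx0, pF]
    · exact div_mul_cancel₀ _ (h.q_pos hx0).ne'
  have e : ρ • bF a G x - (pF G y / qF a G y) • bF a G y =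
      ρ • (bF a G x - bF a G y) +
        ((ρ * (qF a G y - qF a G x) + (pF G x - pF G y)) / qF a G y) • bF a G y := by
    have : (ρ * (qF a G y - qF a G x) + (pF G x - pF G y)) / qF a G y = ρ - pF G y / qF a G y := by
      rw [mul_sub, hρq]; field_simp; ring
    rw [this]; module
  rw [e]
  have h1 : ‖ρ • (bF a G x - bF a G y)‖ ≤ Λ ^ 4 * (K * ‖x - y‖) := by
    rw [norm_smul, Real.norm_of_nonneg (h.pq_nonneg x)]
    gcongr
    exact h.pq_le x
  have h2 : |ρ * (qF a G y - qF a G x) + (pF G x - pF G y)| ≤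
      (Λ ^ 4 * (K * Λ + Λ ^ 3) + 2 * Λ) * ‖y‖ * ‖x - y‖ := by
    calc _ ≤ _ := abs_add_le _ _
      _ ≤ Λ ^ 4 * ((K * Λ + Λ ^ 3) * ‖y‖ * ‖x - y‖) + 2 * Λ * ‖y‖ * ‖x - y‖ := by
        rw [abs_mul, abs_of_nonneg (h.pq_nonneg x)]
        gcongr
        exact h.pq_le x
      _ = _ := by ring
  have h3 : ‖((ρ * (qF a G y - qF a G x) + (pF G x - pF G y)) / qF a G y) • bF a G y‖ ≤
      Λ ^ 5 * (Λ ^ 4 * (K * Λ + Λ ^ 3) + 2 * Λ) * ‖x - y‖ := by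
    rw [norm_smul, norm_div, Real.norm_of_nonneg hqy.le, div_mul_eq_mul_div, div_le_iff₀ hqy]
    calc _ ≤ ((Λ ^ 4 * (K * Λ + Λ ^ 3) + 2 * Λ) * ‖y‖ * ‖x - y‖) * (Λ ^ 2 * ‖y‖) := by
          gcongr
          · exact h2
          · exact h.ble y
      _ = (Λ ^ 4 * (K * Λ + Λ ^ 3) + 2 * Λ) * ‖x - y‖ * Λ ^ 2 * ‖y‖ ^ 2 := by ring
      _ ≤ (Λ ^ 4 * (K * Λ + Λ ^ 3) + 2 * Λ) * ‖x - y‖ * Λ ^ 2 * (Λ ^ 3 * qF a G y) := by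
          gcongr; exact h.q_ge y
      _ = _ := by ring
  calc _ ≤ _ := norm_add_le _ _
    _ ≤ _ := add_le_add h1 h3
    _ = _ := by ring

lemma Y_loclip : LocallyLipschitz (fun x => (pF G x / qF a G x) • bF a G x) := by
  intro x0
  have hp := h.pos
  set R := ‖x0‖ + 1 with hR
  have hR0 : 0 ≤ R := by positivity
  set K := (Λ ^ 4 * (L * Λ * R + Λ ^ 2) +
        Λ ^ 5 * (Λ ^ 4 * ((L * Λ * R + Λ ^ 2) * Λ + Λ ^ 3) + 2 * Λ))
  have hK : 0 ≤ K := by positivity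
  refine ⟨K.toNNReal, ball 0 R, isOpen_ball.mem_nhds (by simp [hR]), ?_⟩
  refine LipschitzOnWith.of_dist_le_mul fun x hx y hy => ?_
  rw [Real.coe_toNNReal _ hK, dist_eq_norm, dist_eq_norm]
  have hx' : ‖x‖ ≤ R := by simpa using (le_of_lt (mem_ball.1 hx))
  have hy' : ‖y‖ ≤ R := by simpa using (le_of_lt (mem_ball.1 hy))
  rcases le_total ‖x‖ ‖y‖ with hxy | hxy
  · by_cases h0 : y = 0
    · have : x = 0 := by rw [← norm_le_zero_iff]; simpa [h0] using hxy
      simp [h0, this]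
    · exact h.Y_lip_aux hxy hy' h0
  · by_cases h0 : x = 0
    · have : y = 0 := by rw [← norm_le_zero_iff]; simpa [h0] using hxy
      simp [h0, this]
    · rw [norm_sub_rev, norm_sub_rev x y]
      exact h.Y_lip_aux hxy hx' h0

end Geo
end PartFour


section PartFive
open Filter Function
open scoped RealInnerProductSpace

variable {E : Type*} [NormedAddCommGroup E] [InnerProductSpace ℝ E] [FiniteDimensional ℝ E]
  [MeasurableSpace E] [BorelSpace E]

lemma int_close {X P Bd : E → ℝ} (hX : Measurable X) (hP : Integrable P) (hB : Integrable Bd)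
    (hle : ∀ᵐ x : E, |X x - P x| ≤ Bd x) (h0 : ∫ x, X x = 0) : |∫ x, P x| ≤ ∫ x, Bd x := by
  have h1 : Integrable (fun x => X x - P x) :=
    hB.mono' (hX.aestronglyMeasurable.sub hP.aestronglyMeasurable) hle
  have h2 : Integrable X := by
    have := h1.add hP
    refine this.congr (.of_forall fun x => ?_)
    simp
  have h3 : ∫ x, P x = - ∫ x, (X x - P x) := by
    rw [integral_sub h2 hP, h0]; ring
  rw [h3, abs_neg]
  exact norm_integral_le_of_norm_le (f := fun x => X x - P x) hB hle

lemma int_cc {F φ : E → ℝ} (hF : Continuous F) (hc : HasCompactSupport F) (hφ : Measurable φ)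
    {C : ℝ} (hb : ∀ x, |φ x| ≤ C) : Integrable fun x => φ x * F x :=
  (hF.integrable_of_hasCompactSupport hc).bdd_mul hφ.aestronglyMeasurable (.of_forall hb)

structure Sol (a : E → E →L[ℝ] E) (u : E → ℝ) (g : E → E) (ρ : ℝ) : Prop where
  hu : ∀ x, HasFDerivAt u (innerSL ℝ (g x)) x
  hg : Continuous g
  hc : HasCompactSupport u
  hw : ∀ ψ : E → ℝ, ContDiff ℝ ∞ ψ → HasCompactSupport ψ → tsupport ψ ⊆ ball 0 ρ →
      ∫ x, fderiv ℝ ψ x (a x (g x)) = 0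

def wF (G : E →L[ℝ] E) (s : ℝ) (x : E) : ℝ := max (s - pF G x) 0
def hF (a : E → E →L[ℝ] E) (G : E →L[ℝ] E) (u : E → ℝ) (s : ℝ) : ℝ :=
  ∫ x, (qF a G x / pF G x * u x ^ 2) * wF G s x ^ 2
def iF (a : E → E →L[ℝ] E) (G : E →L[ℝ] E) (g : E → E) (s : ℝ) : ℝ :=
  ∫ x, ⟪a x (g x), g x⟫ * wF G s x ^ 3
def jF (a : E → E →L[ℝ] E) (G : E →L[ℝ] E) (g : E → E) (s : ℝ) : ℝ :=
  ∫ x, (pF G x / qF a G x * ⟪bF a G x, g x⟫ ^ 2) * wF G s x ^ 2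

namespace Sol
variable {a : E → E →L[ℝ] E} {G : E →L[ℝ] E} {Λ : ℝ} {L : ℝ≥0} {u : E → ℝ} {g : E → E} {ρ : ℝ}

lemma cu (S : Sol a u g ρ) : Continuous u :=
  continuous_iff_continuousAt.2 fun x => (S.hu x).continuousAt

lemma C1 (S : Sol a u g ρ) : ContDiff ℝ 1 u := by
  rw [contDiff_one_iff_fderiv]
  refine ⟨fun x => (S.hu x).differentiableAt, ?_⟩
  have : fderiv ℝ u = fun x => innerSL ℝ (g x) := funext fun x => (S.hu x).fderiv
  rw [this]
  exact (innerSL ℝ).continuous.comp S.hg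

lemma cg (S : Sol a u g ρ) : HasCompactSupport g := by
  refine HasCompactSupport.intro S.hc fun x hx => ?_
  have h1 := fderiv_zero_off hx
  rw [(S.hu x).fderiv] at h1
  have := innerSL_apply_norm ℝ (g x)
  rw [h1, norm_zero] at this
  exact norm_eq_zero.1 this.symm

lemma bg (S : Sol a u g ρ) : ∃ M, ∀ x, ‖g x‖ ≤ M := S.cg.exists_bound_of_continuous S.hg

lemma continuous_p : Continuous (pF G) := by unfold pF; fun_prop
lemma continuous_w (s : ℝ) : Continuous (wF G s) := by
  have := continuous_p (G := G)
  unfold wF; fun_prop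
lemma continuous_b (h : Geo a G Λ L) : Continuous (bF a G) :=
  h.lip.continuous.clm_apply G.continuous
lemma continuous_q (h : Geo a G Λ L) : Continuous (qF a G) :=
  (continuous_b h).inner G.continuous
lemma continuous_e (h : Geo a G Λ L) (S : Sol a u g ρ) : Continuous fun x => ⟪a x (g x), g x⟫ :=
  (h.lip.continuous.clm_apply S.hg).inner S.hg
lemma continuous_bg (h : Geo a G Λ L) (S : Sol a u g ρ) : Continuous fun x => ⟪bF a G x, g x⟫ :=
  (continuous_b h).inner S.hg

lemma w_nonneg (s : ℝ) (x : E) : 0 ≤ wF G s x := le_max_right _ _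

lemma sw (s : ℝ) (x : E) : s * wF G s x = wF G s x ^ 2 + pF G x * wF G s x := by
  unfold wF
  rcases le_total (s - pF G x) 0 with h | h
  · rw [max_eq_right h]; simp
  · rw [max_eq_left h]; ring

lemma w_supp (h : Geo a G Λ L) {s : ℝ} (hs : 0 < s) {x : E} (hx : Λ * Real.sqrt s < ‖x‖) :
    wF G s x = 0 := by
  have hp := h.pos
  refine max_eq_right ?_
  have h1 := h.p_ge x
  have h2 : (Λ * Real.sqrt s) ^ 2 < ‖x‖ ^ 2 := by gcongr
  rw [mul_pow, Real.sq_sqrt hs.le] at h2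
  have h3 : Λ * s ≤ Λ ^ 2 * s := by nlinarith [h.hΛ, mul_pos hp hs]
  have : Λ * s < Λ * pF G x := by linarith
  linarith [lt_of_mul_lt_mul_left this hp.le]

lemma w_tsupp (h : Geo a G Λ L) {s : ℝ} (hs : 0 < s) (hsρ : Λ * Real.sqrt s < ρ)
    {F : Type*} [NormedAddCommGroup F] {f : E → F} (hf : ∀ x, wF G s x = 0 → f x = 0) :
    HasCompactSupport f ∧ tsupport f ⊆ ball 0 ρ := by
  have h1 : support f ⊆ closedBall 0 (Λ * Real.sqrt s) := by
    intro x hx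
    by_contra hc
    refine hx (hf x (w_supp h hs ?_))
    simpa using hc
  have h2 : tsupport f ⊆ closedBall 0 (Λ * Real.sqrt s) := closure_minimal h1 isClosed_closedBall
  exact ⟨(isCompact_closedBall _ _).of_isClosed_subset (isClosed_tsupport f) h2,
    h2.trans (closedBall_subset_ball hsρ)⟩

lemma w_loclip (h : Geo a G Λ L) (s : ℝ) : LocallyLipschitz (wF G s) := by
  have h1 : LocallyLipschitz (pF G) := by
    have : ContDiff ℝ 1 (pF G) := by
      unfold pF
      exact ContDiff.inner ℝ G.contDiff contDiff_id
    exact this.locallyLipschitz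
  have h2 : LipschitzWith 1 (fun t : ℝ => max (s - t) 0) := by
    refine LipschitzWith.of_dist_le_mul fun x y => ?_
    rw [Real.dist_eq, Real.dist_eq, NNReal.coe_one, one_mul]
    refine (abs_max_sub_max_le_abs _ _ _).trans ?_
    rw [abs_sub_comm x y]; apply le_of_eq; congr 1; ring
  exact h2.locallyLipschitz.comp h1

lemma b_loclip (h : Geo a G Λ L) : LocallyLipschitz (bF a G) := by
  intro x0
  have hp := h.pos
  set R := ‖x0‖ + 1 with hR
  have hR0 : 0 ≤ R := by positivity
  have hK : 0 ≤ L * Λ * R + Λ ^ 2 := by positivity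
  refine ⟨(L * Λ * R + Λ ^ 2).toNNReal, ball 0 R, isOpen_ball.mem_nhds (by simp [hR]), ?_⟩
  refine LipschitzOnWith.of_dist_le_mul fun x hx y hy => ?_
  rw [Real.coe_toNNReal _ hK, dist_eq_norm, dist_eq_norm]
  exact h.b_lip (by simpa using (le_of_lt (mem_ball.1 hx)))

lemma loclip_pow {f : E → ℝ} (hf : LocallyLipschitz f) (n : ℕ) :
    LocallyLipschitz fun x => f x ^ n :=
  (contDiff_id.pow n : ContDiff ℝ 1 fun t : ℝ => t ^ n).locallyLipschitz.comp hf

lemma w_fderiv (h : Geo a G Λ L) (s : ℝ) (n : ℕ) (hn : 1 ≤ n) (x : E) :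
    HasFDerivAt (fun x => wF G s x ^ (n + 1))
      (-(2 * ((n + 1) * wF G s x ^ n)) • innerSL ℝ (G x)) x := by
  have h1 := (maxpow_deriv n hn (s - pF G x)).comp_hasFDerivAt x
    ((h.p_hasFDerivAt x).const_sub s)
  refine (show HasFDerivAt (fun x => wF G s x ^ (n + 1)) _ x from h1).congr_fderiv ?_
  ext v
  simp [wF]
  ring

/-- the test `u w^3` -/
lemma I_eq (h : Geo a G Λ L) (S : Sol a u g ρ) {s : ℝ} (hs : 0 < s) (hsρ : Λ * Real.sqrt s < ρ) :
    iF a G g s = 6 * ∫ x, (u x * ⟪bF a G x, g x⟫) * wF G s x ^ 2 := by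
  have hul := S.C1.locallyLipschitz
  have hl : LocallyLipschitz (fun x => u x * wF G s x ^ 3) :=
    loclip_mul hul (loclip_pow (w_loclip h s) 3)
  obtain ⟨hcs, hts⟩ := w_tsupp (ρ := ρ) h hs hsρ (f := fun x => u x * wF G s x ^ 3)
    (fun x hx => by simp [hx])
  obtain ⟨C, hC⟩ := lip_of_loc hl hcs
  have h1 := weak_lip (h.lip.continuous.clm_apply S.hg) isOpen_ball S.hw hC hcs hts
  have h2 : ∀ x, fderiv ℝ (fun x => u x * wF G s x ^ 3) x (a x (g x)) =
      ⟪a x (g x), g x⟫ * wF G s x ^ 3 - 6 * ((u x * ⟪bF a G x, g x⟫) * wF G s x ^ 2) := by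
    intro x
    rw [((S.hu x).fun_mul (w_fderiv h s 2 (by norm_num) x)).fderiv]
    simp only [ContinuousLinearMap.add_apply, ContinuousLinearMap.smul_apply, innerSL_apply_apply,
      smul_eq_mul, bF, h.sym x (G x), real_inner_comm (a x (g x)) (g x)]
    push_cast; ring
  simp only [h2] at h1
  have i1 : Integrable fun x => ⟪a x (g x), g x⟫ * wF G s x ^ 3 := by
    have c1 := continuous_e h S
    have c2 := continuous_w (G := G) s
    refine Continuous.integrable_of_hasCompactSupport (by fun_prop) ?_
    exact (w_tsupp (ρ := ρ) h hs hsρ (fun x hx => by simp [hx])).1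
  have i2 : Integrable fun x => 6 * ((u x * ⟪bF a G x, g x⟫) * wF G s x ^ 2) := by
    have c1 := continuous_bg h S
    have c2 := continuous_w (G := G) s
    have c3 := S.cu
    refine Continuous.integrable_of_hasCompactSupport (by fun_prop) ?_
    exact (w_tsupp (ρ := ρ) h hs hsρ (fun x hx => by simp [hx])).1
  rw [integral_sub i1 i2, integral_const_mul] at h1
  unfold iF; linarith

lemma meas_qp (h : Geo a G Λ L) : Measurable fun x => qF a G x / pF G x :=
  (continuous_q h).measurable.div continuous_p.measurable
lemma meas_pq (h : Geo a G Λ L) : Measurable fun x => pF G x / qF a G x :=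
  continuous_p.measurable.div (continuous_q h).measurable

lemma int_h (h : Geo a G Λ L) (S : Sol a u g ρ) : Integrable fun x => qF a G x / pF G x * u x ^ 2 := by
  refine int_cc (S.cu.pow 2) ?_ (meas_qp h) (C := Λ ^ 4) fun x => ?_
  · exact S.hc.comp_left (g := fun t : ℝ => t ^ 2) (by simp)
  · rw [abs_of_nonneg (h.qp_nonneg x)]; exact h.qp_le x

lemma int_j (h : Geo a G Λ L) (S : Sol a u g ρ) :
    Integrable fun x => pF G x / qF a G x * ⟪bF a G x, g x⟫ ^ 2 := by
  refine int_cc ((continuous_bg h S).pow 2) ?_ (meas_pq h) (C := Λ ^ 4) fun x => ?_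
  · refine HasCompactSupport.intro S.cg fun x hx => ?_
    simp [image_eq_zero_of_notMem_tsupport hx]
  · rw [abs_of_nonneg (h.pq_nonneg x)]; exact h.pq_le x

lemma int_e (h : Geo a G Λ L) (S : Sol a u g ρ) : Integrable fun x => ⟪a x (g x), g x⟫ := by
  refine (continuous_e h S).integrable_of_hasCompactSupport ?_
  refine HasCompactSupport.intro S.cg fun x hx => ?_
  simp [image_eq_zero_of_notMem_tsupport hx]

lemma int_w (h : Geo a G Λ L) {f : E → ℝ} (hf : Integrable f) {s : ℝ} (hs : 0 < s) (n : ℕ) :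
    Integrable fun x => f x * wF G s x ^ n := by
  refine hf.mul_bdd (c := s ^ n) ((continuous_w s).pow n).aestronglyMeasurable (.of_forall fun x => ?_)
  rw [norm_pow, Real.norm_of_nonneg (w_nonneg s x)]
  exact pow_le_pow_left₀ (w_nonneg s x) (max_le (by linarith [h.p_nonneg x]) hs.le) n

lemma h_nonneg (h : Geo a G Λ L) (s : ℝ) : 0 ≤ hF a G u s :=
  integral_nonneg fun x => by
    have := h.qp_nonneg x
    have := w_nonneg (G := G) s x
    positivity

lemma e_nonneg (h : Geo a G Λ L) (x v : E) : 0 ≤ ⟪a x v, v⟫ := by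
  have := h.ell x v
  have := h.pos
  by_contra hc
  nlinarith [sq_nonneg ‖v‖]

lemma i_nonneg (h : Geo a G Λ L) (s : ℝ) : 0 ≤ iF a G g s :=
  integral_nonneg fun x => by
    have := e_nonneg h x (g x)
    have := w_nonneg (G := G) s x
    positivity

lemma cauchy (h : Geo a G Λ L) (S : Sol a u g ρ) {s : ℝ} (hs : 0 < s) (hsρ : Λ * Real.sqrt s < ρ)
    (t : ℝ) : t * iF a G g s / 3 ≤ t ^ 2 * hF a G u s + jF a G g s := by
  have e1 : t * iF a G g s / 3 = ∫ x, 2 * t * ((u x * ⟪bF a G x, g x⟫) * wF G s x ^ 2) := by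
    rw [integral_const_mul, I_eq h S hs hsρ]; ring
  have i1 : Integrable fun x => 2 * t * ((u x * ⟪bF a G x, g x⟫) * wF G s x ^ 2) := by
    have c1 := continuous_bg h S
    have c2 := continuous_w (G := G) s
    have c3 := S.cu
    refine Continuous.integrable_of_hasCompactSupport (by fun_prop) ?_
    exact (w_tsupp (ρ := ρ) h hs hsρ (fun x hx => by simp [hx])).1
  have ih := int_w h (int_h h S) hs 2
  have ij := int_w h (int_j h S) hs 2
  rw [e1, hF, jF, ← integral_const_mul, ← integral_add (ih.const_mul (t ^ 2)) ij]
  refine integral_mono i1 ((ih.const_mul (t ^ 2)).add ij) fun x => ?_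
  by_cases hx : x = 0
  · subst hx
    simp [bF, pF, qF]
  have hp := h.p_pos hx
  have hq := h.q_pos hx
  have h3 : 0 ≤ (wF G s x ^ 2) * ((qF a G x / pF G x) * (t * u x - (pF G x / qF a G x) * ⟪bF a G x, g x⟫) ^ 2) := by
    have := h.qp_nonneg x
    positivity
  have h4 : (wF G s x ^ 2) * ((qF a G x / pF G x) * (t * u x - (pF G x / qF a G x) * ⟪bF a G x, g x⟫) ^ 2) =
    t ^ 2 * ((qF a G x / pF G x * u x ^ 2) * wF G s x ^ 2) + (pF G x / qF a G x * ⟪bF a G x, g x⟫ ^ 2) * wF G s x ^ 2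
     - 2 * t * ((u x * ⟪bF a G x, g x⟫) * wF G s x ^ 2) := by
    field_simp
    ring
  simp only
  linarith

end Sol
end PartFive


section PartSix
open Filter Function
open scoped RealInnerProductSpace

variable {E : Type*} [NormedAddCommGroup E] [InnerProductSpace ℝ E] [FiniteDimensional ℝ E]
  [MeasurableSpace E] [BorelSpace E]

namespace Sol
variable {a : E → E →L[ℝ] E} {G : E →L[ℝ] E} {Λ : ℝ} {L : ℝ≥0} {u : E → ℝ} {g : E → E} {ρ : ℝ}

lemma ae_ne_zero [Nontrivial E] : ∀ᵐ x : E, x ≠ 0 := by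
  rw [ae_iff]; simp

lemma h_id [Nontrivial E] (h : Geo a G Λ L) (S : Sol a u g ρ) {s : ℝ} (hs : 0 < s)
    (hsρ : Λ * Real.sqrt s < ρ) :
    |∫ x, (Module.finrank ℝ E * ((qF a G x / pF G x * u x ^ 2) * wF G s x ^ 2)
      - 4 * (qF a G x * u x ^ 2 * wF G s x) + 2 * ((u x * ⟪bF a G x, g x⟫) * wF G s x ^ 2))| ≤
      3 * Module.finrank ℝ E * L * Λ ^ 8 * Real.sqrt s * hF a G u s := by
  have hp := h.pos
  have hul := S.C1.locallyLipschitz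
  have hl : LocallyLipschitz (fun x => (u x ^ 2 * wF G s x ^ 2) • bF a G x) :=
    loclip_smul (loclip_mul (loclip_pow hul 2) (loclip_pow (w_loclip h s) 2)) (b_loclip h)
  obtain ⟨hcs, hts⟩ := w_tsupp (ρ := ρ) h hs hsρ (f := fun x => (u x ^ 2 * wF G s x ^ 2) • bF a G x)
    (fun x hx => by simp [hx])
  obtain ⟨C, hC⟩ := lip_of_loc hl hcs
  have h1 := integral_trE_zero hC hcs
  have ih := int_w h (int_h h S) hs 2
  have c1 := continuous_bg h S
  have c2 := continuous_w (G := G) s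
  have c3 := S.cu
  have c4 := continuous_q h
  have i2 : Integrable fun x => 4 * (qF a G x * u x ^ 2 * wF G s x) :=
    Continuous.integrable_of_hasCompactSupport (by fun_prop)
      (w_tsupp (ρ := ρ) h hs hsρ (fun x hx => by simp [hx])).1
  have i3 : Integrable fun x => 2 * ((u x * ⟪bF a G x, g x⟫) * wF G s x ^ 2) :=
    Continuous.integrable_of_hasCompactSupport (by fun_prop)
      (w_tsupp (ρ := ρ) h hs hsρ (fun x hx => by simp [hx])).1
  rw [hF, ← integral_const_mul]
  refine int_close (trE_measurable (measurable_fderiv ℝ _)) (((ih.const_mul _).sub i2).add i3)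
    (ih.const_mul _) ?_ h1
  filter_upwards [ae_ne_zero, h.lip.ae_differentiableAt] with x hx hax
  have d1 := ((((S.hu x).pow 2).fun_mul (w_fderiv h s 1 le_rfl x)).fun_smul (h.b_hasFDerivAt hax)).fderiv
  simp only [Nat.reduceAdd] at d1
  rw [d1, trE_add, trE_smul, trE_smulRight]
  set D := (a x).comp G + (fderiv ℝ a x).flip (G x) with hD
  have e1 : ⟪G x, bF a G x⟫ = qF a G x := by rw [real_inner_comm]; rfl
  have e2 : trE D - Module.finrank ℝ E = trE (D - ContinuousLinearMap.id ℝ E) := by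
    rw [trE_sub, trE_id]
  simp only [ContinuousLinearMap.add_apply, ContinuousLinearMap.smul_apply, innerSL_apply_apply,
      smul_eq_mul, e1, real_inner_comm (bF a G x) (g x)]
  have e3 : |trE D - Module.finrank ℝ E| ≤ Module.finrank ℝ E * (2 * L * Λ * ‖x‖) := by
    rw [e2]; exact (trE_bound _).trans (by gcongr; exact h.db_sub_id)
  have e4 := h.qp_sub_one hx
  by_cases hxs : Λ * Real.sqrt s < ‖x‖
  · simp [w_supp h hs hxs]
  push Not at hxs
  have e5 := h.qp_ge hx
  set k : ℝ := ((Module.finrank ℝ E : ℕ) : ℝ)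
  have hk : 0 ≤ k := Nat.cast_nonneg _
  set μ := qF a G x / pF G x with hμ
  have hw := w_nonneg (G := G) s x
  have e6 : |trE D - k * μ| ≤ 3 * k * L * Λ ^ 4 * Real.sqrt s := by
    have e7 : trE D - k * μ = (trE D - k) - k * (μ - 1) := by ring
    rw [e7]
    have hΛ3 : Λ ≤ Λ ^ 3 := by
      simpa using pow_le_pow_right₀ h.hΛ (show 1 ≤ 3 by norm_num)
    calc _ ≤ |trE D - k| + |k * (μ - 1)| := abs_sub _ _
      _ ≤ k * (2 * L * Λ * ‖x‖) + k * (L * Λ ^ 3 * ‖x‖) := by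
        rw [abs_mul, abs_of_nonneg hk]; gcongr
      _ ≤ k * (2 * L * Λ ^ 3 * (Λ * Real.sqrt s)) + k * (L * Λ ^ 3 * (Λ * Real.sqrt s)) := by
        gcongr
      _ = _ := by ring
  have e8 : ∀ X Y : ℝ, X - Y = (u x ^ 2 * wF G s x ^ 2) * (trE D - k * μ) →
      |X - Y| ≤ 3 * k * L * Λ ^ 8 * Real.sqrt s * (μ * u x ^ 2 * wF G s x ^ 2) := by
    intro X Y hXY
    rw [hXY, abs_mul, abs_of_nonneg (by positivity)]
    calc _ ≤ (u x ^ 2 * wF G s x ^ 2) * (3 * k * L * Λ ^ 4 * Real.sqrt s) * 1 := by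
          rw [mul_one]; gcongr
      _ ≤ (u x ^ 2 * wF G s x ^ 2) * (3 * k * L * Λ ^ 4 * Real.sqrt s) * (Λ ^ 4 * μ) := by
          gcongr
      _ = _ := by ring
  apply e8
  simp
  ring

lemma i_id [Nontrivial E] (h : Geo a G Λ L) (S : Sol a u g ρ) {s : ℝ} (hs : 0 < s)
    (hsρ : Λ * Real.sqrt s < ρ) :
    |∫ x, ((2 - Module.finrank ℝ E) * (⟪a x (g x), g x⟫ * wF G s x ^ 3)
      - 12 * ((pF G x / qF a G x * ⟪bF a G x, g x⟫ ^ 2) * wF G s x ^ 2)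
      + 6 * (pF G x * ⟪a x (g x), g x⟫ * wF G s x ^ 2))| ≤
      (17 + 8 * Module.finrank ℝ E) * L * Λ ^ 14 * Real.sqrt s * iF a G g s := by
  have hp := h.pos
  obtain ⟨M, hM⟩ := S.bg
  have hl : LocallyLipschitz (fun x => (wF G s x ^ 3) • ((pF G x / qF a G x) • bF a G x)) :=
    loclip_smul (loclip_pow (w_loclip h s) 3) h.Y_loclip
  set Z := fun x => (wF G s x ^ 3) • ((pF G x / qF a G x) • bF a G x) with hZ
  obtain ⟨hcs, hts⟩ := w_tsupp (ρ := ρ) h hs hsρ (f := Z) (fun x hx => by simp [hZ, hx])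
  obtain ⟨C, hC⟩ := lip_of_loc hl hcs
  have h1 := rellich_vec h.lip h.bd h.sym S.hu S.hg hM isOpen_ball S.hw hC hcs hts
  have ie := int_w h (int_e h S) hs 3
  have ij := int_w h (int_j h S) hs 2
  have c1 := continuous_e h S
  have c2 := continuous_w (G := G) s
  have c3 := continuous_p (G := G)
  have i2 : Integrable fun x => 6 * (pF G x * ⟪a x (g x), g x⟫ * wF G s x ^ 2) :=
    Continuous.integrable_of_hasCompactSupport (by fun_prop)
      (w_tsupp (ρ := ρ) h hs hsρ (fun x hx => by simp [hx])).1
  have hV : Continuous fun x => a x (g x) := h.lip.continuous.clm_apply S.hg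
  rw [iF, ← integral_const_mul]
  refine int_close ?_ (((ie.const_mul _).sub (ij.const_mul _)).add i2) (ie.const_mul _) ?_ h1
  · have m1 : Measurable fun x => ⟪fderiv ℝ Z x (a x (g x)), g x⟫ := by
      have h2 : Continuous fun p : (E →L[ℝ] E) × E × E => ⟪p.1 p.2.1, p.2.2⟫ := by fun_prop
      exact h2.measurable.comp ((measurable_fderiv ℝ Z).prodMk (hV.measurable.prodMk S.hg.measurable))
    have m2 : Measurable fun x => ⟪fderiv ℝ a x (Z x) (g x), g x⟫ := by
      have h2 : Continuous fun p : (E →L[ℝ] E →L[ℝ] E) × E × E => ⟪p.1 p.2.1 p.2.2, p.2.2⟫ := by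
        fun_prop
      exact h2.measurable.comp ((measurable_fderiv ℝ a).prodMk
        (hC.continuous.measurable.prodMk S.hg.measurable))
    exact ((m1.const_mul 2).sub ((trE_measurable (measurable_fderiv ℝ _)).mul c1.measurable)).sub m2
  filter_upwards [ae_ne_zero, h.lip.ae_differentiableAt] with x hx hax
  obtain ⟨T, hT, hTb⟩ := h.Y_hasFDerivAt hax hx
  have d1 : fderiv ℝ Z x = _ := ((w_fderiv h s 2 (by norm_num) x).fun_smul hT).fderiv
  simp only [Nat.reduceAdd] at d1
  have e1 : ⟪G x, bF a G x⟫ = qF a G x := by rw [real_inner_comm]; rfl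
  have e0 : ⟪G x, a x (g x)⟫ = ⟪bF a G x, g x⟫ := (h.sym x (G x) (g x)).symm
  have hq := h.q_pos hx
  set r := pF G x / qF a G x with hr
  have e2 : r * qF a G x = pF G x := div_mul_cancel₀ _ hq.ne'
  set k : ℝ := ((Module.finrank ℝ E : ℕ) : ℝ) with hkdef
  have hk : 0 ≤ k := Nat.cast_nonneg _
  set w := wF G s x with hwdef
  have hw : 0 ≤ w := w_nonneg (G := G) s x
  set e := ⟪a x (g x), g x⟫ with hedef
  set β := ⟪bF a G x, g x⟫ with hβ
  have t1 : trE (fderiv ℝ Z x) = w ^ 3 * trE T - 6 * w ^ 2 * pF G x := by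
    rw [d1, trE_add, trE_smul, trE_smulRight]
    simp only [ContinuousLinearMap.smul_apply, innerSL_apply_apply, smul_eq_mul, inner_smul_right, e1]
    rw [e2]; push_cast; ring
  have t2 : ⟪fderiv ℝ Z x (a x (g x)), g x⟫ = w ^ 3 * ⟪T (a x (g x)), g x⟫ - 6 * w ^ 2 * r * β ^ 2 := by
    rw [d1]
    simp only [ContinuousLinearMap.add_apply, ContinuousLinearMap.smul_apply,
      ContinuousLinearMap.smulRight_apply, innerSL_apply_apply, smul_eq_mul, inner_add_left,
      real_inner_smul_left, e0, ← hβ]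
    push_cast; ring
  have t3 : ⟪fderiv ℝ a x (Z x) (g x), g x⟫ = w ^ 3 * (r * ⟪fderiv ℝ a x (bF a G x) (g x), g x⟫) := by
    simp only [hZ, map_smul, ContinuousLinearMap.smul_apply, real_inner_smul_left]; rfl
  rw [t1, t2, t3]
  have n1 : |⟪T (a x (g x)), g x⟫ - e| ≤ 8 * L * Λ ^ 12 * ‖x‖ * ‖g x‖ ^ 2 := by
    have : ⟪T (a x (g x)), g x⟫ - e = ⟪(T - ContinuousLinearMap.id ℝ E) (a x (g x)), g x⟫ := by
      simp [inner_sub_left, hedef]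
    rw [this]
    calc _ ≤ ‖(T - ContinuousLinearMap.id ℝ E) (a x (g x))‖ * ‖g x‖ := abs_real_inner_le_norm _ _
      _ ≤ (8 * L * Λ ^ 11 * ‖x‖ * (Λ * ‖g x‖)) * ‖g x‖ := by
        gcongr
        exact (ContinuousLinearMap.le_opNorm _ _).trans (by gcongr; exact h.ale x _)
      _ = _ := by ring
  have e_le : |e| ≤ Λ * ‖g x‖ ^ 2 := by
    calc _ ≤ ‖a x (g x)‖ * ‖g x‖ := abs_real_inner_le_norm _ _
      _ ≤ (Λ * ‖g x‖) * ‖g x‖ := by gcongr; exact h.ale x _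
      _ = _ := by ring
  have n2 : |(trE T - k) * e| ≤ k * (8 * L * Λ ^ 11 * ‖x‖) * (Λ * ‖g x‖ ^ 2) := by
    rw [abs_mul]
    gcongr
    have : trE T - k = trE (T - ContinuousLinearMap.id ℝ E) := by rw [trE_sub, trE_id]
    rw [this]; exact (trE_bound _).trans (by gcongr)
  have n3 : |r * ⟪fderiv ℝ a x (bF a G x) (g x), g x⟫| ≤ Λ ^ 4 * ((L * (Λ ^ 2 * ‖x‖) * ‖g x‖) * ‖g x‖) := by
    rw [abs_mul, abs_of_nonneg (h.pq_nonneg x)]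
    gcongr
    · exact h.pq_le x
    · refine (abs_real_inner_le_norm _ _).trans ?_
      gcongr
      refine (ContinuousLinearMap.le_opNorm _ _).trans ?_
      gcongr
      refine (ContinuousLinearMap.le_opNorm _ _).trans ?_
      gcongr
      · exact norm_fderiv_le_of_lipschitz ℝ h.lip
      · exact h.ble x
  by_cases hxs : Λ * Real.sqrt s < ‖x‖
  · have : w = 0 := w_supp h hs hxs
    simp [this]
  push Not at hxs
  have e5 : ‖g x‖ ^ 2 ≤ Λ * e := h.ell x (g x)
  have he0 : 0 ≤ e := e_nonneg h x (g x)
  have hΛ6 : Λ ^ 6 ≤ Λ ^ 12 := pow_le_pow_right₀ h.hΛ (by norm_num)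
  have n4 : |2 * (⟪T (a x (g x)), g x⟫ - e) - (trE T - k) * e - r * ⟪fderiv ℝ a x (bF a G x) (g x), g x⟫|
      ≤ (17 + 8 * k) * L * Λ ^ 14 * Real.sqrt s * e := by
    calc _ ≤ |2 * (⟪T (a x (g x)), g x⟫ - e)| + |(trE T - k) * e| + |r * ⟪fderiv ℝ a x (bF a G x) (g x), g x⟫| := by
          refine (abs_sub _ _).trans ?_
          gcongr
          exact abs_sub _ _
      _ ≤ 2 * (8 * L * Λ ^ 12 * ‖x‖ * ‖g x‖ ^ 2) + k * (8 * L * Λ ^ 11 * ‖x‖) * (Λ * ‖g x‖ ^ 2) +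
          Λ ^ 4 * ((L * (Λ ^ 2 * ‖x‖) * ‖g x‖) * ‖g x‖) := by
          rw [abs_mul, abs_two]; gcongr
      _ = (16 + 8 * k) * (L * Λ ^ 12 * ‖x‖ * ‖g x‖ ^ 2) + L * Λ ^ 6 * ‖x‖ * ‖g x‖ ^ 2 := by ring
      _ ≤ (16 + 8 * k) * (L * Λ ^ 12 * ‖x‖ * ‖g x‖ ^ 2) + L * Λ ^ 12 * ‖x‖ * ‖g x‖ ^ 2 := by gcongr
      _ = (17 + 8 * k) * (L * Λ ^ 12 * ‖x‖ * ‖g x‖ ^ 2) := by ring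
      _ ≤ (17 + 8 * k) * (L * Λ ^ 12 * (Λ * Real.sqrt s) * (Λ * e)) := by gcongr
      _ = _ := by ring
  have n5 : ∀ X Y : ℝ, X - Y = w ^ 3 * (2 * (⟪T (a x (g x)), g x⟫ - e) - (trE T - k) * e - r * ⟪fderiv ℝ a x (bF a G x) (g x), g x⟫) →
      |X - Y| ≤ (17 + 8 * k) * L * Λ ^ 14 * Real.sqrt s * (e * w ^ 3) := by
    intro X Y hXY
    rw [hXY, abs_mul, abs_of_nonneg (by positivity)]
    calc _ ≤ w ^ 3 * ((17 + 8 * k) * L * Λ ^ 14 * Real.sqrt s * e) := by gcongr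
      _ = _ := by ring
  apply n5
  ring

end Sol

/-- the constant in the almost-identities -/
def kap (k : ℕ) (Λ : ℝ) (L : ℝ≥0) : ℝ := (17 + 8 * k) * L * Λ ^ 14

namespace Sol
variable {a : E → E →L[ℝ] E} {G : E →L[ℝ] E} {Λ : ℝ} {L : ℝ≥0} {u : E → ℝ} {g : E → E} {ρ : ℝ}

lemma h_deriv [Nontrivial E] (h : Geo a G Λ L) (S : Sol a u g ρ) {s : ℝ} (hs : 0 < s)
    (hsρ : Λ * Real.sqrt s < ρ) : ∃ h', HasDerivAt (hF a G u) h' s ∧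
      |s * h' - (2 + Module.finrank ℝ E / 2) * hF a G u s - iF a G g s / 6| ≤
        kap (Module.finrank ℝ E) Λ L * Real.sqrt s * hF a G u s := by
  have hp := h.pos
  refine ⟨_, deriv_weight (int_h h S) continuous_p h.p_nonneg 1 le_rfl hs, ?_⟩
  have h1 := h_id h S hs hsρ
  have ih := int_w h (int_h h S) hs 2
  have c1 := continuous_bg h S
  have c2 := continuous_w (G := G) s
  have c3 := S.cu
  have c4 := continuous_q h
  have i2 : Integrable fun x => qF a G x * u x ^ 2 * wF G s x :=
    Continuous.integrable_of_hasCompactSupport (by fun_prop)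
      (w_tsupp (ρ := ρ) h hs hsρ (fun x hx => by simp [hx])).1
  have i3 : Integrable fun x => (u x * ⟪bF a G x, g x⟫) * wF G s x ^ 2 :=
    Continuous.integrable_of_hasCompactSupport (by fun_prop)
      (w_tsupp (ρ := ρ) h hs hsρ (fun x hx => by simp [hx])).1
  have i12 : Integrable fun x => (Module.finrank ℝ E * ((qF a G x / pF G x * u x ^ 2) * wF G s x ^ 2)
      - 4 * (qF a G x * u x ^ 2 * wF G s x)) := (ih.const_mul _).sub (i2.const_mul 4)
  rw [integral_add i12 (i3.const_mul 2), integral_sub (ih.const_mul _) (i2.const_mul 4),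
    integral_const_mul, integral_const_mul, integral_const_mul] at h1
  have e1 : s * (∫ x, (qF a G x / pF G x * u x ^ 2) * (((1 : ℕ) + 1) * (max (s - pF G x) 0) ^ 1)) =
      2 * hF a G u s + 2 * ∫ x, qF a G x * u x ^ 2 * wF G s x := by
    rw [hF, ← integral_const_mul, ← integral_const_mul, ← integral_const_mul,
      ← integral_add (ih.const_mul 2) (i2.const_mul 2)]
    congr 1; ext x
    have hsw := sw (G := G) s x
    have hqp : qF a G x / pF G x * pF G x = qF a G x := by
      by_cases hx : x = 0
      · simp [hx, qF, pF]
      · exact div_mul_cancel₀ _ (h.p_pos hx).ne'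
    change s * ((qF a G x / pF G x * u x ^ 2) * (((1 : ℕ) + 1) * wF G s x ^ 1)) = _
    calc _ = 2 * (qF a G x / pF G x * u x ^ 2) * (s * wF G s x) := by push_cast; ring
      _ = 2 * (qF a G x / pF G x * u x ^ 2 * wF G s x ^ 2) + 2 * ((qF a G x / pF G x * pF G x) * u x ^ 2 * wF G s x) := by
        rw [hsw]; ring
      _ = _ := by rw [hqp]
  rw [e1, I_eq h S hs hsρ]
  have hh := h_nonneg (u := u) h s
  change |Module.finrank ℝ E * hF a G u s - _ + _| ≤ _ at h1
  have hk : (0 : ℝ) ≤ Module.finrank ℝ E := Nat.cast_nonneg _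
  have hkap : 3 * (Module.finrank ℝ E : ℝ) * L * Λ ^ 8 * Real.sqrt s * hF a G u s ≤
      2 * (kap (Module.finrank ℝ E) Λ L * Real.sqrt s * hF a G u s) := by
    have : Λ ^ 8 ≤ Λ ^ 14 := pow_le_pow_right₀ h.hΛ (by norm_num)
    unfold kap
    calc _ ≤ (2 * (17 + 8 * (Module.finrank ℝ E : ℝ))) * L * Λ ^ 14 * Real.sqrt s * hF a G u s := by
          gcongr ?_ * L * ?_ * Real.sqrt s * _
          linarith
      _ = _ := by ring
  rw [abs_le] at h1 ⊢
  constructor <;> linarith [h1.1, h1.2]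

lemma i_deriv [Nontrivial E] (h : Geo a G Λ L) (S : Sol a u g ρ) {s : ℝ} (hs : 0 < s)
    (hsρ : Λ * Real.sqrt s < ρ) : ∃ i', HasDerivAt (iF a G g) i' s ∧
      |s * i' - (2 + Module.finrank ℝ E / 2) * iF a G g s - 6 * jF a G g s| ≤
        kap (Module.finrank ℝ E) Λ L * Real.sqrt s * iF a G g s := by
  have hp := h.pos
  refine ⟨_, deriv_weight (int_e h S) continuous_p h.p_nonneg 2 (by norm_num) hs, ?_⟩
  have h1 := i_id h S hs hsρ
  have ie := int_w h (int_e h S) hs 3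
  have ij := int_w h (int_j h S) hs 2
  have c1 := continuous_e h S
  have c2 := continuous_w (G := G) s
  have c3 := continuous_p (G := G)
  have i2 : Integrable fun x => pF G x * ⟪a x (g x), g x⟫ * wF G s x ^ 2 :=
    Continuous.integrable_of_hasCompactSupport (by fun_prop)
      (w_tsupp (ρ := ρ) h hs hsρ (fun x hx => by simp [hx])).1
  have i12 : Integrable fun x => ((2 - Module.finrank ℝ E) * (⟪a x (g x), g x⟫ * wF G s x ^ 3)
      - 12 * ((pF G x / qF a G x * ⟪bF a G x, g x⟫ ^ 2) * wF G s x ^ 2)) :=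
    (ie.const_mul _).sub (ij.const_mul 12)
  rw [integral_add i12 (i2.const_mul 6), integral_sub (ie.const_mul _) (ij.const_mul 12),
    integral_const_mul, integral_const_mul, integral_const_mul] at h1
  have e1 : s * (∫ x, ⟪a x (g x), g x⟫ * (((2 : ℕ) + 1) * (max (s - pF G x) 0) ^ 2)) =
      3 * iF a G g s + 3 * ∫ x, pF G x * ⟪a x (g x), g x⟫ * wF G s x ^ 2 := by
    rw [iF, ← integral_const_mul, ← integral_const_mul, ← integral_const_mul,
      ← integral_add (ie.const_mul 3) (i2.const_mul 3)]
    congr 1; ext x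
    have hsw := sw (G := G) s x
    change s * (⟪a x (g x), g x⟫ * (((2 : ℕ) + 1) * wF G s x ^ 2)) = _
    calc _ = 3 * ⟪a x (g x), g x⟫ * wF G s x * (s * wF G s x) := by push_cast; ring
      _ = _ := by rw [hsw]; ring
  rw [e1]
  change |(2 - Module.finrank ℝ E) * iF a G g s - 12 * jF a G g s + _| ≤ _ at h1
  have hi := i_nonneg (g := g) h s
  have hpos : 0 ≤ kap (Module.finrank ℝ E) Λ L * Real.sqrt s * iF a G g s := by
    unfold kap; positivity
  change _ ≤ kap (Module.finrank ℝ E) Λ L * Real.sqrt s * iF a G g s at h1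
  rw [abs_le] at h1 ⊢
  constructor <;> linarith [h1.1, h1.2]

end Sol
end PartSix


section PartSeven
open Filter Function

structure Freq (h I J : ℝ → ℝ) (A κ S : ℝ) : Prop where
  hA : 1 ≤ A
  hκ : 0 ≤ κ
  hS : κ * Real.sqrt S ≤ 1 / 8
  h0 : ∀ s, 0 ≤ h s
  I0 : ∀ s, 0 ≤ I s
  dh : ∀ s, 0 < s → s ≤ S → ∃ h', HasDerivAt h h' s ∧ |s * h' - A * h s - I s / 6| ≤ κ * Real.sqrt s * h s
  dI : ∀ s, 0 < s → s ≤ S → ∃ I', HasDerivAt I I' s ∧ |s * I' - A * I s - 6 * J s| ≤ κ * Real.sqrt s * I s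
  cs : ∀ s, 0 < s → s ≤ S → ∀ t, t * I s / 3 ≤ t ^ 2 * h s + J s

namespace Freq
variable {h I J : ℝ → ℝ} {A κ S : ℝ} (F : Freq h I J A κ S)
include F

lemma mono {s1 s2 δ : ℝ} (h1 : 0 < s1) (h2 : s2 ≤ S) (hδ : 0 ≤ δ)
    (hpos : ∀ s ∈ Icc s1 s2, 0 < h s + δ) :
    MonotoneOn (fun s => I s / (h s + δ) * Real.exp (4 * κ * Real.sqrt s)) (Icc s1 s2) := by
  have key : ∀ s ∈ Icc s1 s2, ∃ d, 0 ≤ d ∧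
      HasDerivAt (fun s => I s / (h s + δ) * Real.exp (4 * κ * Real.sqrt s)) d s := by
    intro s hs
    have hs0 : 0 < s := h1.trans_le hs.1
    have hsS : s ≤ S := hs.2.trans h2
    obtain ⟨h', hh', bh⟩ := F.dh s hs0 hsS
    obtain ⟨I', hI', bI⟩ := F.dI s hs0 hsS
    have hp := hpos s hs
    have d1 := (hI'.fun_div (hh'.add_const δ) hp.ne').fun_mul
      (((Real.hasDerivAt_sqrt hs0.ne').const_mul (4 * κ)).exp)
    refine ⟨_, ?_, d1⟩
    have hq : 0 < Real.sqrt s := Real.sqrt_pos.2 hs0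
    have hss : Real.sqrt s ^ 2 = s := Real.sq_sqrt hs0.le
    have hJ : I s ^ 2 ≤ 36 * (J s * (h s + δ)) := by
      have := F.cs s hs0 hsS (I s / (6 * (h s + δ)))
      have e1 : I s / (6 * (h s + δ)) * I s / 3 = I s ^ 2 / (18 * (h s + δ)) := by
        field_simp; ring
      have e2 : (I s / (6 * (h s + δ))) ^ 2 * h s ≤ I s ^ 2 / (36 * (h s + δ)) := by
        have : (I s / (6 * (h s + δ))) ^ 2 * h s ≤ (I s / (6 * (h s + δ))) ^ 2 * (h s + δ) := by
          gcongr; linarith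
        refine this.trans (le_of_eq ?_)
        field_simp; ring
      have e3 : I s ^ 2 / (18 * (h s + δ)) - I s ^ 2 / (36 * (h s + δ)) = I s ^ 2 / (36 * (h s + δ)) := by
        field_simp; ring
      have e4 : I s ^ 2 / (36 * (h s + δ)) ≤ J s := by linarith
      rw [div_le_iff₀ (by positivity)] at e4
      linarith
    have b1 := (abs_le.1 bh).2
    have b2 := (abs_le.1 bI).1
    have i0 := F.I0 s
    have h0 := F.h0 s
    have hκ := F.hκ
    have hA := F.hA
    -- main numerators
    have m1 : -(2 * κ * Real.sqrt s * I s * (h s + δ)) ≤ s * (I' * (h s + δ) - I s * h') := by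
      have m2 : (A * I s + 6 * J s - κ * Real.sqrt s * I s) * (h s + δ) ≤ s * I' * (h s + δ) := by
        gcongr; linarith
      have m3 : I s * (s * h') ≤ I s * (A * h s + I s / 6 + κ * Real.sqrt s * h s) := by
        gcongr; linarith
      have m4 : 0 ≤ A * I s * δ := by positivity
      have m5 : 0 ≤ κ * Real.sqrt s * I s * δ := by positivity
      nlinarith
    have m6 : 0 ≤ (I' * (h s + δ) - I s * h') / (h s + δ) ^ 2 + I s / (h s + δ) * (4 * κ * (1 / (2 * Real.sqrt s))) := by
      have e5 : (I' * (h s + δ) - I s * h') / (h s + δ) ^ 2 + I s / (h s + δ) * (4 * κ * (1 / (2 * Real.sqrt s)))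
        = (s * (I' * (h s + δ) - I s * h') + 2 * κ * Real.sqrt s * I s * (h s + δ)) / (s * (h s + δ) ^ 2) := by
        have : I s / (h s + δ) * (4 * κ * (1 / (2 * Real.sqrt s))) = 2 * κ * Real.sqrt s * I s * (h s + δ) / (s * (h s + δ) ^ 2) := by
          rw [div_mul_eq_mul_div, div_eq_div_iff (by positivity) (by positivity)]
          field_simp
          rw [hss]; ring
        rw [this]; field_simp
      rw [e5]
      apply div_nonneg
      · linarith
      · positivity
    have m7 := mul_nonneg m6 (Real.exp_pos (4 * κ * Real.sqrt s)).le
    linarith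
  refine monotoneOn_of_deriv_nonneg (convex_Icc _ _) ?_ ?_ ?_
  · intro s hs
    obtain ⟨d, -, hd⟩ := key s hs
    exact hd.continuousAt.continuousWithinAt
  · intro s hs
    obtain ⟨d, -, hd⟩ := key s (interior_subset hs)
    exact hd.differentiableAt.differentiableWithinAt
  · intro s hs
    obtain ⟨d, h0, hd⟩ := key s (interior_subset hs)
    rw [hd.deriv]; exact h0

lemma N_le {s1 s2 s t δ : ℝ} (h1 : 0 < s1) (h2 : s2 ≤ S) (hδ : 0 ≤ δ)
    (hpos : ∀ s ∈ Icc s1 s2, 0 < h s + δ) (hs : s ∈ Icc s1 s2) (ht : t ∈ Icc s1 s2) (hst : s ≤ t) :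
    I s / (h s + δ) ≤ 2 * (I t / (h t + δ)) := by
  have hm := F.mono h1 h2 hδ hpos hs ht hst
  simp only at hm
  have hκ := F.hκ
  have n1 : 0 ≤ I s / (h s + δ) := div_nonneg (F.I0 s) (hpos s hs).le
  have n2 : 0 ≤ I t / (h t + δ) := div_nonneg (F.I0 t) (hpos t ht).le
  have e1 : 1 ≤ Real.exp (4 * κ * Real.sqrt s) := Real.one_le_exp (by positivity)
  have e2 : Real.exp (4 * κ * Real.sqrt t) ≤ 2 := by
    have : Real.sqrt t ≤ Real.sqrt S := Real.sqrt_le_sqrt (ht.2.trans h2)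
    have h3 : 4 * κ * Real.sqrt t ≤ 1 / 2 := by
      have := mul_le_mul_of_nonneg_left this hκ
      linarith [F.hS]
    calc _ ≤ Real.exp (1 / 2) := Real.exp_le_exp.2 h3
      _ ≤ Real.exp (Real.log 2) := Real.exp_le_exp.2 (by linarith [Real.log_two_gt_d9])
      _ = 2 := Real.exp_log two_pos
  calc _ ≤ I s / (h s + δ) * Real.exp (4 * κ * Real.sqrt s) := le_mul_of_one_le_right n1 e1
    _ ≤ _ := hm
    _ ≤ I t / (h t + δ) * 2 := by gcongr
    _ = _ := by ring

lemma kS {s : ℝ} (h2 : s ≤ S) : κ * Real.sqrt s ≤ 1 / 8 := by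
  refine le_trans ?_ F.hS
  have := F.hκ
  gcongr

lemma up_aux {s1 s2 δ : ℝ} (h1 : 0 < s1) (h12 : s1 ≤ s2) (h2 : s2 ≤ S) (hδ : 0 ≤ δ)
    (hpos : ∀ s ∈ Icc s1 s2, 0 < h s + δ) :
    Real.log (h s2 + δ) - Real.log (h s1 + δ) ≤
      (A + 1 + I s2 / (h s2 + δ)) * (Real.log s2 - Real.log s1) := by
  set m := A + 1 + I s2 / (h s2 + δ) with hm
  have key : ∀ s ∈ Icc s1 s2, ∃ d, d ≤ 0 ∧
      HasDerivAt (fun s => Real.log (h s + δ) - m * Real.log s) d s := by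
    intro s hs
    have hs0 : 0 < s := h1.trans_le hs.1
    have hsS : s ≤ S := hs.2.trans h2
    obtain ⟨h', hh', bh⟩ := F.dh s hs0 hsS
    have hp := hpos s hs
    refine ⟨_, ?_, ((hh'.add_const δ).log hp.ne').sub ((Real.hasDerivAt_log hs0.ne').const_mul m)⟩
    have hN := F.N_le h1 h2 hδ hpos hs ⟨h12, le_rfl⟩ hs.2
    have b1 := (abs_le.1 bh).2
    have h0 := F.h0 s
    have k1 : κ * Real.sqrt s * h s ≤ 1 / 8 * h s := by gcongr; exact F.kS hsS
    have hi : I s ≤ 2 * (I s2 / (h s2 + δ)) * (h s + δ) := (div_le_iff₀ hp).1 hN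
    have n2 : 0 ≤ I s2 / (h s2 + δ) := div_nonneg (F.I0 s2) (hpos s2 ⟨h12, le_rfl⟩).le
    have hA := F.hA
    have : s * h' ≤ m * (h s + δ) := by
      have : 0 ≤ A * δ := by positivity
      have : 0 ≤ I s2 / (h s2 + δ) * (h s + δ) := by positivity
      rw [hm]; linarith
    have e : h' / (h s + δ) - m * s⁻¹ = (s * h' - m * (h s + δ)) / (s * (h s + δ)) := by
      field_simp
    rw [e]
    exact div_nonpos_of_nonpos_of_nonneg (by linarith) (by positivity)
  have anti : AntitoneOn (fun s => Real.log (h s + δ) - m * Real.log s) (Icc s1 s2) := by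
    refine antitoneOn_of_deriv_nonpos (convex_Icc _ _) ?_ ?_ ?_
    · intro s hs
      obtain ⟨d, -, hd⟩ := key s hs
      exact hd.continuousAt.continuousWithinAt
    · intro s hs
      obtain ⟨d, -, hd⟩ := key s (interior_subset hs)
      exact hd.differentiableAt.differentiableWithinAt
    · intro s hs
      obtain ⟨d, h0, hd⟩ := key s (interior_subset hs)
      rw [hd.deriv]; exact h0
  have := anti ⟨le_rfl, h12⟩ ⟨h12, le_rfl⟩ h12
  simp only at this
  linarith

lemma pos_of_pos {s1 s2 : ℝ} (h1 : 0 < s1) (h12 : s1 ≤ s2) (h2 : s2 ≤ S) (hp : 0 < h s2) :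
    0 < h s1 := by
  have hl : 0 ≤ Real.log s2 - Real.log s1 := sub_nonneg.2 (Real.log_le_log h1 h12)
  set m := (A + 1 + I s2 / h s2) * (Real.log s2 - Real.log s1) with hm
  have key : ∀ δ, 0 < δ → Real.exp (-m) * h s2 ≤ h s1 + δ := by
    intro δ hδ
    have hpos : ∀ s ∈ Icc s1 s2, 0 < h s + δ := fun s _ => by linarith [F.h0 s]
    have h3 := F.up_aux h1 h12 h2 hδ.le hpos
    have h4 : (A + 1 + I s2 / (h s2 + δ)) * (Real.log s2 - Real.log s1) ≤ m := by
      rw [hm]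
      have := F.I0 s2
      gcongr; linarith
    have h5 : Real.log (h s2) ≤ Real.log (h s2 + δ) := Real.log_le_log hp (by linarith)
    have h6 : -m + Real.log (h s2) ≤ Real.log (h s1 + δ) := by linarith
    have h7 := Real.exp_le_exp.2 h6
    rwa [Real.exp_add, Real.exp_log hp, Real.exp_log (hpos s1 ⟨le_rfl, h12⟩)] at h7
  have : Real.exp (-m) * h s2 ≤ h s1 := le_of_forall_pos_le_add key
  exact lt_of_lt_of_le (by positivity) this

theorem K1 {s1 s2 : ℝ} (h1 : 0 < s1) (h12 : s1 ≤ s2) (h2 : s2 ≤ S) (hp : 0 < h s2) :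
    Real.log (h s2) - Real.log (h s1) ≤ (A + 1 + I s2 / h s2) * (Real.log s2 - Real.log s1) := by
  have := F.up_aux h1 h12 h2 le_rfl (fun s hs => by
    rw [add_zero]; exact F.pos_of_pos (h1.trans_le hs.1) hs.2 h2 hp)
  simpa using this

theorem K2 {s1 s2 : ℝ} (h1 : 0 < s1) (h12 : s1 ≤ s2) (h2 : s2 ≤ S) (hp : 0 < h s2) :
    I s1 / h s1 / 12 * (Real.log s2 - Real.log s1) ≤ Real.log (h s2) - Real.log (h s1) := by
  have hpos : ∀ s ∈ Icc s1 s2, 0 < h s + 0 := (fun s hs => by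
    rw [add_zero]; exact F.pos_of_pos (h1.trans_le hs.1) hs.2 h2 hp)
  set m := I s1 / h s1 / 12 with hm
  have key : ∀ s ∈ Icc s1 s2, ∃ d, 0 ≤ d ∧
      HasDerivAt (fun s => Real.log (h s) - m * Real.log s) d s := by
    intro s hs
    have hs0 : 0 < s := h1.trans_le hs.1
    have hsS : s ≤ S := hs.2.trans h2
    obtain ⟨h', hh', bh⟩ := F.dh s hs0 hsS
    have hp := hpos s hs
    have hN := F.N_le h1 h2 le_rfl hpos ⟨le_rfl, h12⟩ hs hs.1
    simp only [add_zero] at hp hN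
    refine ⟨_, ?_, (hh'.log hp.ne').sub ((Real.hasDerivAt_log hs0.ne').const_mul m)⟩
    have b1 := (abs_le.1 bh).1
    have k1 : κ * Real.sqrt s * h s ≤ 1 / 8 * h s := by gcongr; exact F.kS hsS
    have hA : 1 * h s ≤ A * h s := by gcongr; exact F.hA
    have hi : m * h s ≤ I s / 6 := by
      have : m ≤ I s / h s / 6 := by rw [hm]; linarith
      calc _ ≤ I s / h s / 6 * h s := by gcongr
        _ = _ := by field_simp
    have : m * h s ≤ s * h' := by linarith
    have e : h' / h s - m * s⁻¹ = (s * h' - m * h s) / (s * h s) := by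
      field_simp
    rw [e]
    exact div_nonneg (by linarith) (by positivity)
  have mon : MonotoneOn (fun s => Real.log (h s) - m * Real.log s) (Icc s1 s2) := by
    refine monotoneOn_of_deriv_nonneg (convex_Icc _ _) ?_ ?_ ?_
    · intro s hs
      obtain ⟨d, -, hd⟩ := key s hs
      exact hd.continuousAt.continuousWithinAt
    · intro s hs
      obtain ⟨d, -, hd⟩ := key s (interior_subset hs)
      exact hd.differentiableAt.differentiableWithinAt
    · intro s hs
      obtain ⟨d, h0, hd⟩ := key s (interior_subset hs)
      rw [hd.deriv]; exact h0
  have := mon ⟨le_rfl, h12⟩ ⟨h12, le_rfl⟩ h12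
  simp only at this
  linarith

end Freq
end PartSeven


section PartEight
open Filter Function
open scoped RealInnerProductSpace

/-- abstract consequence of the almost monotonicity of the frequency -/
def KeyAt (M : ℝ → ℝ) (R B C D : ℝ) : Prop :=
  ∃ Φ N : ℝ → ℝ, (∀ r, 0 < r → r ≤ R → 0 ≤ N r) ∧
    (∀ r₁ r₂, 0 < r₁ → r₁ ≤ r₂ → r₂ ≤ R →
      (N r₁ / 6 - 4) * Real.log (r₂ / r₁) ≤ Φ r₂ - Φ r₁ ∧
      Φ r₂ - Φ r₁ ≤ (B + 2 * N r₂) * Real.log (r₂ / r₁)) ∧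
    ∀ r, 0 < r → r ≤ R → Real.log (M (r / D)) - C ≤ Φ r ∧ Φ r ≤ Real.log (M (D * r)) + C

variable {E : Type*} [NormedAddCommGroup E] [InnerProductSpace ℝ E] [FiniteDimensional ℝ E]
  [MeasurableSpace E] [BorelSpace E]

namespace Sol
variable {a : E → E →L[ℝ] E} {G : E →L[ℝ] E} {Λ : ℝ} {L : ℝ≥0} {u : E → ℝ} {g : E → E} {ρ : ℝ}

lemma int_u2 (S : Sol a u g ρ) : Integrable fun x => u x ^ 2 := by
  have h1 : HasCompactSupport fun x => u x ^ 2 := by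
    refine HasCompactSupport.intro S.hc fun x hx => ?_
    rw [image_eq_zero_of_notMem_tsupport hx]; norm_num
  exact (S.cu.pow 2).integrable_of_hasCompactSupport h1

lemma h_le (h : Geo a G Λ L) (S : Sol a u g ρ) {r : ℝ} (hr : 0 < r) :
    hF a G u (r ^ 2) ≤ Λ ^ 4 * r ^ 4 * ∫ x in ball 0 (2 * Λ * r), u x ^ 2 := by
  have hp := h.pos
  have hr2 : 0 < r ^ 2 := by positivity
  rw [← integral_const_mul, ← integral_indicator measurableSet_ball]
  refine integral_mono (int_w h (int_h h S) hr2 2)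
    ((S.int_u2.const_mul _).indicator measurableSet_ball) fun x => ?_
  by_cases hx : x ∈ ball (0 : E) (2 * Λ * r)
  · simp only [indicator_of_mem hx]
    have h1 := h.qp_le x
    have h2 := w_nonneg (G := G) (r ^ 2) x
    have h3 : wF G (r ^ 2) x ≤ r ^ 2 := max_le (by linarith [h.p_nonneg x]) hr2.le
    have h4 := h.qp_nonneg x
    calc _ ≤ (Λ ^ 4 * u x ^ 2) * (r ^ 2) ^ 2 := by gcongr
      _ = _ := by ring
  · have h1 : wF G (r ^ 2) x = 0 := by
      apply w_supp h hr2
      rw [Real.sqrt_sq hr.le]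
      have : 2 * Λ * r ≤ ‖x‖ := by simpa using hx
      nlinarith [mul_pos hp hr]
    simp [indicator_of_notMem hx, h1]

lemma h_ge [Nontrivial E] (h : Geo a G Λ L) (S : Sol a u g ρ) {r : ℝ} (hr : 0 < r) :
    r ^ 4 * ∫ x in ball 0 (r / (2 * Λ)), u x ^ 2 ≤ 4 * Λ ^ 4 * hF a G u (r ^ 2) := by
  have hp := h.pos
  have hr2 : 0 < r ^ 2 := by positivity
  rw [hF, ← integral_const_mul, ← integral_const_mul, ← integral_indicator measurableSet_ball]
  refine integral_mono_ae ((S.int_u2.const_mul _).indicator measurableSet_ball)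
    ((int_w h (int_h h S) hr2 2).const_mul _)  ?_
  filter_upwards [ae_ne_zero] with x hx0
  have h1 := h.qp_ge hx0
  have h2 := w_nonneg (G := G) (r ^ 2) x
  have h4 := h.qp_nonneg x
  by_cases hx : x ∈ ball (0 : E) (r / (2 * Λ))
  · simp only [indicator_of_mem hx]
    have h3 : r ^ 2 / 2 ≤ wF G (r ^ 2) x := by
      refine le_max_of_le_left ?_
      have h5 := h.ple x
      have h6 : ‖x‖ < r / (2 * Λ) := by simpa using hx
      have h7 : ‖x‖ ^ 2 ≤ (r / (2 * Λ)) ^ 2 := by gcongr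
      have h8 : Λ * ‖x‖ ^ 2 ≤ Λ * (r / (2 * Λ)) ^ 2 := by gcongr
      have h9 : Λ * (r / (2 * Λ)) ^ 2 = r ^ 2 / (4 * Λ) := by field_simp; ring
      have h10 : r ^ 2 / (4 * Λ) ≤ r ^ 2 / 2 := by
        apply div_le_div_of_nonneg_left hr2.le (by norm_num); linarith [h.hΛ]
      linarith
    calc r ^ 4 * u x ^ 2 = 4 * 1 * u x ^ 2 * (r ^ 2 / 2) ^ 2 := by ring
      _ ≤ 4 * (Λ ^ 4 * (qF a G x / pF G x)) * u x ^ 2 * wF G (r ^ 2) x ^ 2 := by gcongr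
      _ = _ := by ring
  · simp only [indicator_of_notMem hx]
    positivity

lemma freq [Nontrivial E] (h : Geo a G Λ L) (S : Sol a u g ρ) {R : ℝ} (hR : 0 < R)
    (h1 : Λ * R < ρ) (h2 : kap (Module.finrank ℝ E) Λ L * R ≤ 1 / 8) :
    Freq (hF a G u) (iF a G g) (jF a G g) (2 + Module.finrank ℝ E / 2)
      (kap (Module.finrank ℝ E) Λ L) (R ^ 2) := by
  have hp := h.pos
  have hs : ∀ s, 0 < s → s ≤ R ^ 2 → Λ * Real.sqrt s < ρ := by
    intro s hs hsR
    have : Real.sqrt s ≤ R := by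
      rw [Real.sqrt_le_left hR.le]; exact hsR
    exact lt_of_le_of_lt (by gcongr) h1
  refine ⟨?_, ?_, ?_, h_nonneg h, i_nonneg h, ?_, ?_, ?_⟩
  · have : (0 : ℝ) ≤ Module.finrank ℝ E := Nat.cast_nonneg _
    linarith
  · unfold kap; positivity
  · rwa [Real.sqrt_sq hR.le]
  · intro s h0 hsR; exact h_deriv h S h0 (hs s h0 hsR)
  · intro s h0 hsR; exact i_deriv h S h0 (hs s h0 hsR)
  · intro s h0 hsR t; exact cauchy h S h0 (hs s h0 hsR) t

theorem posAt [Nontrivial E] (h : Geo a G Λ L) (S : Sol a u g ρ) {R : ℝ} (hR : 0 < R)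
    (h1 : Λ * R < ρ) (h2 : kap (Module.finrank ℝ E) Λ L * R ≤ 1 / 8)
    (hM : 0 < ∫ x in ball 0 (R / (2 * Λ)), u x ^ 2) {r : ℝ} (hr : 0 < r) (hrR : r ≤ R) :
    0 < ∫ x in ball 0 (2 * Λ * r), u x ^ 2 := by
  have hp := h.pos
  have F := S.freq h hR h1 h2
  have h3 := S.h_ge h hR
  have h4 : 0 < hF a G u (R ^ 2) := by
    have : 0 < R ^ 4 * ∫ x in ball 0 (R / (2 * Λ)), u x ^ 2 := by positivity
    have := this.trans_le h3
    exact pos_of_mul_pos_right this (by positivity)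
  have h5 := F.pos_of_pos (s1 := r ^ 2) (by positivity) (by gcongr) le_rfl h4
  have h6 := h5.trans_le (S.h_le h hr)
  exact pos_of_mul_pos_right h6 (by positivity)

theorem keyAt [Nontrivial E] (h : Geo a G Λ L) (S : Sol a u g ρ) {R : ℝ} (hR : 0 < R)
    (h1 : Λ * R < ρ) (h2 : kap (Module.finrank ℝ E) Λ L * R ≤ 1 / 8)
    (hM : ∀ r, 0 < r → 0 < ∫ x in ball 0 r, u x ^ 2) :
    KeyAt (fun r => ∫ x in ball 0 r, u x ^ 2) R (2 * (3 + Module.finrank ℝ E / 2))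
      (Real.log (4 * Λ ^ 4)) (2 * Λ) := by
  have hp := h.pos
  have F := S.freq h hR h1 h2
  have hpos : ∀ r, 0 < r → 0 < hF a G u (r ^ 2) := by
    intro r hr
    have h3 := S.h_ge h hr
    have : 0 < r ^ 4 * ∫ x in ball 0 (r / (2 * Λ)), u x ^ 2 := by
      have := hM (r / (2 * Λ)) (by positivity)
      positivity
    have := this.trans_le h3
    exact pos_of_mul_pos_right this (by positivity)
  refine ⟨fun r => Real.log (hF a G u (r ^ 2)) - 4 * Real.log r,
    fun r => iF a G g (r ^ 2) / hF a G u (r ^ 2), ?_, ?_, ?_⟩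
  · intro r _ _
    exact div_nonneg (i_nonneg h _) (h_nonneg h _)
  · intro r₁ r₂ hr1 hr12 hr2
    have hr2' : 0 < r₂ := hr1.trans_le hr12
    have hs : r₂ ^ 2 ≤ R ^ 2 := by gcongr
    have a1 := F.K1 (s1 := r₁ ^ 2) (s2 := r₂ ^ 2) (by positivity) (by gcongr) hs (hpos _ hr2')
    have a2 := F.K2 (s1 := r₁ ^ 2) (s2 := r₂ ^ 2) (by positivity) (by gcongr) hs (hpos _ hr2')
    rw [Real.log_pow, Real.log_pow] at a1 a2
    have hl : Real.log (r₂ / r₁) = Real.log r₂ - Real.log r₁ := Real.log_div hr2'.ne' hr1.ne'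
    have hl0 : 0 ≤ Real.log (r₂ / r₁) := Real.log_nonneg ((one_le_div hr1).2 hr12)
    simp only
    rw [hl] at hl0 ⊢
    push_cast at a1 a2
    constructor
    · linarith
    · linarith
  · intro r hr hrR
    have b1 := S.h_le h hr
    have b2 := S.h_ge h hr
    have m1 := hM (r / (2 * Λ)) (by positivity)
    have m2 := hM (2 * Λ * r) (by positivity)
    have b3 := Real.log_le_log (hpos r hr) b1
    have b4 := Real.log_le_log (by positivity) b2
    rw [Real.log_mul (by positivity) (by positivity), Real.log_mul (by positivity) (by positivity), Real.log_pow r] at b3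
    rw [Real.log_mul (by positivity) (by positivity), Real.log_mul (by positivity) (hpos r hr).ne', Real.log_pow r] at b4
    have b5 : Real.log (Λ ^ 4) ≤ Real.log (4 * Λ ^ 4) := Real.log_le_log (by positivity) (by nlinarith [pow_pos hp 4])
    push_cast at b3 b4
    constructor
    · simp only; linarith
    · simp only; linarith

end Sol
end PartEight


section PartNine
open Filter Function
open scoped RealInnerProductSpace

section abs
variable {E : Type*} [NormedAddCommGroup E] [InnerProductSpace ℝ E] [FiniteDimensional ℝ E]

lemma sym_sq_le {T : E →L[ℝ] E} {Λ : ℝ} (hΛ : 1 ≤ Λ) (sym : ∀ v w, ⟪T v, w⟫ = ⟪v, T w⟫)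
    (ell : ∀ v, ‖v‖ ^ 2 ≤ Λ * ⟪T v, v⟫) (up : ∀ v, ⟪T v, v⟫ ≤ Λ * ‖v‖ ^ 2) (v : E) :
    ‖T v‖ ^ 2 ≤ Λ * ⟪T v, v⟫ := by
  have hp : 0 < Λ := by linarith
  have h1 := ell (v - Λ⁻¹ • T v)
  have h2 : 0 ≤ ⟪T (v - Λ⁻¹ • T v), v - Λ⁻¹ • T v⟫ := by
    have : 0 ≤ Λ * ⟪T (v - Λ⁻¹ • T v), v - Λ⁻¹ • T v⟫ := (sq_nonneg _).trans h1
    exact nonneg_of_mul_nonneg_right this hp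
  have h3 := up (T v)
  have h4 : ⟪T (T v), v⟫ = ‖T v‖ ^ 2 := by rw [sym, real_inner_self_eq_norm_sq]
  rw [map_sub, map_smul, inner_sub_left, inner_sub_right, inner_sub_right, inner_smul_left,
    inner_smul_left, inner_smul_right, inner_smul_right, h4, real_inner_self_eq_norm_sq] at h2
  simp only [conj_trivial] at h2
  have h5 : Λ * (⟪T v, v⟫ - Λ⁻¹ * ‖T v‖ ^ 2 - (Λ⁻¹ * ‖T v‖ ^ 2 - Λ⁻¹ * (Λ⁻¹ * ⟪T (T v), T v⟫))) =
    Λ * ⟪T v, v⟫ - 2 * ‖T v‖ ^ 2 + Λ⁻¹ * ⟪T (T v), T v⟫ := by field_simp; ring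
  have h6 := mul_nonneg hp.le h2
  have h7 : Λ⁻¹ * ⟪T (T v), T v⟫ ≤ ‖T v‖ ^ 2 := by
    rw [inv_mul_le_iff₀ hp]; exact h3
  have h8 : Λ * (⟪T v, v⟫ - Λ⁻¹ * ‖T v‖ ^ 2 - (Λ⁻¹ * ‖T v‖ ^ 2 - Λ⁻¹ * (Λ⁻¹ * ⟪T (T v), T v⟫))) ≥ 0 := by
    convert h6 using 2
  rw [h5] at h8
  linarith

lemma geo_of {a : E → E →L[ℝ] E} {Λ : ℝ} {L : ℝ≥0} (hΛ : 1 ≤ Λ) (lip : LipschitzWith L a)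
    (sym : ∀ x v w, ⟪a x v, w⟫ = ⟪v, a x w⟫)
    (ell : ∀ x v, ‖v‖ ^ 2 ≤ Λ * ⟪a x v, v⟫) (up : ∀ x v, ⟪a x v, v⟫ ≤ Λ * ‖v‖ ^ 2) :
    ∃ G, Geo a G Λ L := by
  have hp : 0 < Λ := by linarith
  have key := fun x => sym_sq_le hΛ (sym x) (ell x) (up x)
  have inj : Injective (a 0 : E →ₗ[ℝ] E) := by
    rw [injective_iff_map_eq_zero]
    intro v hv
    have h1 := ell 0 v
    have h2 : a 0 v = 0 := hv
    rw [h2, inner_zero_left, mul_zero] at h1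
    have : ‖v‖ = 0 := by nlinarith [norm_nonneg v]
    simpa using this
  let e := LinearEquiv.ofInjectiveEndo (a 0 : E →ₗ[ℝ] E) inj
  let G : E →L[ℝ] E := LinearMap.toContinuousLinearMap (e.symm : E →ₗ[ℝ] E)
  have aG : ∀ v, a 0 (G v) = v := fun v => e.apply_symm_apply v
  refine ⟨G, hΛ, lip, sym, ?_, ell, ?_, aG, ?_, ?_⟩
  · intro x
    refine ContinuousLinearMap.opNorm_le_bound _ hp.le fun v => ?_
    have h1 := key x v
    have h2 := up x v
    have : ‖a x v‖ ^ 2 ≤ (Λ * ‖v‖) ^ 2 := by nlinarith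
    exact (pow_le_pow_iff_left₀ (norm_nonneg _) (by positivity) two_ne_zero).1 this
  · intro v w
    have h1 := sym 0 (G v) (G w)
    rw [aG, aG] at h1; exact h1.symm
  · refine ContinuousLinearMap.opNorm_le_bound _ hp.le fun v => ?_
    have h1 := ell 0 (G v)
    rw [aG] at h1
    have h2 := real_inner_le_norm v (G v)
    by_cases h0 : ‖G v‖ = 0
    · rw [h0]; positivity
    · have h3 : 0 < ‖G v‖ := lt_of_le_of_ne (norm_nonneg _) (Ne.symm h0)
      have : ‖G v‖ * ‖G v‖ ≤ (Λ * ‖v‖) * ‖G v‖ := by nlinarith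
      exact le_of_mul_le_mul_right this h3
  · intro v
    have h1 := key 0 (G v)
    rw [aG] at h1
    rwa [real_inner_comm] at h1

/-- radial retraction -/
def retr (ρ : ℝ) (x : E) : E := (min 1 (ρ / ‖x‖)) • x

lemma retr_in {ρ : ℝ} {x : E} (h : ‖x‖ ≤ ρ) : retr ρ x = x := by
  unfold retr
  rcases eq_or_ne x 0 with rfl | hx
  · simp
  · rw [min_eq_left, one_smul]
    rwa [one_le_div (norm_pos_iff.2 hx)]

lemma retr_out {ρ : ℝ} {x : E} (hρ : 0 < ρ) (h : ρ ≤ ‖x‖) : retr ρ x = (ρ / ‖x‖) • x := by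
  unfold retr
  rw [min_eq_right]
  rwa [div_le_one (hρ.trans_le h)]

lemma retr_norm {ρ : ℝ} (hρ : 0 < ρ) (x : E) : ‖retr ρ x‖ ≤ ρ := by
  rcases le_total ‖x‖ ρ with h | h
  · rwa [retr_in h]
  · rw [retr_out hρ h, norm_smul, Real.norm_of_nonneg (by positivity), div_mul_cancel₀]
    exact (hρ.trans_le h).ne'

lemma retr_dist {ρ : ℝ} (hρ : 0 < ρ) {x : E} (h : ρ ≤ ‖x‖) : ‖x - retr ρ x‖ = ‖x‖ - ρ := by
  have hx := hρ.trans_le h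
  have : x - (ρ / ‖x‖) • x = (1 - ρ / ‖x‖) • x := by rw [sub_smul, one_smul]
  rw [retr_out hρ h, this, norm_smul, Real.norm_of_nonneg, sub_mul, one_mul, div_mul_cancel₀ _ hx.ne']
  rw [sub_nonneg, div_le_one hx]; exact h

lemma retr_lip_aux {ρ : ℝ} (hρ : 0 < ρ) {x y : E} (hxy : ‖y‖ ≤ ‖x‖) :
    ‖retr ρ x - retr ρ y‖ ≤ 2 * ‖x - y‖ := by
  have h0 := norm_sub_norm_le x y
  rcases le_total ‖x‖ ρ with hx | hx
  · rw [retr_in hx, retr_in (hxy.trans hx)]; linarith [norm_nonneg (x - y)]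
  rcases le_total ‖y‖ ρ with hy | hy
  · rw [retr_in hy]
    have h1 := retr_dist hρ hx
    have h2 : ‖retr ρ x - y‖ ≤ ‖retr ρ x - x‖ + ‖x - y‖ := norm_sub_le_norm_sub_add_norm_sub _ _ _
    rw [norm_sub_rev] at h1
    have h3 : ‖y‖ ≤ ρ := hy
    rw [h1] at h2
    rcases eq_or_ne ‖y‖ ρ with e | e
    · linarith
    · linarith [norm_nonneg (x-y)]
  · have hx' := hρ.trans_le hx
    have hy' := hρ.trans_le hy
    rw [retr_out hρ hx, retr_out hρ hy]
    have : (ρ / ‖x‖) • x - (ρ / ‖y‖) • y = (ρ / ‖y‖) • (x - y) + (ρ / ‖x‖ - ρ / ‖y‖) • x := by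
      rw [sub_smul, smul_sub]; abel
    rw [this]
    refine (norm_add_le _ _).trans ?_
    rw [norm_smul, norm_smul, Real.norm_of_nonneg (by positivity)]
    have h1 : ρ / ‖y‖ ≤ 1 := by rwa [div_le_one hy']
    have h2 : ρ / ‖x‖ ≤ ρ / ‖y‖ := div_le_div_of_nonneg_left hρ.le hy' hxy
    rw [Real.norm_of_nonpos (by linarith)]
    have h3 : -(ρ / ‖x‖ - ρ / ‖y‖) * ‖x‖ = (ρ / ‖y‖) * (‖x‖ - ‖y‖) := by field_simp; ring
    rw [h3]
    have h4 : (ρ / ‖y‖) * (‖x‖ - ‖y‖) ≤ 1 * (‖x‖ - ‖y‖) := by gcongr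
    have h5 : (ρ / ‖y‖) * ‖x - y‖ ≤ 1 * ‖x - y‖ := by gcongr
    linarith

lemma retr_lip {ρ : ℝ} (hρ : 0 < ρ) : LipschitzWith 2 (retr ρ : E → E) := by
  refine LipschitzWith.of_dist_le_mul fun x y => ?_
  rw [dist_eq_norm, dist_eq_norm]
  rcases le_total ‖y‖ ‖x‖ with h | h
  · simpa using retr_lip_aux hρ h
  · rw [norm_sub_rev, norm_sub_rev x]; simpa using retr_lip_aux hρ h
end abs
end PartNine


section PartTen
open Filter Function
open scoped RealInnerProductSpace
variable {k : ℕ}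

def mCLM (B : Matrix (Fin k) (Fin k) ℝ) : Euc k →L[ℝ] Euc k := Matrix.toEuclideanCLM (𝕜 := ℝ) B

lemma mCLM_apply (B : Matrix (Fin k) (Fin k) ℝ) (v : Euc k) (i : Fin k) :
    mCLM B v i = ∑ j, B i j * v j := by
  simp [mCLM, Matrix.mulVec, dotProduct]

lemma mCLM_sub (B C : Matrix (Fin k) (Fin k) ℝ) : mCLM B - mCLM C = mCLM (B - C) := by
  simp [mCLM]

lemma mCLM_inner (B : Matrix (Fin k) (Fin k) ℝ) (v w : Euc k) :
    ⟪mCLM B v, w⟫ = aForm B v w := by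
  rw [PiLp.inner_apply, aForm]
  refine Finset.sum_congr rfl fun i _ => ?_
  rw [mCLM_apply]
  simp [Finset.mul_sum]
  refine Finset.sum_congr rfl fun i _ => ?_
  ring

lemma mCLM_norm {B : Matrix (Fin k) (Fin k) ℝ} {c : ℝ} (hc : 0 ≤ c) (h : ∀ i j, |B i j| ≤ c) :
    ‖mCLM B‖ ≤ c * k ^ 2 := by
  refine ContinuousLinearMap.opNorm_le_bound _ (by positivity) fun v => ?_
  have e : ∀ i, |mCLM B v i| ≤ k * (c * ‖v‖) := by
    intro i
    rw [mCLM_apply]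
    refine (Finset.abs_sum_le_sum_abs _ _).trans ?_
    refine (Finset.sum_le_card_nsmul _ _ (c * ‖v‖) fun j _ => ?_).trans ?_
    · rw [abs_mul]
      have := PiLp.norm_apply_le v j
      rw [Real.norm_eq_abs] at this
      gcongr; exact h i j
    · simp
  have h2 : ‖mCLM B v‖ ≤ ∑ i, |mCLM B v i| := by
    have : mCLM B v = ∑ i, EuclideanSpace.single i (mCLM B v i) := by
      ext j; simp [Finset.sum_apply]
    calc ‖mCLM B v‖ = ‖∑ i, EuclideanSpace.single i (mCLM B v i)‖ := by rw [← this]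
      _ ≤ ∑ i, ‖EuclideanSpace.single i (mCLM B v i)‖ := norm_sum_le _ _
      _ = _ := by simp
  refine h2.trans ((Finset.sum_le_card_nsmul _ _ _ fun i _ => e i).trans ?_)
  simp
  apply le_of_eq; ring

lemma exists_sol {A : Euc k → Matrix (Fin k) (Fin k) ℝ} {L : ℝ≥0} {Λ : ℝ} (hΛ : 1 ≤ Λ)
    (hs : ∀ x ∈ ball (0 : Euc k) 1, (A x).IsSymm) (hL : LipEntries A L (ball 0 1))
    (hE : UnifElliptic A Λ (ball 0 1)) {v : Euc k → ℝ} (hv : ContDiffOn ℝ 1 v (ball 0 1))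
    (hw : IsWeakSol A v (ball 0 1)) {z : Euc k} (hz : ‖z‖ < 1) :
    ∃ a G u g, Geo a G Λ (L * 2 * k ^ 2) ∧ Sol a u g ((1 - ‖z‖) / 2) ∧
      ∀ x ∈ ball 0 ((1 - ‖z‖) / 2), u x = v (z + x) := by
  set ρ := (1 - ‖z‖) / 2 with hρ
  have hρ0 : 0 < ρ := by linarith
  have hin : ∀ x : Euc k, ‖x‖ < 2 * ρ → z + x ∈ ball (0 : Euc k) 1 := by
    intro x hx
    have := norm_add_le z x
    simp; linarith
  have hret : ∀ x, z + retr ρ x ∈ ball (0 : Euc k) 1 := by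
    intro x; apply hin; linarith [retr_norm hρ0 x]
  have hp : 0 < Λ := by linarith
  set a : Euc k → Euc k →L[ℝ] Euc k := fun x => mCLM (A (z + retr ρ x)) with ha
  have nsq : ∀ v : Euc k, ∑ i, v i ^ 2 = ‖v‖ ^ 2 := fun v => (EuclideanSpace.real_norm_sq_eq v).symm
  obtain ⟨G, hG⟩ : ∃ G, Geo a G Λ (L * 2 * k ^ 2) := by
    apply geo_of hΛ
    · refine LipschitzWith.of_dist_le_mul fun x y => ?_
      rw [dist_eq_norm, ha]
      simp only [mCLM_sub]
      refine (mCLM_norm (c := L * (2 * dist x y)) (by positivity) fun i j => ?_).trans ?_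
      · have h1 := (hL i j).dist_le_mul _ (hret x) _ (hret y)
        rw [Real.dist_eq, dist_add_left] at h1
        refine h1.trans ?_
        gcongr
        exact (retr_lip hρ0).dist_le_mul x y
      · push_cast; apply le_of_eq; ring
    · intro x v w
      rw [← real_inner_comm v (a x w), mCLM_inner, mCLM_inner, aForm, aForm, Finset.sum_comm]
      refine Finset.sum_congr rfl fun i _ => Finset.sum_congr rfl fun j _ => ?_
      rw [(hs _ (hret x)).apply]; ring
    · intro x v
      rw [mCLM_inner, ← nsq]
      have := (hE _ (hret x) v).1
      rwa [inv_mul_le_iff₀ hp] at this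
    · intro x v
      rw [mCLM_inner, ← nsq]
      exact (hE _ (hret x) v).2
  let η : ContDiffBump (0 : Euc k) := ⟨ρ, 3 * ρ / 2, hρ0, by linarith⟩
  set u : Euc k → ℝ := fun x => η x * v (z + x) with hu
  have hts : tsupport η = closedBall 0 (3 * ρ / 2) := η.tsupport_eq
  have hvz : ∀ x : Euc k, ‖x‖ < 2 * ρ → ContDiffAt ℝ 1 (fun x => v (z + x)) x := by
    intro x hx
    have h1 : ContDiffAt ℝ 1 v (z + x) := hv.contDiffAt (isOpen_ball.mem_nhds (hin x hx))
    exact h1.comp x (contDiffAt_const.add contDiffAt_id)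
  have hu1 : ContDiff ℝ 1 u := by
    rw [contDiff_iff_contDiffAt]
    intro x
    by_cases hx : ‖x‖ < 2 * ρ
    · exact η.contDiff.contDiffAt.mul (hvz x hx)
    · have h1 : x ∉ tsupport η := by
        rw [hts]; simp; linarith
      have h2 : (fun y => u y) =ᶠ[𝓝 x] fun _ => 0 := by
        filter_upwards [notMem_tsupport_iff_eventuallyEq.1 h1] with y hy
        simp [hu, hy]
      exact contDiffAt_const.congr_of_eventuallyEq h2
  have huc : HasCompactSupport u := η.hasCompactSupport.mul_right
  have huv : ∀ x ∈ ball 0 ρ, u x = v (z + x) := by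
    intro x hx
    have : η x = 1 := η.one_of_mem_closedBall (ball_subset_closedBall hx)
    simp [hu, this]
  set g : Euc k → Euc k := fun x => (InnerProductSpace.toDual ℝ (Euc k)).symm (fderiv ℝ u x) with hg
  have hgi : ∀ x y, ⟪g x, y⟫ = fderiv ℝ u x y := by
    intro x y; simp [hg]
  refine ⟨a, G, u, g, hG, ⟨?_, ?_, huc, ?_⟩, huv⟩
  · intro x
    have h1 : innerSL ℝ (g x) = fderiv ℝ u x := by
      ext y; rw [innerSL_apply_apply, hgi]
    rw [h1]
    exact (hu1.differentiable one_ne_zero x).hasFDerivAt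
  · exact (LinearIsometryEquiv.continuous _).comp (hu1.continuous_fderiv one_ne_zero)
  · intro ψ hψ hψc hψs
    set ψ' : Euc k → ℝ := fun y => ψ (y - z) with hψ'
    have hd' : ∀ y, fderiv ℝ ψ' y = fderiv ℝ ψ (y - z) := by
      intro y
      simp only [hψ', sub_eq_add_neg]
      rw [fderiv_comp_add_right]
    have hts' : ∀ y ∈ tsupport ψ', y - z ∈ tsupport ψ := by
      intro y hy
      have h1 : tsupport ψ' ⊆ (fun y => y - z) ⁻¹' tsupport ψ := by
        apply closure_minimal
        · intro y hy; exact subset_tsupport ψ hy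
        · exact (isClosed_tsupport ψ).preimage (by fun_prop)
      exact h1 hy
    have hz' : ∀ y, y - z ∈ ball (0 : Euc k) ρ → y ∈ ball (0 : Euc k) 1 := by
      intro y hy
      have := hin (y - z) (by simp at hy; linarith)
      simpa using this
    have hw' := hw ψ' (hψ.comp (contDiff_id.sub contDiff_const))
      (hψc.comp_homeomorph (Homeomorph.subRight z)) (fun y hy => hz' y (hψs (hts' y hy)))
    have h0 : ∀ y, y ∉ ball (0 : Euc k) 1 → aForm (A y) (gradVec v y) (gradVec ψ' y) = 0 := by
      intro y hy
      have h1 : fderiv ℝ ψ' y = 0 := by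
        by_contra h
        exact hy (hz' y (hψs (hts' y (support_fderiv_subset ℝ h))))
      simp [aForm, gradVec, h1]
    rw [setIntegral_eq_integral_of_forall_compl_eq_zero h0] at hw'
    rw [← hw', ← integral_sub_right_eq_self _ z]
    refine integral_congr_ae (.of_forall fun y => ?_)
    simp only
    by_cases hy : y - z ∈ tsupport ψ
    · have hyb := hψs hy
      have e1 : a (y - z) = mCLM (A y) := by
        simp only [ha]
        rw [retr_in (by simp at hyb; linarith)]; congr 2; abel
      have e2 : ∀ w, fderiv ℝ u (y - z) w = fderiv ℝ v y w := by
        have : u =ᶠ[𝓝 (y - z)] fun x => v (x + z) := by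
          filter_upwards [isOpen_ball.mem_nhds hyb] with x hx
          rw [huv x hx, add_comm]
        intro w
        rw [this.fderiv_eq, fderiv_comp_add_right, sub_add_cancel]
      have e3 : ∀ w : Euc k, fderiv ℝ ψ (y - z) w = ∑ i, w i * gradVec ψ' y i := by
        intro w
        have : w = ∑ i, w i • EuclideanSpace.single i (1:ℝ) := by
          ext j; simp [Finset.sum_apply, Pi.single_apply]
        conv_lhs => rw [this]
        simp [gradVec, hd']
      have e4 : ∀ j, g (y - z) j = gradVec v y j := by
        intro j
        have := hgi (y - z) (EuclideanSpace.single j 1)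
        rw [e2] at this
        rw [gradVec, ← this]
        simp [EuclideanSpace.inner_single_right]
      rw [e1, e3, aForm]
      refine Finset.sum_congr rfl fun i _ => ?_
      rw [mCLM_apply, Finset.sum_mul]
      refine Finset.sum_congr rfl fun j _ => ?_
      rw [e4]
    · have h1 : fderiv ℝ ψ (y - z) = 0 := by
        by_contra h
        exact hy (support_fderiv_subset ℝ h)
      simp [h1, aForm, gradVec, hd']
end PartTen


section PartEleven
open Filter Function
variable {k : ℕ}

structure Dat (A : Euc k → Matrix (Fin k) (Fin k) ℝ) (v : Euc k → ℝ) (L : ℝ≥0) (Λ : ℝ) : Prop where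
  hk : 2 ≤ k
  hΛ : 1 ≤ Λ
  hs : ∀ x ∈ ball (0 : Euc k) 1, (A x).IsSymm
  hL : LipEntries A L (ball 0 1)
  hE : UnifElliptic A Λ (ball 0 1)
  hv : ContDiffOn ℝ 1 v (ball 0 1)
  hw : IsWeakSol A v (ball 0 1)
  hn : ∃ x ∈ ball (0 : Euc k) 1, v x ≠ 0

def Mf (v : Euc k → ℝ) (z : Euc k) (r : ℝ) : ℝ := ∫ y in ball z r, v y ^ 2

def c0 (k : ℕ) (L : ℝ≥0) (Λ : ℝ) : ℝ := 1 / (16 * Λ * (kap k Λ (L * 2 * k ^ 2) + 1))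

namespace Dat
variable {A : Euc k → Matrix (Fin k) (Fin k) ℝ} {v : Euc k → ℝ} {L : ℝ≥0} {Λ : ℝ}

lemma cb_sub {z : Euc k} {r : ℝ} (hr : r < 1 - ‖z‖) : closedBall z r ⊆ ball 0 1 := by
  intro y hy
  have h1 : ‖y - z‖ ≤ r := by simpa [dist_eq_norm] using hy
  have h2 : ‖y‖ ≤ ‖y - z‖ + ‖z‖ := by simpa using norm_add_le (y - z) z
  simp; linarith

lemma intOn (h : Dat A v L Λ) {z : Euc k} {r : ℝ} (hr : r < 1 - ‖z‖) :
    IntegrableOn (fun y => v y ^ 2) (ball z r) :=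
  (((h.hv.continuousOn.mono (cb_sub hr)).pow 2).integrableOn_compact
    (isCompact_closedBall z r)).mono_set ball_subset_closedBall

lemma Mpos_of (h : Dat A v L Λ) {z y : Euc k} {r : ℝ} (hr : r < 1 - ‖z‖) (hy : y ∈ ball z r)
    (hy0 : v y ≠ 0) : 0 < Mf v z r := by
  have hO : IsOpen (ball z r ∩ v ⁻¹' {0}ᶜ) :=
    (h.hv.continuousOn.mono (ball_subset_closedBall.trans (cb_sub hr))).isOpen_inter_preimage
      isOpen_ball isOpen_compl_singleton
  rw [Mf, setIntegral_pos_iff_support_of_nonneg_ae (.of_forall fun x => by positivity) (h.intOn hr)]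
  refine lt_of_lt_of_le (hO.measure_pos volume ⟨y, hy, hy0⟩) (measure_mono ?_)
  rintro x ⟨h1, h2⟩
  refine ⟨?_, h1⟩
  simpa using h2

lemma Mmono (h : Dat A v L Λ) {z w : Euc k} {r s : ℝ} (hr : r < 1 - ‖z‖) (hs : ball w s ⊆ ball z r) :
    Mf v w s ≤ Mf v z r :=
  setIntegral_mono_set (h.intOn hr) (.of_forall fun x => by positivity) (.of_forall hs)

lemma M_eq {u : Euc k → ℝ} {z : Euc k} {ρ r : ℝ} (hu : ∀ x ∈ ball 0 ρ, u x = v (z + x)) (hr : r ≤ ρ) :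
    ∫ x in ball 0 r, u x ^ 2 = Mf v z r := by
  have h1 : ∫ x in ball 0 r, u x ^ 2 = ∫ x in ball 0 r, v (z + x) ^ 2 :=
    setIntegral_congr_fun measurableSet_ball fun x hx => by
      rw [hu x (ball_subset_ball hr hx)]
  rw [h1, Mf, ← integral_indicator measurableSet_ball, ← integral_indicator measurableSet_ball,
    ← integral_add_left_eq_self ((ball z r).indicator fun y => v y ^ 2) z]
  refine integral_congr_ae (.of_forall fun x => ?_)
  simp [indicator, dist_eq_norm]

lemma kap_nn {Λ : ℝ} (hΛ : 1 ≤ Λ) (L : ℝ≥0) : 0 ≤ kap k Λ L := by unfold kap; positivity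

lemma c0_pos {Λ : ℝ} (hΛ : 1 ≤ Λ) (L : ℝ≥0) : 0 < c0 k L Λ := by
  have := kap_nn (k := k) hΛ (L * 2 * k ^ 2)
  unfold c0; positivity

lemma c0_a {Λ : ℝ} (hΛ : 1 ≤ Λ) (L : ℝ≥0) : 16 * Λ * c0 k L Λ ≤ 1 := by
  have h1 := kap_nn (k := k) hΛ (L * 2 * k ^ 2)
  have : 16 * Λ * c0 k L Λ = 1 / (kap k Λ (L * 2 * k ^ 2) + 1) := by unfold c0; field_simp
  rw [this, div_le_one (by positivity)]; linarith

lemma c0_b {Λ : ℝ} (hΛ : 1 ≤ Λ) (L : ℝ≥0) : kap k Λ (L * 2 * k ^ 2) * c0 k L Λ ≤ 1 / 16 := by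
  have h1 := kap_nn (k := k) hΛ (L * 2 * k ^ 2)
  unfold c0
  rw [mul_one_div, div_le_div_iff₀ (by positivity) (by positivity)]
  nlinarith

lemma nontriv (h : Dat A v L Λ) : Nontrivial (Euc k) := by
  have : Nonempty (Fin k) := ⟨⟨0, by linarith [h.hk]⟩⟩
  infer_instance

lemma rads (h : Dat A v L Λ) {z : Euc k} (hz : ‖z‖ < 1) :
    0 < c0 k L Λ * (1 - ‖z‖) ∧ Λ * (c0 k L Λ * (1 - ‖z‖)) < (1 - ‖z‖) / 2 ∧
    kap (Module.finrank ℝ (Euc k)) Λ (L * 2 * k ^ 2) * (c0 k L Λ * (1 - ‖z‖)) ≤ 1 / 8 ∧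
    2 * Λ * (c0 k L Λ * (1 - ‖z‖)) ≤ (1 - ‖z‖) / 8 := by
  have h1 := c0_pos (k := k) h.hΛ L
  have h2 := c0_a (k := k) h.hΛ L
  have h3 := c0_b (k := k) h.hΛ L
  have hd : 0 < 1 - ‖z‖ := by linarith
  have hd' : 1 - ‖z‖ ≤ 1 := by linarith [norm_nonneg z]
  refine ⟨by positivity, by nlinarith, ?_, by nlinarith⟩
  rw [finrank_euclideanSpace_fin, ← mul_assoc]
  nlinarith

lemma uc_loc (h : Dat A v L Λ) {z : Euc k} (hz : ‖z‖ < 1)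
    (hp : 0 < Mf v z (c0 k L Λ * (1 - ‖z‖) / (2 * Λ))) {r : ℝ} (hr : 0 < r)
    (hr1 : r < 1 - ‖z‖) : 0 < Mf v z r := by
  have := h.nontriv
  obtain ⟨a, G, u, g, hG, hS, hu⟩ := exists_sol h.hΛ h.hs h.hL h.hE h.hv h.hw hz
  obtain ⟨r1, r2, r3, r4⟩ := h.rads hz
  have hΛ := h.hΛ
  have hΛ0 : 0 < Λ := by linarith
  set R := c0 k L Λ * (1 - ‖z‖) with hR
  have e1 : R / (2 * Λ) ≤ R := div_le_self r1.le (by linarith)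
  have e2 : R ≤ Λ * R := by nlinarith
  rw [← M_eq hu (by linarith)] at hp
  set s := min (r / (2 * Λ)) R with hs
  have hs0 : 0 < s := lt_min (by positivity) r1
  have h5 := hS.posAt hG r1 r2 r3 hp hs0 (min_le_right _ _)
  have e3 : 2 * Λ * s ≤ 2 * Λ * R := by gcongr; exact min_le_right _ _
  have e4 : 2 * Λ * s ≤ 2 * Λ * (r / (2 * Λ)) := by gcongr; exact min_le_left _ _
  rw [mul_div_cancel₀ _ (by positivity)] at e4
  rw [M_eq hu (by linarith)] at h5
  exact h5.trans_le (h.Mmono hr1 (ball_subset_ball e4))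

lemma Mpos (h : Dat A v L Λ) {z : Euc k} (hz : ‖z‖ < 1) {r : ℝ} (hr : 0 < r)
    (hr1 : r < 1 - ‖z‖) : 0 < Mf v z r := by
  have hΛ := h.hΛ
  have hΛ0 : 0 < Λ := by linarith
  let Z : Set (Euc k) := {z | ∀ᶠ y in 𝓝 z, v y = 0}
  have hZ : IsOpen Z := isOpen_setOf_eventually_nhds
  let W : Set (Euc k) := ball 0 1 ∩ Zᶜ
  have key : ∀ z ∈ W, ∀ w : Euc k, ‖w‖ < 1 → dist z w < c0 k L Λ * (1 - ‖w‖) / (2 * Λ) →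
      ∀ s, 0 < s → s < 1 - ‖w‖ → 0 < Mf v w s := by
    rintro z ⟨hz1, hz2⟩ w hw hd s hs hs1
    obtain ⟨r1, r2, r3, r4⟩ := h.rads hw
    refine h.uc_loc hw ?_ hs hs1
    have h3 : ∃ᶠ y in 𝓝 z, v y ≠ 0 := by
      intro hh
      refine hz2 (hh.mono fun y hy => ?_)
      simpa using hy
    obtain ⟨y, hy0, hy⟩ := (h3.and_eventually (isOpen_ball.mem_nhds hd)).exists
    refine h.Mpos_of ?_ hy hy0
    have e1 : c0 k L Λ * (1 - ‖w‖) / (2 * Λ) ≤ c0 k L Λ * (1 - ‖w‖) := div_le_self r1.le (by linarith)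
    nlinarith
  have hW : IsOpen W := by
    rw [Metric.isOpen_iff]
    rintro z hz
    have hz1 : ‖z‖ < 1 := by simpa using hz.1
    have hc : ContinuousAt (fun w : Euc k => c0 k L Λ * (1 - ‖w‖) / (2 * Λ) - dist z w) z := by fun_prop
    have h0 : (0 : ℝ) < c0 k L Λ * (1 - ‖z‖) / (2 * Λ) - dist z z := by
      have := (h.rads hz1).1
      rw [dist_self, sub_zero]; positivity
    have h1 := hc.eventually (lt_mem_nhds h0)
    have h2 := isOpen_ball.mem_nhds hz.1
    obtain ⟨ε, hε, hb⟩ := Metric.eventually_nhds_iff_ball.1 (h1.and h2)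
    refine ⟨ε, hε, fun w hw => ⟨(hb w hw).2, ?_⟩⟩
    intro hwZ
    have hw1 : ‖w‖ < 1 := by simpa using (hb w hw).2
    have h5 := key z hz w hw1 (by linarith [(hb w hw).1])
    obtain ⟨δ, hδ, hb'⟩ := Metric.eventually_nhds_iff_ball.1 hwZ
    have h6 := h5 (min δ ((1 - ‖w‖) / 2)) (lt_min hδ (by linarith))
      (lt_of_le_of_lt (min_le_right _ _) (by linarith))
    have h7 : Mf v w (min δ ((1 - ‖w‖) / 2)) = 0 := by
      rw [Mf]
      rw [setIntegral_congr_fun (g := fun _ => (0:ℝ)) measurableSet_ball, integral_zero]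
      intro y hy
      simp only
      rw [hb' y (ball_subset_ball (min_le_left _ _) hy)]; norm_num
    linarith
  have hsub : ball (0 : Euc k) 1 ⊆ W := by
    obtain ⟨x0, hx0, hv0⟩ := h.hn
    refine (convex_ball (0 : Euc k) 1).isPreconnected.subset_left_of_subset_union hW hZ ?_ ?_ ?_
    · rw [Set.disjoint_left]; intro y hy hy'; exact hy.2 hy'
    · intro y hy
      by_cases hyZ : y ∈ Z
      · exact Or.inr hyZ
      · exact Or.inl ⟨hy, hyZ⟩
    · exact ⟨x0, hx0, hx0, fun hh => hv0 hh.self_of_nhds⟩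
  have h9 := (h.rads hz).1
  exact key z (hsub (by simpa using hz)) z hz (by rw [dist_self]; positivity) r hr hr1

lemma keyM (h : Dat A v L Λ) {z : Euc k} (hz : ‖z‖ < 1) :
    KeyAt (Mf v z) (c0 k L Λ * (1 - ‖z‖)) (6 + k) (Real.log (4 * Λ ^ 4)) (2 * Λ) := by
  have := h.nontriv
  obtain ⟨a, G, u, g, hG, hS, hu⟩ := exists_sol h.hΛ h.hs h.hL h.hE h.hv h.hw hz
  obtain ⟨r1, r2, r3, r4⟩ := h.rads hz
  have hΛ := h.hΛ
  have hΛ0 : 0 < Λ := by linarith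
  set R := c0 k L Λ * (1 - ‖z‖) with hR
  have hd : 0 < 1 - ‖z‖ := by linarith
  obtain ⟨Φ, N, k1, k2, k3⟩ := hS.keyAt hG r1 r2 r3 (by
    intro r hr
    set s := min r ((1 - ‖z‖) / 2)
    have h1 : 0 < ∫ x in ball 0 s, u x ^ 2 := by
      rw [M_eq hu (min_le_right _ _)]
      exact h.Mpos hz (lt_min hr (by linarith)) (lt_of_le_of_lt (min_le_right _ _) (by linarith))
    refine h1.trans_le (setIntegral_mono_set hS.int_u2.integrableOn
      (.of_forall fun x => by positivity) (.of_forall (ball_subset_ball (min_le_left _ _)))))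
  refine ⟨Φ, N, k1, ?_, ?_⟩
  · have e : (2 * (3 + (Module.finrank ℝ (Euc k) : ℝ) / 2)) = 6 + k := by
      rw [finrank_euclideanSpace_fin]; ring
    rwa [e] at k2
  · intro r hr hrR
    have h1 := k3 r hr hrR
    have e1 : r / (2 * Λ) ≤ r := div_le_self hr.le (by linarith)
    have e2 : R ≤ Λ * R := by nlinarith
    have e3 : 2 * Λ * r ≤ 2 * Λ * R := by gcongr
    simp only at h1
    rwa [M_eq hu (by linarith), M_eq hu (by linarith)] at h1
end Dat
end PartEleven


section PartTwelve
open Filter Function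

namespace KeyAt
variable {M : ℝ → ℝ} {R B C D : ℝ}

lemma mono_R {R' : ℝ} (K : KeyAt M R B C D) (h : R' ≤ R) : KeyAt M R' B C D := by
  obtain ⟨Φ, N, k1, k2, k3⟩ := K
  exact ⟨Φ, N, fun r h0 h1 => k1 r h0 (h1.trans h),
    fun r1 r2 h0 h1 h2 => k2 r1 r2 h0 h1 (h2.trans h), fun r h0 h1 => k3 r h0 (h1.trans h)⟩

lemma three (K : KeyAt M R B C D) (hD : 2 ≤ D) {σ : ℝ} (hσ : 0 < σ) (hR : 4 * D ^ 3 * σ ≤ R) :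
    13 * Real.log (M (2 * σ)) ≤ Real.log (M σ) + 12 * Real.log (M (4 * D ^ 4 * σ)) +
      (26 * C + (B + 48) * Real.log (2 * D ^ 2)) := by
  obtain ⟨Φ, N, k1, k2, k3⟩ := K
  have hD0 : 0 < D := by linarith
  have hq : 1 ≤ 2 * D ^ 2 := by nlinarith
  have hl : 0 ≤ Real.log (2 * D ^ 2) := Real.log_nonneg hq
  have e1 : σ / D ≤ 2 * D * σ := by
    rw [div_le_iff₀ hD0]; nlinarith [mul_pos hσ hD0]
  have e2 : 2 * D * σ ≤ 4 * D ^ 3 * σ := by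
    have : 2 * D ≤ 4 * D ^ 3 := by nlinarith [mul_pos hD0 hD0]
    gcongr
  have p1 : 0 < σ / D := by positivity
  have p2 : 0 < 2 * D * σ := by positivity
  have p3 : 0 < 4 * D ^ 3 * σ := by positivity
  have a1 := (k2 _ _ p1 e1 (e2.trans hR)).2
  have a2 := (k2 _ _ p2 e2 hR).1
  have r1 : 2 * D * σ / (σ / D) = 2 * D ^ 2 := by field_simp
  have r2 : 4 * D ^ 3 * σ / (2 * D * σ) = 2 * D ^ 2 := by field_simp; norm_num
  rw [r1] at a1
  rw [r2] at a2
  have b1 := (k3 _ p1 (e1.trans (e2.trans hR))).2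
  have b2 := (k3 _ p2 (e2.trans hR)).1
  have b3 := (k3 _ p3 hR).2
  have s1 : D * (σ / D) = σ := by field_simp
  have s2 : 2 * D * σ / D = 2 * σ := by field_simp
  have s3 : D * (4 * D ^ 3 * σ) = 4 * D ^ 4 * σ := by ring
  rw [s1] at b1
  rw [s2] at b2
  rw [s3] at b3
  nlinarith

lemma lower (K : KeyAt M R B C D) (hD : 2 ≤ D) (hB : 0 ≤ B) (hC : 0 ≤ C)
    (hm : ∀ r s, 0 < r → r ≤ s → s ≤ 2 * R → Real.log (M r) ≤ Real.log (M s))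
    {r₁ r₂ : ℝ} (h1 : 0 < r₁) (h2 : 2 * r₁ < r₂) (h3 : r₂ ≤ R) :
    ((Real.log (M (2 * r₁)) - Real.log (M r₁)) / (24 * Real.log (2 * D ^ 2)) -
      (C / (12 * Real.log (2 * D ^ 2)) + B / 24 + 4 + 2 * C / Real.log 2)) * Real.log (r₂ / r₁) ≤
      Real.log (M r₂) - Real.log (M r₁) := by
  have hD0 : 0 < D := by linarith
  have hq : 1 < 2 * D ^ 2 := by nlinarith
  have hl : 0 < Real.log (2 * D ^ 2) := Real.log_pos hq
  have hl2 : 0 < Real.log 2 := Real.log_pos (by norm_num)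
  have h20 : 0 < r₂ := by linarith
  set q := Real.log (2 * D ^ 2) with hqd
  set ℓ := Real.log (r₂ / r₁) with hℓ
  set ν := Real.log (M (2 * r₁)) - Real.log (M r₁) with hν
  have hℓ2 : Real.log 2 ≤ ℓ := Real.log_le_log (by norm_num) (by rw [le_div_iff₀ h1]; linarith)
  have hℓ0 : 0 < ℓ := by linarith
  have hν0 : 0 ≤ ν := by
    have := hm r₁ (2 * r₁) h1 (by linarith) (by linarith)
    linarith
  have hcl : 2 * C ≤ (2 * C / Real.log 2) * ℓ := by
    rw [div_mul_eq_mul_div, le_div_iff₀ hl2]; gcongr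
  have hmon : Real.log (M (2 * r₁)) ≤ Real.log (M r₂) := hm _ _ (by linarith) h2.le (by linarith)
  rcases le_or_gt ℓ (2 * q) with hc | hc
  · have g1 : ν / (24 * q) * ℓ ≤ ν := by
      rw [div_mul_eq_mul_div, div_le_iff₀ (by positivity)]
      nlinarith
    have g2 : 0 ≤ (C / (12 * q) + B / 24 + 4 + 2 * C / Real.log 2) * ℓ := by positivity
    rw [sub_mul]
    linarith
  · obtain ⟨Φ, N, k1, k2, k3⟩ := K
    have hlog : Real.log (r₂ / D / (2 * D * r₁)) = ℓ - q := by
      rw [hℓ, hqd, ← Real.log_div (by positivity) (by positivity)]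
      congr 1; field_simp
    have hle : 2 * D * r₁ ≤ r₂ / D := by
      have : 0 < Real.log (r₂ / D / (2 * D * r₁)) := by rw [hlog]; linarith
      by_contra hh
      push Not at hh
      have : Real.log (r₂ / D / (2 * D * r₁)) ≤ 0 := 
        Real.log_nonpos (by positivity) (by rw [div_le_one (by positivity)]; exact hh.le)
      linarith
    have e0 : r₂ / D ≤ r₂ := div_le_self h20.le (by linarith)
    have e1 : r₁ / D ≤ 2 * D * r₁ := by
      rw [div_le_iff₀ hD0]; nlinarith [mul_pos h1 hD0]
    have p1 : 0 < r₁ / D := by positivity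
    have p2 : 0 < 2 * D * r₁ := by positivity
    have p3 : 0 < r₂ / D := by positivity
    have a1 := (k2 _ _ p1 e1 (by linarith)).2
    have a2 := (k2 _ _ p2 hle (by linarith)).1
    have x1 : 2 * D * r₁ / (r₁ / D) = 2 * D ^ 2 := by field_simp
    rw [x1, ← hqd] at a1
    rw [hlog] at a2
    have b1 := (k3 _ p1 (by linarith)).2
    have b2 := (k3 _ p2 (by linarith)).1
    have b3 := (k3 _ p3 (by linarith)).2
    have n0 := k1 _ p2 (by linarith)
    have s1 : D * (r₁ / D) = r₁ := by field_simp
    have s2 : 2 * D * r₁ / D = 2 * r₁ := by field_simp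
    have s3 : D * (r₂ / D) = r₂ := by field_simp
    rw [s1] at b1
    rw [s2] at b2
    rw [s3] at b3
    set n := N (2 * D * r₁) with hn
    have g1 : ν ≤ (B + 2 * n) * q + 2 * C := by linarith
    have g2 : ν / (24 * q) - (C / (12 * q) + B / 24) ≤ n / 12 := by
      have : ν / (24 * q) - C / (12 * q) - B / 24 = (ν - 2 * C - B * q) / (24 * q) := by
        field_simp; ring
      have g3 : (ν - 2 * C - B * q) / (24 * q) ≤ n / 12 := by
        rw [div_le_iff₀ (by positivity)]; linarith
      linarith
    have g4 : (n / 12) * ℓ - 4 * ℓ ≤ (n / 6 - 4) * (ℓ - q) := by nlinarith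
    have g5 := mul_le_mul_of_nonneg_right g2 hℓ0.le
    have g6 : (ν / (24 * q) - (C / (12 * q) + B / 24 + 4 + 2 * C / Real.log 2)) * ℓ =
      (ν / (24 * q) - (C / (12 * q) + B / 24)) * ℓ - 4 * ℓ - (2 * C / Real.log 2) * ℓ := by ring
    rw [g6]
    have g7 : Real.log (M r₁) ≤ Real.log (M (2 * r₁)) := by linarith
    linarith

lemma upper (K : KeyAt M R B C D) (hD : 2 ≤ D) (hB : 0 ≤ B) (hC : 0 ≤ C)
    (hm : ∀ r s, 0 < r → r ≤ s → s ≤ 2 * R → Real.log (M r) ≤ Real.log (M s))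
    {r₁ r₂ : ℝ} (h1 : 0 < r₁) (h2 : 2 * r₁ < r₂) (h3 : r₂ ≤ R) :
    Real.log (M r₂) - Real.log (M r₁) ≤
      ((13 / Real.log 2) * (Real.log (M (2 * r₂)) - Real.log (M (r₂ / (4 * D ^ 4))) + 2 * C) + B + 48) *
        Real.log (r₂ / r₁) := by
  have hD0 : 0 < D := by linarith
  have hl2 : 0 < Real.log 2 := Real.log_pos (by norm_num)
  have h20 : 0 < r₂ := by linarith
  set ℓ := Real.log (r₂ / r₁) with hℓ
  have hD1 : 1 ≤ D := by linarith
  have hD4 : 1 ≤ D ^ 4 := one_le_pow₀ hD1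
  have hD2 : 1 ≤ D ^ 2 := one_le_pow₀ hD1
  set σ := r₂ / (4 * D ^ 4) with hσ
  have hσ0 : 0 < σ := by positivity
  have hσr : r₂ = 4 * D ^ 4 * σ := by rw [hσ]; field_simp
  have hσ2 : 4 * σ ≤ r₂ := by rw [hσr]; nlinarith
  set X := Real.log (M (2 * r₂)) - Real.log (M σ) with hX
  have hℓ2 : Real.log 2 ≤ ℓ := Real.log_le_log (by norm_num) (by rw [le_div_iff₀ h1]; linarith)
  have hℓ0 : 0 < ℓ := by linarith
  have hX0 : 0 ≤ X := by
    have := hm σ (2 * r₂) hσ0 (by linarith) (by linarith)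
    linarith
  have hr22 := hm r₂ (2 * r₂) h20 (by linarith) (by linarith)
  have hXl : X + 2 * C ≤ ((X + 2 * C) / Real.log 2) * ℓ := by
    rw [div_mul_eq_mul_div, le_div_iff₀ hl2]; gcongr
  have hfin : ((13 / Real.log 2) * (X + 2 * C) + B + 48) * ℓ =
    ((X + 2 * C) / Real.log 2) * ℓ + (B + 2 * (6 * ((X + 2 * C) / Real.log 2) + 24)) * ℓ := by ring
  rw [hfin]
  have hXd : 0 ≤ (X + 2 * C) / Real.log 2 := by positivity
  rcases le_or_gt (D ^ 2 * σ) r₁ with hc | hc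
  · have g1 := hm σ r₁ hσ0 (by nlinarith) (by linarith)
    have g2 : 0 ≤ (B + 2 * (6 * ((X + 2 * C) / Real.log 2) + 24)) * ℓ := by positivity
    linarith
  · obtain ⟨Φ, N, k1, k2, k3⟩ := K
    have e1 : r₁ / D ≤ D * σ := by rw [div_le_iff₀ hD0]; nlinarith
    have p1 : 0 < r₁ / D := by positivity
    have p2 : 0 < D * σ := by positivity
    have e2 : 2 * (D * σ) ≤ r₂ := by
      have : D ≤ D ^ 4 := le_self_pow₀ hD1 (by norm_num)
      have := mul_le_mul_of_nonneg_right this hσ0.le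
      have x4 : 0 ≤ D ^ 4 * σ := by positivity
      rw [hσr]; linarith
    have a1 := (k2 _ _ p1 e1 (by linarith)).2
    have a2 := (k2 _ _ p2 (by linarith : D * σ ≤ 2 * (D * σ)) (by linarith)).1
    have x2 : 2 * (D * σ) / (D * σ) = 2 := by field_simp
    rw [x2] at a2
    have b1 := (k3 _ p1 (by linarith)).2
    have b2 := (k3 _ p2 (by linarith)).1
    have b3 := (k3 (2 * (D * σ)) (by linarith) (by linarith)).2
    have n0 := k1 _ p2 (by linarith)
    have s1 : D * (r₁ / D) = r₁ := by field_simp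
    have s2 : D * σ / D = σ := by field_simp
    rw [s1] at b1
    rw [s2] at b2
    have b4 : Real.log (M (D * (2 * (D * σ)))) ≤ Real.log (M (2 * r₂)) := by
      apply hm _ _ (by positivity) _ (by linarith)
      rw [hσr]
      have : D ^ 2 ≤ D ^ 4 := pow_le_pow_right₀ hD1 (by norm_num)
      have := mul_le_mul_of_nonneg_right this hσ0.le
      have x3 : D * (2 * (D * σ)) = 2 * (D ^ 2 * σ) := by ring
      have x4 : 0 ≤ D ^ 4 * σ := by positivity
      rw [x3]; linarith
    set n := N (D * σ) with hn
    have g1 : n ≤ 6 * ((X + 2 * C) / Real.log 2) + 24 := by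
      have : (n / 6 - 4) ≤ (X + 2 * C) / Real.log 2 := by
        rw [le_div_iff₀ hl2]; linarith
      linarith
    have g2 : Real.log (D * σ / (r₁ / D)) ≤ ℓ := by
      apply Real.log_le_log (by positivity)
      have : D * σ / (r₁ / D) = (D ^ 2 * σ) / r₁ := by field_simp
      rw [this]
      gcongr
      rw [hσr]
      have : D ^ 2 ≤ 4 * D ^ 4 := by
        have := pow_le_pow_right₀ hD1 (show 2 ≤ 4 by norm_num)
        linarith
      gcongr
    have g3 : (B + 2 * n) * Real.log (D * σ / (r₁ / D)) ≤
        (B + 2 * (6 * ((X + 2 * C) / Real.log 2) + 24)) * ℓ := by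
      have : B + 2 * n ≤ (B + 2 * (6 * ((X + 2 * C) / Real.log 2) + 24)) := by linarith
      calc (B + 2 * n) * Real.log (D * σ / (r₁ / D)) ≤ (B + 2 * n) * ℓ := by gcongr
        _ ≤ _ := by gcongr
    linarith

end KeyAt
end PartTwelve


section PartThirteen
open Filter Function
variable {k : ℕ}

lemma exists_cover (k : ℕ) {ε : ℝ} (hε : 0 < ε) : ∃ t : Finset (Euc k), 0 < t.card ∧
    (∀ y ∈ t, ‖y‖ ≤ 1) ∧ ∀ x : Euc k, ‖x‖ < 1 → ∃ y ∈ t, ‖x - y‖ < ε := by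
  obtain ⟨t, ht, hf, hc⟩ := (isCompact_closedBall (0 : Euc k) 1).finite_cover_balls hε
  have hx : ∀ x : Euc k, ‖x‖ < 1 → ∃ y ∈ hf.toFinset, ‖x - y‖ < ε := by
    intro x hx
    have := hc (show x ∈ closedBall (0 : Euc k) 1 by simpa using hx.le)
    simp only [mem_iUnion, mem_ball, dist_eq_norm, exists_prop] at this
    simpa using this
  refine ⟨hf.toFinset, ?_, ?_, hx⟩
  · obtain ⟨y, hy, _⟩ := hx 0 (by simp)
    exact Finset.card_pos.2 ⟨y, hy⟩
  · intro y hy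
    have := ht (by simpa using hy)
    simpa using this

namespace Dat
variable {A : Euc k → Matrix (Fin k) (Fin k) ℝ} {v : Euc k → ℝ} {L : ℝ≥0} {Λ : ℝ}

lemma c0_le (h : Dat A v L Λ) : c0 k L Λ ≤ 1 / 16 := by
  have := c0_a (k := k) h.hΛ L
  have := c0_pos (k := k) h.hΛ L
  nlinarith [h.hΛ]

lemma keyM' (h : Dat A v L Λ) {z : Euc k} (hz : ‖z‖ < 3 / 4) :
    KeyAt (Mf v z) (c0 k L Λ / 4) (6 + k) (Real.log (4 * Λ ^ 4)) (2 * Λ) := by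
  refine (h.keyM (by linarith)).mono_R ?_
  have := c0_pos (k := k) h.hΛ L
  nlinarith

def C3 (k : ℕ) (Λ : ℝ) : ℝ :=
  26 * Real.log (4 * Λ ^ 4) + ((6 + k) + 48) * Real.log (2 * (2 * Λ) ^ 2)

lemma C3_nn {Λ : ℝ} (hΛ : 1 ≤ Λ) : 0 ≤ C3 k Λ := by
  have h1 : 0 ≤ Real.log (4 * Λ ^ 4) := Real.log_nonneg (by linarith [one_le_pow₀ hΛ (n := 4)])
  have h2 : 0 ≤ Real.log (2 * (2 * Λ) ^ 2) := Real.log_nonneg (by nlinarith)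
  unfold C3; positivity

lemma chain (h : Dat A v L Λ) {x : Euc k} (hx : ‖x‖ < 1 / 2) {σ : ℝ} (hσ : 0 < σ)
    (hr : 4 * (2 * Λ) ^ 4 * σ < c0 k L Λ / 4) (j : ℕ) :
    ∀ z : Euc k, ‖z - x‖ ≤ j * σ → ‖z - x‖ ≤ 4 * (2 * Λ) ^ 4 * σ →
      (1 / 13) ^ j * (Real.log (Mf v x (2 * (4 * (2 * Λ) ^ 4 * σ))) - Real.log (Mf v x σ)) - C3 k Λ ≤
        Real.log (Mf v x (2 * (4 * (2 * Λ) ^ 4 * σ))) - Real.log (Mf v z σ) := by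
  have hΛ := h.hΛ
  have hc := h.c0_le
  have hC := C3_nn (k := k) hΛ
  have hΛ3 : (1 : ℝ) ≤ Λ ^ 3 := one_le_pow₀ hΛ
  have hΛ4 : (1 : ℝ) ≤ Λ ^ 4 := one_le_pow₀ hΛ
  set r := 4 * (2 * Λ) ^ 4 * σ with hrd
  have hσr : 64 * σ ≤ r := by
    have : r = 64 * Λ ^ 4 * σ := by rw [hrd]; ring
    rw [this]; nlinarith
  have h3r : 4 * (2 * Λ) ^ 3 * σ ≤ r := by
    have : r = (2 * Λ) * (4 * (2 * Λ) ^ 3 * σ) := by rw [hrd]; ring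
    rw [this]
    have : 0 < 4 * (2 * Λ) ^ 3 * σ := by positivity
    nlinarith
  have hzn : ∀ z : Euc k, ‖z - x‖ ≤ r → ‖z‖ < 3 / 4 := by
    intro z hz
    have : ‖z‖ ≤ ‖z - x‖ + ‖x‖ := by simpa using norm_add_le (z - x) x
    linarith
  induction j with
  | zero =>
    intro z hz _
    have : z = x := by
      have : ‖z - x‖ ≤ 0 := by simpa using hz
      rw [norm_le_zero_iff, sub_eq_zero] at this; exact this
    subst this
    simp; exact hC
  | succ j ih =>
    intro z hz hzr
    set t : ℝ := j / (j + 1) with ht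
    have hj1 : (0 : ℝ) < j + 1 := by positivity
    have ht0 : 0 ≤ t := by positivity
    have ht1 : t ≤ 1 := by rw [ht, div_le_one hj1]; linarith
    push_cast at hz
    set w : Euc k := x + t • (z - x) with hw
    have hwx : w - x = t • (z - x) := by rw [hw]; abel
    have hwn : ‖w - x‖ = t * ‖z - x‖ := by rw [hwx, norm_smul, Real.norm_of_nonneg ht0]
    have hzw : z - w = (1 - t) • (z - x) := by rw [hw, sub_smul, one_smul]; abel
    have hzwn : ‖z - w‖ ≤ σ := by
      rw [hzw, norm_smul, Real.norm_of_nonneg (by linarith)]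
      have : 1 - t = 1 / (j + 1) := by rw [ht]; field_simp; ring
      rw [this, one_div_mul_eq_div, div_le_iff₀ hj1]; linarith
    have i1 := ih w (by
      rw [hwn]
      calc t * ‖z - x‖ ≤ t * ((j + 1) * σ) := by gcongr
        _ = j * σ := by rw [ht]; field_simp) (by
      rw [hwn]; nlinarith [norm_nonneg (z - x)])
    have hwr : ‖w - x‖ ≤ r := by rw [hwn]; nlinarith [norm_nonneg (z - x)]
    have hw1 := hzn w hwr
    have hz1 := hzn z hzr
    have three := (h.keyM' hw1).three (by linarith) hσ (h3r.trans hr.le)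
    have m1 : Mf v z σ ≤ Mf v w (2 * σ) := by
      apply h.Mmono (by linarith)
      apply ball_subset_ball'
      rw [dist_eq_norm]; linarith
    have m2 : Mf v w (4 * (2 * Λ) ^ 4 * σ) ≤ Mf v x (2 * r) := by
      apply h.Mmono (by linarith)
      apply ball_subset_ball'
      rw [dist_eq_norm, ← hrd]; linarith
    have l1 := Real.log_le_log (h.Mpos (by linarith) hσ (by linarith)) m1
    have l2 := Real.log_le_log (h.Mpos (by linarith) (by rw [← hrd]; linarith) (by rw [← hrd]; linarith)) m2
    have e3 : 26 * Real.log (4 * Λ ^ 4) + ((6 + k) + 48) * Real.log (2 * (2 * Λ) ^ 2) = C3 k Λ := rfl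
    rw [e3] at three
    rw [pow_succ]
    linarith

lemma chain_main (h : Dat A v L Λ) {x : Euc k} (hx : ‖x‖ < 1 / 2) {r : ℝ} (hr0 : 0 < r)
    (hr : r < c0 k L Λ / 4) {t : Finset (Euc k)} (ht0 : 0 < t.card) (ht1 : ∀ y ∈ t, ‖y‖ ≤ 1)
    (ht : ∀ x : Euc k, ‖x‖ < 1 → ∃ y ∈ t, ‖x - y‖ < 1 / (4 * (2 * Λ) ^ 4)) :
    (1 / 13) ^ ⌈4 * (2 * Λ) ^ 4⌉₊ * (Real.log (Mf v x (2 * r)) - Real.log (Mf v x (r / (4 * (2 * Λ) ^ 4)))) ≤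
      Real.log (Mf v x (2 * r)) - Real.log (Mf v x r) + (C3 k Λ + Real.log t.card) := by
  have hΛ := h.hΛ
  have hΛ0 : 0 < Λ := by linarith
  have hc := h.c0_le
  have hC := C3_nn (k := k) hΛ
  set K := 4 * (2 * Λ) ^ 4 with hK
  have hK0 : 0 < K := by positivity
  have hK1 : 1 ≤ K := by
    have : (1 : ℝ) ≤ Λ ^ 4 := one_le_pow₀ hΛ
    have : K = 64 * Λ ^ 4 := by rw [hK]; ring
    linarith
  set σ := r / K with hσ
  have hσ0 : 0 < σ := by positivity
  have hKσ : K * σ = r := by rw [hσ]; field_simp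
  have hσr : σ ≤ r := div_le_self hr0.le hK1
  have ch := h.chain hx hσ0 (by rw [← hK, hKσ]; exact hr) ⌈K⌉₊
  rw [← hK, hKσ] at ch
  set T := Real.log (Mf v x (2 * r))
  set S := (1 / 13 : ℝ) ^ ⌈K⌉₊ * (T - Real.log (Mf v x σ)) with hS
  have hxr : ∀ s, s ≤ 2 * r → s < 1 - ‖x‖ := by intro s hs; linarith
  have hzn : ∀ y ∈ t, ‖(x + r • y) - x‖ ≤ r := by
    intro y hy
    rw [add_sub_cancel_left, norm_smul, Real.norm_of_nonneg hr0.le]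
    nlinarith [ht1 y hy]
  have hz1 : ∀ y ∈ t, ‖x + r • y‖ < 3 / 4 := by
    intro y hy
    have h1 := hzn y hy
    have : ‖x + r • y‖ ≤ ‖x + r • y - x‖ + ‖x‖ := by
      have := norm_add_le (x + r • y - x) x
      rwa [sub_add_cancel] at this
    linarith
  have hMi : ∀ y ∈ t, Mf v (x + r • y) σ ≤ Real.exp (T - S + C3 k Λ) := by
    intro y hy
    have h1 := ch (x + r • y) ((hzn y hy).trans (by
      rw [← hKσ]; gcongr; exact Nat.le_ceil K)) (hzn y hy)
    have h2 := h.Mpos (by linarith [hz1 y hy]) hσ0 (by linarith [hz1 y hy] : σ < 1 - ‖x + r • y‖)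
    rw [← Real.log_le_iff_le_exp h2]
    linarith
  have hsum : Mf v x r ≤ ∑ y ∈ t, Mf v (x + r • y) σ := by
    unfold Mf
    have hi : ∀ y ∈ t, Integrable ((ball (x + r • y) σ).indicator fun w => v w ^ 2) := by
      intro y hy
      exact (h.intOn (by linarith [hz1 y hy])).integrable_indicator measurableSet_ball
    rw [← integral_indicator measurableSet_ball]
    have e : ∑ y ∈ t, ∫ w in ball (x + r • y) σ, v w ^ 2 =
        ∫ w, ∑ y ∈ t, (ball (x + r • y) σ).indicator (fun w => v w ^ 2) w := by
      rw [integral_finset_sum _ hi]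
      refine Finset.sum_congr rfl fun y _ => ?_
      rw [integral_indicator measurableSet_ball]
    rw [e]
    refine integral_mono ((h.intOn (hxr r (by linarith))).integrable_indicator measurableSet_ball)
      (integrable_finset_sum _ hi) fun w => ?_
    have hnn : ∀ y ∈ t, 0 ≤ (ball (x + r • y) σ).indicator (fun w => v w ^ 2) w :=
      fun y _ => indicator_nonneg (fun _ _ => by positivity) _
    by_cases hw : w ∈ ball x r
    · have hwr : ‖w - x‖ < r := by simpa [dist_eq_norm] using hw
      obtain ⟨y, hy, hyw⟩ := ht (r⁻¹ • (w - x)) (by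
        rw [norm_smul, norm_inv, Real.norm_of_nonneg hr0.le, inv_mul_lt_iff₀ hr0]; linarith)
      have hmem : w ∈ ball (x + r • y) σ := by
        rw [mem_ball, dist_eq_norm]
        have : w - (x + r • y) = r • (r⁻¹ • (w - x) - y) := by
          rw [smul_sub, smul_inv_smul₀ hr0.ne']; abel
        rw [this, norm_smul, Real.norm_of_nonneg hr0.le, hσ, div_eq_mul_one_div]
        gcongr
      simp only [indicator_of_mem hw]
      calc v w ^ 2 = (ball (x + r • y) σ).indicator (fun w => v w ^ 2) w := by
            rw [indicator_of_mem hmem]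
        _ ≤ _ := Finset.single_le_sum (f := fun y => (ball (x + r • y) σ).indicator (fun w => v w ^ 2) w) hnn hy
    · rw [indicator_of_notMem hw]; exact Finset.sum_nonneg hnn
  have h5 : Mf v x r ≤ t.card * Real.exp (T - S + C3 k Λ) := by
    refine hsum.trans ((Finset.sum_le_card_nsmul _ _ _ hMi).trans ?_)
    simp
  have hpos := h.Mpos (by linarith) hr0 (hxr r (by linarith))
  have h6 := Real.log_le_log hpos h5
  rw [Real.log_mul (by positivity) (Real.exp_ne_zero _), Real.log_exp] at h6
  linarith

end Dat
end PartThirteen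


section PartFourteen
open Filter Function
variable {k : ℕ}

namespace Dat
variable {A : Euc k → Matrix (Fin k) (Fin k) ℝ} {v : Euc k → ℝ} {L : ℝ≥0} {Λ : ℝ}

lemma alpha_bd (h : Dat A v L Λ) {x : Euc k} (hx : x ∈ ball (0 : Euc k) 1) :
    Λ⁻¹ ≤ alphaFn A x ∧ alphaFn A x ≤ Λ := by
  have hΛ := h.hΛ
  have hp : 0 < Λ := by linarith
  unfold alphaFn
  split_ifs with h0
  · exact ⟨inv_le_one_of_one_le₀ hΛ, hΛ⟩
  · have hn : 0 < ‖x‖ ^ 2 := by have := norm_pos_iff.2 h0; positivity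
    have := h.hE x hx x
    rw [← EuclideanSpace.real_norm_sq_eq] at this
    rw [le_div_iff₀ hn, div_le_iff₀ hn]
    exact this

lemma H_int (h : Dat A v L Λ) {x : Euc k} {r : ℝ} (hr : r < 1 - ‖x‖) :
    IntegrableOn (fun z => alphaFn A z * v z ^ 2) (ball x r) := by
  have := h.nontriv
  have hsub : ball x r ⊆ ball 0 1 := ball_subset_closedBall.trans (cb_sub hr)
  have hae : (ball x r \ {0} : Set (Euc k)) =ᵐ[volume] ball x r :=
    diff_null_ae_eq_self (measure_singleton _)
  have hA : ∀ i j, ContinuousOn (fun x => A x i j) (ball 0 1) := fun i j => (h.hL i j).continuousOn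
  have hmeas : AEStronglyMeasurable (fun z => alphaFn A z * v z ^ 2) (volume.restrict (ball x r)) := by
    rw [← Measure.restrict_congr_set hae]
    refine ContinuousOn.aestronglyMeasurable ?_ (measurableSet_ball.diff (measurableSet_singleton _))
    have h1 : ContinuousOn (fun z : Euc k => (aForm (A z) (fun i => z i) (fun i => z i) / ‖z‖ ^ 2) * v z ^ 2)
        (ball x r \ {0}) := by
      have hs2 : ball x r \ {0} ⊆ ball (0 : Euc k) 1 := diff_subset.trans hsub
      refine ContinuousOn.mul (ContinuousOn.div ?_ (by fun_prop) ?_)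
        ((h.hv.continuousOn.mono hs2).pow 2)
      · unfold aForm
        refine continuousOn_finset_sum _ fun i _ => continuousOn_finset_sum _ fun j _ => ?_
        exact (((hA i j).mono hs2).mul (by fun_prop)).mul (by fun_prop)
      · intro z hz
        have : z ≠ 0 := by simpa using hz.2
        simpa using this
    refine h1.congr fun z hz => ?_
    have : z ≠ 0 := by simpa using hz.2
    simp [alphaFn, this]
  refine Integrable.mono' ((h.intOn hr).const_mul Λ) hmeas ?_
  filter_upwards [ae_restrict_mem measurableSet_ball] with z hz
  have hb := h.alpha_bd (hsub hz)
  have hp : 0 < Λ := by linarith [h.hΛ]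
  have hi : 0 < Λ⁻¹ := by positivity
  rw [Real.norm_of_nonneg (mul_nonneg (by linarith) (sq_nonneg _))]
  exact mul_le_mul_of_nonneg_right hb.2 (sq_nonneg _)

lemma H_bd (h : Dat A v L Λ) {x : Euc k} {r : ℝ} (hr : r < 1 - ‖x‖) :
    Λ⁻¹ * Mf v x r ≤ Hfun A v x r ∧ Hfun A v x r ≤ Λ * Mf v x r := by
  have hsub : ball x r ⊆ ball 0 1 := ball_subset_closedBall.trans (cb_sub hr)
  unfold Mf Hfun
  rw [← integral_const_mul, ← integral_const_mul]
  constructor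
  · refine setIntegral_mono_on ((h.intOn hr).const_mul _) (h.H_int hr) measurableSet_ball fun z hz => ?_
    exact mul_le_mul_of_nonneg_right (h.alpha_bd (hsub hz)).1 (sq_nonneg _)
  · refine setIntegral_mono_on (h.H_int hr) ((h.intOn hr).const_mul _) measurableSet_ball fun z hz => ?_
    exact mul_le_mul_of_nonneg_right (h.alpha_bd (hsub hz)).2 (sq_nonneg _)

lemma H_log (h : Dat A v L Λ) {x : Euc k} {r : ℝ} (h0 : 0 < r) (hr : r < 1 - ‖x‖) :
    0 < Hfun A v x r ∧ Real.log (Mf v x r) - Real.log Λ ≤ Real.log (Hfun A v x r) ∧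
      Real.log (Hfun A v x r) ≤ Real.log (Mf v x r) + Real.log Λ := by
  have hp : 0 < Λ := by linarith [h.hΛ]
  have hM := h.Mpos (by linarith) h0 hr
  obtain ⟨h1, h2⟩ := h.H_bd hr
  have hH : 0 < Hfun A v x r := lt_of_lt_of_le (by positivity) h1
  refine ⟨hH, ?_, ?_⟩
  · have := Real.log_le_log (by positivity) h1
    rw [Real.log_mul (by positivity) hM.ne', Real.log_inv] at this; linarith
  · have := Real.log_le_log hH h2
    rw [Real.log_mul (by positivity) hM.ne'] at this; linarith

set_option maxHeartbeats 1000000 in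
theorem main {k : ℕ} (hk : 2 ≤ k) (L : ℝ≥0) {Λ : ℝ} (hΛ : 1 ≤ Λ) : ∃ ρ₀ > 0, ∃ C₁ > 0, ∃ C₂ > 0,
    ∀ (A : Euc k → Matrix (Fin k) (Fin k) ℝ) (v : Euc k → ℝ), Dat A v L Λ →
      ∀ x : Euc k, ‖x‖ < 1 / 2 → ∀ r₁ r₂ : ℝ, 0 < r₁ → 2 * r₁ < r₂ → r₂ < ρ₀ →
        (r₂ / r₁) ^ (C₁⁻¹ * doubN A v x r₁ - C₂) ≤ Hfun A v x r₂ / Hfun A v x r₁ ∧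
        Hfun A v x r₂ / Hfun A v x r₁ ≤ (r₂ / r₁) ^ (C₁ * doubN A v x r₂ + C₂) := by
  have hΛ0 : 0 < Λ := by linarith
  obtain ⟨t, ht0, ht1, ht⟩ := exists_cover k (ε := 1 / (4 * (2 * Λ) ^ 4)) (by positivity)
  have hl2 : 0 < Real.log 2 := Real.log_pos (by norm_num)
  have hC30 := C3_nn (k := k) hΛ
  have hn0 : 0 ≤ Real.log t.card := Real.log_natCast_nonneg _
  obtain ⟨C4, hC4⟩ : ∃ C4, C4 = C3 k Λ + Real.log t.card := ⟨_, rfl⟩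
  have hC40 : 0 ≤ C4 := by rw [hC4]; positivity
  obtain ⟨δ, hδ⟩ : ∃ δ : ℝ, δ = (1 / 13) ^ ⌈4 * (2 * Λ) ^ 4⌉₊ := ⟨_, rfl⟩
  have hδ0 : 0 < δ := by rw [hδ]; positivity
  obtain ⟨q, hq⟩ : ∃ q, q = Real.log (2 * (2 * Λ) ^ 2) := ⟨_, rfl⟩
  have hq0 : 0 < q := by rw [hq]; exact Real.log_pos (by nlinarith)
  obtain ⟨C, hC⟩ : ∃ C, C = Real.log (4 * Λ ^ 4) := ⟨_, rfl⟩
  have hC0 : 0 ≤ C := by rw [hC]; exact Real.log_nonneg (by linarith [one_le_pow₀ hΛ (n := 4)])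
  obtain ⟨l, hl⟩ : ∃ l, l = Real.log Λ := ⟨_, rfl⟩
  have hl0 : 0 ≤ l := by rw [hl]; exact Real.log_nonneg hΛ
  obtain ⟨B, hB⟩ : ∃ B : ℝ, B = 6 + k := ⟨_, rfl⟩
  have hB0 : 0 ≤ B := by rw [hB]; positivity
  obtain ⟨C5, hC5⟩ : ∃ C5, C5 = C / (12 * q) + B / 24 + 4 + 2 * C / Real.log 2 := ⟨_, rfl⟩
  have hC50 : 0 ≤ C5 := by rw [hC5]; positivity
  obtain ⟨p, hp⟩ : ∃ p, p = 13 / Real.log 2 := ⟨_, rfl⟩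
  have hp0 : 0 < p := by rw [hp]; positivity
  obtain ⟨e, he⟩ : ∃ e, e = 2 * l / Real.log 2 := ⟨_, rfl⟩
  have he0 : 0 ≤ e := by rw [he]; positivity
  obtain ⟨C₁, hC₁⟩ : ∃ C₁, C₁ = p * δ⁻¹ + 24 * q + 1 := ⟨_, rfl⟩
  have hC₁0 : 1 ≤ C₁ := by
    have : 0 < p * δ⁻¹ := by positivity
    linarith
  have hC₁a : p * δ⁻¹ ≤ C₁ := by linarith
  have hC₁b : 24 * q ≤ C₁ := by
    have : 0 < p * δ⁻¹ := by positivity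
    linarith
  obtain ⟨C₂, hC₂⟩ : ∃ C₂, C₂ = C5 + 2 * l + e + (p * (δ⁻¹ * C4 + 2 * C) + B + 48 + 2 * l * C₁) + 1 := ⟨_, rfl⟩
  have hT : 0 ≤ p * (δ⁻¹ * C4 + 2 * C) + B + 48 + 2 * l * C₁ := by positivity
  have hC₂0 : 0 < C₂ := by linarith
  have hc0 := c0_pos (k := k) hΛ L
  refine ⟨c0 k L Λ / 4, by positivity, C₁, by linarith, C₂, hC₂0, ?_⟩
  intro A v h x hx r₁ r₂ h1 h2 h3
  have hc := h.c0_le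
  have h20 : 0 < r₂ := by linarith
  have hK := h.keyM' (show ‖x‖ < 3 / 4 by linarith)
  rw [← hC, ← hB] at hK
  have hm : ∀ r s, 0 < r → r ≤ s → s ≤ 2 * (c0 k L Λ / 4) →
      Real.log (Mf v x r) ≤ Real.log (Mf v x s) := by
    intro r s hr hrs hs
    exact Real.log_le_log (h.Mpos (by linarith) hr (by linarith))
      (h.Mmono (by linarith) (ball_subset_ball hrs))
  have lo := hK.lower (by linarith) hB0 hC0 hm h1 h2 h3.le
  have up := hK.upper (by linarith) hB0 hC0 hm h1 h2 h3.le
  have ch := h.chain_main hx h20 h3 ht0 ht1 ht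
  rw [← hq, ← hC5] at lo
  rw [← hp] at up
  rw [← hδ, ← hC4] at ch
  obtain ⟨p1, a1, b1⟩ := h.H_log h1 (by linarith : r₁ < 1 - ‖x‖)
  obtain ⟨p2, a2, b2⟩ := h.H_log h20 (by linarith : r₂ < 1 - ‖x‖)
  obtain ⟨p3, a3, b3⟩ := h.H_log (by linarith : 0 < 2 * r₁) (by linarith : 2 * r₁ < 1 - ‖x‖)
  obtain ⟨p4, a4, b4⟩ := h.H_log (by linarith : 0 < 2 * r₂) (by linarith : 2 * r₂ < 1 - ‖x‖)
  rw [← hl] at a1 b1 a2 b2 a3 b3 a4 b4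
  have n1 := hm r₁ (2 * r₁) h1 (by linarith) (by linarith)
  have n2 := hm r₂ (2 * r₂) h20 (by linarith) (by linarith)
  have hℓ2 : Real.log 2 ≤ Real.log (r₂ / r₁) :=
    Real.log_le_log (by norm_num) (by rw [le_div_iff₀ h1]; linarith)
  have hrr : 0 < r₂ / r₁ := by positivity
  have hqq : 0 < Hfun A v x r₂ / Hfun A v x r₁ := by positivity
  rw [Real.rpow_def_of_pos hrr, Real.rpow_def_of_pos hrr, ← Real.le_log_iff_exp_le hqq,
    ← Real.log_le_iff_le_exp hqq, doubN, doubN, Real.log_div p2.ne' p1.ne', Real.log_div p3.ne' p1.ne',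
    Real.log_div p4.ne' p2.ne']
  generalize Real.log (r₂ / r₁) = ℓ at *
  generalize Real.log (Hfun A v x r₁) = H1 at *
  generalize Real.log (Hfun A v x r₂) = H2 at *
  generalize Real.log (Hfun A v x (2 * r₁)) = H3 at *
  generalize Real.log (Hfun A v x (2 * r₂)) = H4 at *
  generalize Real.log (Mf v x r₁) = M1 at *
  generalize Real.log (Mf v x r₂) = M2 at *
  generalize Real.log (Mf v x (2 * r₁)) = M3 at *
  generalize Real.log (Mf v x (2 * r₂)) = M4 at *
  generalize Real.log (Mf v x (r₂ / (4 * (2 * Λ) ^ 4))) = M0 at *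
  have hℓ0 : 0 < ℓ := by linarith
  have hel : 2 * l ≤ e * ℓ := by
    rw [he, div_mul_eq_mul_div, le_div_iff₀ hl2]; gcongr
  constructor
  · have g1 : C₁⁻¹ * (H3 - H1) ≤ (M3 - M1) / (24 * q) + 2 * l := by
      have hi : C₁⁻¹ ≤ 1 := inv_le_one_of_one_le₀ hC₁0
      have hi0 : 0 < C₁⁻¹ := by positivity
      calc C₁⁻¹ * (H3 - H1) ≤ C₁⁻¹ * ((M3 - M1) + 2 * l) := by gcongr; linarith
        _ = (M3 - M1) / C₁ + C₁⁻¹ * (2 * l) := by ring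
        _ ≤ (M3 - M1) / (24 * q) + 1 * (2 * l) := by
          gcongr
        _ = _ := by ring
    have g2 : ℓ * (C₁⁻¹ * (H3 - H1) - C₂) ≤ ℓ * ((M3 - M1) / (24 * q) - C5 - e) := by
      gcongr ?_ * ?_
      linarith
    linarith
  · have g1 : M4 - M0 ≤ δ⁻¹ * (M4 - M2 + C4) := by
      rw [le_inv_mul_iff₀ hδ0]; exact ch
    have g2 : p * (M4 - M0 + 2 * C) + B + 48 + e ≤ C₁ * (H4 - H2) + C₂ := by
      have s1 : p * (M4 - M0 + 2 * C) ≤ p * (δ⁻¹ * (M4 - M2 + C4) + 2 * C) := by gcongr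
      have s2 : p * (δ⁻¹ * (M4 - M2 + C4) + 2 * C) =
        (p * δ⁻¹) * (M4 - M2) + p * (δ⁻¹ * C4 + 2 * C) := by ring
      have s3 : (p * δ⁻¹) * (M4 - M2) ≤ C₁ * (M4 - M2) := by gcongr
      have s4 : C₁ * (M4 - M2) ≤ C₁ * ((H4 - H2) + 2 * l) := by gcongr; linarith
      rw [hC₂]
      linarith
    have g3 := mul_le_mul_of_nonneg_left g2 hℓ0.le
    linarith

end Dat
end PartFourteen

/-- Let `v ∈ W^{1,2}_loc(B(0,1))` be a (not identically zero) weak solution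
of `div(A∇v) = 0` in `B = B(0,1) ⊆ ℝᵏ`, where `A` is symmetric, uniformly elliptic with
constant `Λ`, has `L`-Lipschitz entries, and `A(0) = Id`. Then there are constants
`ρ₀, C₁, C₂ > 0`, depending only on `k`, `L` and `Λ`, such that for every `x ∈ B(0,1/2)`
and all radii `0 < 2r₁ < r₂ < ρ₀`,
`(r₂/r₁)^{C₁⁻¹ 𝒩_v(x,r₁) − C₂} ≤ H_v(x,r₂)/H_v(x,r₁) ≤ (r₂/r₁)^{C₁ 𝒩_v(x,r₂) + C₂}`. -/
theorem statement_4 (k : ℕ) (hk : 2 ≤ k) (L : ℝ≥0) (Λ : ℝ) (hΛ : 1 ≤ Λ) :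
    ∃ ρ₀ > (0 : ℝ), ∃ C₁ > (0 : ℝ), ∃ C₂ > (0 : ℝ),
      ∀ A : Euc k → Matrix (Fin k) (Fin k) ℝ,
        (∀ x ∈ ball (0 : Euc k) 1, (A x).IsSymm) →
        LipEntries A L (ball 0 1) →
        UnifElliptic A Λ (ball 0 1) →
        A 0 = 1 →
        ∀ v : Euc k → ℝ,
          ContDiffOn ℝ 1 v (ball 0 1) →
          IsWeakSol A v (ball 0 1) →
          (∃ x ∈ ball (0 : Euc k) 1, v x ≠ 0) →
          ∀ x ∈ ball (0 : Euc k) (1 / 2), ∀ r₁ r₂ : ℝ,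
            0 < r₁ → 2 * r₁ < r₂ → r₂ < ρ₀ →
            (r₂ / r₁) ^ (C₁⁻¹ * doubN A v x r₁ - C₂) ≤ Hfun A v x r₂ / Hfun A v x r₁ ∧
            Hfun A v x r₂ / Hfun A v x r₁ ≤ (r₂ / r₁) ^ (C₁ * doubN A v x r₂ + C₂) := by
  obtain ⟨ρ₀, h1, C₁, h2, C₂, h3, H⟩ := Dat.main hk L hΛ
  refine ⟨ρ₀, h1, C₁, h2, C₂, h3, ?_⟩
  intro A hs hL hE _ v hv hw hn x hx r₁ r₂ hr1 hr2 hr3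
  exact H A v ⟨hk, hΛ, hs, hL, hE, hv, hw, hn⟩ x (by simpa using hx) r₁ r₂ hr1 hr2 hr3
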